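/- arXiv:1808.08611 — 3 statements merged into one kernel-verified Lean document; each statement's English description precedes it below -/
import Mathlib

section
/- (Coinvariant formulation of: for N ≥ 6 and 1 ≤ s ≤ ∞, the quantum reflection group H_N^{s+} is topologically generated by H_{N-1}^{s+} and S_N.) Let N ≥ 6, let s be an integer ≥ 1 or s = ∞, let k ∈ ℕ and ε = (ε_1,…,ε_k) ∈ {1,*}^k. If a linear functional f : (ℂ^N)^{⊗k} → ℂ is S_N-invariant and (q_{N-1}(u), ε)-invariant in 𝒜(H_{N-1}^{s+}), then f is (u, ε)-invariant in 𝒜(H_N^{s+}). -/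
noncomputable section

/-- The defining relations of the quantum reflection group algebra `𝒜(H_N^{s+})`:
each `u i j` is normal, the matrix `u` and its transpose are unitary, each
`p i j := u i j * (u i j)*` is idempotent and, when `s = some t` is finite,
`(u i j)^t = p i j`.  The value `s = none` encodes `s = ∞`, where the power relation
is omitted. -/
def IsReflection {N : ℕ} {A : Type} [Ring A] [Star A] (s : Option ℕ)
    (u : Fin N → Fin N → A) : Prop :=
  (∀ i j, u i j * star (u i j) = star (u i j) * u i j) ∧
  (∀ i j, ∑ k, u i k * star (u j k) = if i = j then 1 else 0) ∧
  (∀ i j, ∑ k, star (u k i) * u k j = if i = j then 1 else 0) ∧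
  (∀ i j, ∑ k, star (u i k) * u j k = if i = j then 1 else 0) ∧
  (∀ i j, ∑ k, u k i * star (u k j) = if i = j then 1 else 0) ∧
  (∀ i j, (u i j * star (u i j)) * (u i j * star (u i j)) = u i j * star (u i j)) ∧
  (∀ t : ℕ, s = some t → ∀ i j, u i j ^ t = u i j * star (u i j))

/-- The quantum reflection group algebra `𝒜(H_N^{s+})` (with `s = none` encoding
`s = ∞`), characterized (uniquely up to *-isomorphism) by its universal property. -/
structure QuantumReflection (N : ℕ) (s : Option ℕ) where
  carrier : Type
  [ringA : Ring carrier]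
  [algA : Algebra ℂ carrier]
  [starA : StarRing carrier]
  [smodA : StarModule ℂ carrier]
  u : Fin N → Fin N → carrier
  refl : IsReflection s u
  univ : ∀ (B : Type) [Ring B] [Algebra ℂ B] [StarRing B] [StarModule ℂ B]
      (v : Fin N → Fin N → B), IsReflection s v →
      ∃! φ : carrier →⋆ₐ[ℂ] B, ∀ i j, φ (u i j) = v i j

attribute [instance] QuantumReflection.ringA QuantumReflection.algA
  QuantumReflection.starA QuantumReflection.smodA

/-- The ordered product `g 0 * g 1 * ⋯ * g (k-1)` in a (noncommutative) monoid. -/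
def ordProd {B : Type} [Monoid B] {k : ℕ} (g : Fin k → B) : B :=
  ((List.finRange k).map g).prod

/-- `f`, encoding a linear functional on `(ℂ^N)^{⊗k}` via its values on the standard
basis, is `(v, ε)`-invariant, where `ε a = true` means the factor `v` and
`ε a = false` means the factor `star v`:
`∑_j f j • v_{j_1 i_1}^{ε_1} ⋯ v_{j_k i_k}^{ε_k} = f i • 1` for all `i`. -/
def IsStarInvariant {B : Type} [Ring B] [Algebra ℂ B] [Star B] {N k : ℕ}
    (v : Fin N → Fin N → B) (ε : Fin k → Bool) (f : (Fin k → Fin N) → ℂ) : Prop :=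
  ∀ i : Fin k → Fin N,
    ∑ j : Fin k → Fin N,
      f j • ordProd (fun a => if ε a then v (j a) (i a) else star (v (j a) (i a))) =
      f i • (1 : B)

/-- `f` is `S_N`-invariant. -/
def IsSymmInvariant {N k : ℕ} (f : (Fin k → Fin N) → ℂ) : Prop :=
  ∀ (σ : Equiv.Perm (Fin N)) (j : Fin k → Fin N), f (σ ∘ j) = f j

/-- The image family `q_M(u)`: the N×N matrix over the smaller algebra whose
(i,j) entry is `u i j` for `i, j < M` and `δ_{ij} · 1` otherwise. -/
def restrFam {A : Type} [Ring A] {M : ℕ} (N : ℕ) (u : Fin M → Fin M → A) :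
    Fin N → Fin N → A := fun i j =>
  if h : (i : ℕ) < M ∧ (j : ℕ) < M then u ⟨i, h.1⟩ ⟨j, h.2⟩
  else if (i : ℕ) = (j : ℕ) then 1 else 0

namespace TopGen

/-- A noncommutative polynomial with integer coefficients in letters coded by natural numbers. -/
abbrev Poly := List (ℤ × List ℕ)

/-- The rewriting rules `a d ↦ Σ c • m` of the twisted magic algebra. -/
def rules : List (ℕ × ℕ × Poly) :=
  [(2, 1, [(-1, [1, 2]), (-2, [0, 0])]),
   (2, 3, [(-1, [1, 6]), (-2, [0, 4])]),
   (2, 5, [(-1, [1, 8]), (-2, [0, 7]), (4, [])]),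
   (4, 0, [(-1, [3, 2]), (1, [1, 6]), (1, [0, 4]), (2, [0])]),
   (4, 1, [(1, [3, 0]), (-1, [1, 4]), (1, [0, 3]), (2, [1])]),
   (4, 3, [(1, [3, 4]), (1, [1, 7]), (-1, [0, 5]), (2, [3])]),
   (4, 4, [(-1, [3, 6]), (-1, [1, 8]), (-1, [0, 7]), (2, [4]), (3, [])]),
   (5, 0, [(-2, [3, 4]), (-1, [1, 7])]),
   (5, 1, [(-2, [3, 3]), (-1, [1, 5])]),
   (5, 2, [(-2, [3, 6]), (-1, [1, 8]), (4, [])]),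
   (6, 0, [(1, [4, 2]), (1, [2, 4]), (-1, [0, 6]), (2, [2])]),
   (6, 1, [(1, [3, 2]), (-2, [1, 6]), (-2, [0, 4]), (-4, [0])]),
   (6, 3, [(1, [3, 6]), (2, [1, 8]), (2, [0, 7]), (-4, [4]), (-4, [])]),
   (6, 4, [(1, [4, 6]), (-1, [2, 7]), (1, [0, 8]), (2, [6])]),
   (6, 5, [(-2, [4, 7]), (-1, [3, 8])]),
   (7, 0, [(2, [3, 6]), (2, [1, 8]), (1, [0, 7]), (-4, [4]), (-4, [])]),
   (7, 1, [(-2, [3, 4]), (-2, [1, 7]), (1, [0, 5]), (-4, [3])]),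
   (7, 2, [(-2, [4, 6]), (-1, [0, 8])]),
   (7, 3, [(1, [5, 4]), (1, [4, 5]), (-1, [3, 7]), (2, [5])]),
   (7, 4, [(-1, [5, 6]), (1, [4, 7]), (1, [3, 8]), (2, [7])]),
   (8, 0, [(-2, [4, 6]), (1, [2, 7]), (-2, [0, 8]), (-4, [6])]),
   (8, 1, [(-2, [3, 6]), (-3, [1, 8]), (-2, [0, 7]), (8, [4]), (8, [])]),
   (8, 2, [(-2, [6, 6]), (-1, [2, 8])]),
   (8, 3, [(1, [5, 6]), (-2, [4, 7]), (-2, [3, 8]), (-4, [7])]),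
   (8, 4, [(1, [7, 6]), (1, [6, 7]), (-1, [4, 8]), (2, [8])]),
   (8, 5, [(-2, [7, 7]), (-1, [5, 8])])]

/-- The right-hand side of the rule for the pair `a d`, if there is one. -/
def lookup (a d : ℕ) : Option Poly :=
  (rules.find? fun r => r.1 == a && r.2.1 == d).map fun r => r.2.2

/-- Rewrite the leftmost reducible pair of a word. -/
def red? : List ℕ → Option Poly
  | [] => none
  | [_] => none
  | a :: d :: l =>
    match lookup a d with
    | some m => some (m.map fun t => (t.1, t.2 ++ l))
    | none => (red? (d :: l)).map fun P => P.map fun t => (t.1, a :: t.2)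

theorem red?_some : ∀ {w : List ℕ} {P : Poly}, red? w = some P →
    ∃ p q a d m, lookup a d = some m ∧ w = p ++ a :: d :: q ∧
      P = m.map fun t => (t.1, p ++ t.2 ++ q)
  | [], _, h => by simp [red?] at h
  | [_], _, h => by simp [red?] at h
  | a :: d :: l, P, h => by
    rw [red?] at h
    rcases hl : lookup a d with _ | m
    · simp only [hl, Option.map_eq_some_iff] at h
      obtain ⟨P', h', rfl⟩ := h
      obtain ⟨p, q, a', d', m, hm, hw, rfl⟩ := red?_some h'
      exact ⟨a :: p, q, a', d', m, hm, by simp [hw], by simp⟩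
    · simp only [hl, Option.some.injEq] at h
      exact ⟨[], l, a, d, m, hl, rfl, by simp [← h]⟩

theorem red?_none : ∀ {w : List ℕ}, red? w = none →
    ∀ p q a d, w = p ++ a :: d :: q → lookup a d = none
  | [], _, p, q, a, d, h => by simp at h
  | [_], _, p, q, a, d, h => by
    have := congrArg List.length h
    simp at this
    omega
  | a :: d :: l, h, p, q, a', d', hw => by
    rw [red?] at h
    rcases hl : lookup a d with _ | m
    · simp only [hl, Option.map_eq_none_iff] at h
      rcases p with _ | ⟨x, p⟩
      · simp only [List.nil_append, List.cons.injEq] at hw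
        rw [← hw.1, ← hw.2.1, hl]
      · simp only [List.cons_append, List.cons.injEq] at hw
        exact red?_none h p q a' d' hw.2
    · simp [hl] at h

/-- The value of a polynomial under an evaluation of words. -/
def ev {M : Type*} [AddCommGroup M] (e : List ℕ → M) (P : Poly) : M :=
  (P.map fun t => t.1 • e t.2).sum

section ev
variable {M : Type*} [AddCommGroup M] (e : List ℕ → M)

@[simp] theorem ev_nil : ev e [] = 0 := rfl

@[simp] theorem ev_cons (t : ℤ × List ℕ) (P : Poly) : ev e (t :: P) = t.1 • e t.2 + ev e P := by
  simp [ev]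

@[simp] theorem ev_append (P R : Poly) : ev e (P ++ R) = ev e P + ev e R := by
  simp [ev]

@[simp] theorem ev_zero (P : Poly) : ev (fun _ => (0 : M)) P = 0 := by
  simp [ev]

theorem ev_map (F : List ℕ → List ℕ) (P : Poly) :
    ev e (P.map fun t => (t.1, F t.2)) = ev (fun u => e (F u)) P := by
  simp [ev, Function.comp_def]

theorem ev_scale_map (c : ℤ) (F : List ℕ → List ℕ) (P : Poly) :
    ev e (P.map fun t => (c * t.1, F t.2)) = c • ev (fun u => e (F u)) P := by
  induction P with
  | nil => simp
  | cons t P ih => simp [ih, mul_smul]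

theorem ev_congr {e e' : List ℕ → M} {P : Poly} (h : ∀ t ∈ P, e t.2 = e' t.2) :
    ev e P = ev e' P := by
  unfold ev
  congr 1
  exact List.map_congr_left fun t ht => by rw [h t ht]

theorem ev_comm (F : List ℕ → List ℕ → M) (P R : Poly) :
    ev (fun u => ev (fun v => F u v) R) P = ev (fun v => ev (fun u => F u v) P) R := by
  induction P with
  | nil => simp
  | cons t P ih =>
    simp only [ev_cons, ih]
    clear ih
    induction R with
    | nil => simp
    | cons r R ih => simp only [ev_cons, ← ih, smul_add, smul_comm t.1 r.1]; abel

/-- The evaluation `e` satisfies all rewriting relations at the word `w`. -/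
def RelAt (w : List ℕ) : Prop :=
  ∀ p q a d m, lookup a d = some m → w = p ++ a :: d :: q →
    e w = ev (fun u => e (p ++ u ++ q)) m

end ev

/-- A termination measure for rewriting. -/
def code : List ℕ → ℕ
  | [] => 0
  | x :: l => (x + 1) * 10 ^ l.length + code l

/-- Add a term to a polynomial, merging equal words. -/
def insertTerm (c : ℤ) (w : List ℕ) : Poly → Poly
  | [] => [(c, w)]
  | t :: P => if t.2 == w then (c + t.1, w) :: P else t :: insertTerm c w P

/-- Merge equal words. -/
def collect (P : Poly) : Poly := P.foldr (fun t R => insertTerm t.1 t.2 R) []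

/-- One reduction step applied to all terms. -/
def redPoly (P : Poly) : Poly :=
  collect (P.flatMap fun t => ((red? t.2).getD [(1, t.2)]).map fun r => (t.1 * r.1, r.2))

/-- Try to reduce a polynomial to `0`, using relations at words of code less than `b`. -/
def check (b : ℕ) : ℕ → Poly → Bool
  | 0, P => P.all fun t => t.1 == 0
  | n + 1, P => (P.all fun t => t.1 == 0) ||
      ((P.all fun t => decide (code t.2 < b)) && check b n (redPoly P))

section sound
variable {M : Type*} [AddCommGroup M] (e : List ℕ → M)

theorem ev_addTerm (c : ℤ) (w : List ℕ) (P : Poly) :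
    ev e (insertTerm c w P) = c • e w + ev e P := by
  induction P with
  | nil => simp [insertTerm]
  | cons t P ih =>
    rw [insertTerm]
    split_ifs with h
    · simp only [beq_iff_eq] at h
      simp [add_smul, h, add_assoc]
    · simp only [ev_cons, ih]; abel

theorem ev_collect (P : Poly) : ev e (collect P) = ev e P := by
  induction P with
  | nil => simp [collect]
  | cons t P ih =>
    rw [collect, List.foldr_cons, ev_addTerm, ev_cons]
    rw [collect] at ih
    rw [ih]

theorem ev_redPoly {P : Poly} (h : ∀ t ∈ P, RelAt e t.2) : ev e (redPoly P) = ev e P := by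
  rw [redPoly, ev_collect]
  induction P with
  | nil => simp
  | cons t P ih =>
    rw [List.flatMap_cons, ev_append, ih fun t ht => h t (List.mem_cons_of_mem _ ht), ev_scale_map (F := fun u => u),
      ev_cons]
    congr 2
    rcases hr : red? t.2 with _ | R
    · simp
    · obtain ⟨p, q, a, d, m, hm, hw, rfl⟩ := red?_some hr
      rw [Option.getD_some, ev_map (F := fun u => p ++ u ++ q)]
      exact (h t List.mem_cons_self p q a d m hm hw).symm

theorem ev_eq_zero_of_check {b : ℕ} (he : ∀ w, code w < b → RelAt e w) :
    ∀ (n : ℕ) (P : Poly), check b n P = true → ev e P = 0 := by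
  have h0 : ∀ P : Poly, (P.all fun t => t.1 == 0) = true → ev e P = 0 := by
    intro P h
    induction P with
    | nil => rfl
    | cons t P ih =>
      simp only [List.all_cons, Bool.and_eq_true, beq_iff_eq] at h
      simp [h.1, ih h.2]
  intro n
  induction n with
  | zero => exact h0
  | succ n ih =>
    intro P h
    rw [check, Bool.or_eq_true, Bool.and_eq_true] at h
    rcases h with h | ⟨h, h'⟩
    · exact h0 P h
    · rw [← ev_redPoly e fun t ht => he _ (by simpa using List.all_eq_true.1 h t ht)]
      exact ih _ h'

end sound

theorem lookup_some {a d : ℕ} {m : Poly} (h : lookup a d = some m) : (a, d, m) ∈ rules := by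
  rw [lookup, Option.map_eq_some_iff] at h
  obtain ⟨r, hr, rfl⟩ := h
  have h1 := List.find?_some hr
  simp only [Bool.and_eq_true, beq_iff_eq] at h1
  have h2 := List.mem_of_find?_eq_some hr
  rw [← h1.1, ← h1.2]
  exact h2

theorem overlaps_check : ∀ r ∈ rules, ∀ r' ∈ rules, r.2.1 = r'.1 →
    check (code [r.1, r.2.1, r'.2.1]) 20 (r.2.2.map (fun t => (t.1, t.2 ++ [r'.2.1])) ++
      r'.2.2.map fun t => (-1 * t.1, [r.1] ++ t.2)) = true := by
  decide +kernel

theorem code_append (p q : List ℕ) : code (p ++ q) = code p * 10 ^ q.length + code q := by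
  induction p with
  | nil => simp [code]
  | cons x p ih =>
    rw [List.cons_append, code, code, ih, List.length_append, pow_add]
    ring

theorem rules_decrease : ∀ r ∈ rules, ∀ t ∈ r.2.2,
    t.2.length ≤ 2 ∧ code t.2 < code [r.1, r.2.1] := by
  decide +kernel

theorem code_rewrite {a d : ℕ} {m : Poly} (h : lookup a d = some m) {t : ℤ × List ℕ}
    (ht : t ∈ m) (p q : List ℕ) : code (p ++ t.2 ++ q) < code (p ++ a :: d :: q) := by
  obtain ⟨h1, h2⟩ := rules_decrease _ (lookup_some h) t ht
  rw [show p ++ a :: d :: q = p ++ [a, d] ++ q by simp, code_append, code_append p, code_append _ q,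
    code_append p]
  have h3 : code p * 10 ^ t.2.length ≤ code p * 10 ^ [a, d].length :=
    Nat.mul_le_mul_left _ (Nat.pow_le_pow_right (by norm_num) h1)
  have : code p * 10 ^ t.2.length + code t.2 < code p * 10 ^ [a, d].length + code [a, d] :=
    Nat.add_lt_add_of_le_of_lt h3 h2
  have := Nat.mul_lt_mul_of_pos_right this (pow_pos (by norm_num : 0 < 10) q.length)
  omega

theorem code_red? {w : List ℕ} {P : Poly} (h : red? w = some P) {t : ℤ × List ℕ} (ht : t ∈ P) :
    code t.2 < code w := by
  obtain ⟨p, q, a, d, m, hm, rfl, rfl⟩ := red?_some h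
  rw [List.mem_map] at ht
  obtain ⟨t, ht, rfl⟩ := ht
  exact code_rewrite hm ht p q

/-- The functional on words extending prescribed values on words of length at most `n` and
compatible with the rewriting rules. -/
def ext (n : ℕ) (g : List ℕ → ℂ) (w : List ℕ) : ℂ :=
  if w.length ≤ n then g w
  else match h : red? w with
    | none => 0
    | some P => (P.attach.map fun t => t.1.1 • ext n g t.1.2).sum
termination_by code w
decreasing_by exact code_red? h t.2

theorem ext_of_le {n : ℕ} (g : List ℕ → ℂ) {w : List ℕ} (h : w.length ≤ n) :
    ext n g w = g w := by
  rw [ext, if_pos h]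

theorem ext_of_red? {n : ℕ} (g : List ℕ → ℂ) {w : List ℕ} (h : ¬ w.length ≤ n) {P : Poly}
    (hP : red? w = some P) : ext n g w = ev (ext n g) P := by
  rw [ext, if_neg h]
  split
  · simp_all
  · rename_i P' hP'
    rw [hP] at hP'
    obtain rfl := Option.some.inj hP'
    exact congrArg List.sum (List.attach_map_val (f := fun t : ℤ × List ℕ => t.1 • ext n g t.2) (l := P))

theorem two_splits {α : Type*} : ∀ {p q p' q' : List α} {a d a' d' : α},
    p ++ a :: d :: q = p' ++ a' :: d' :: q' → p.length ≤ p'.length →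
    (p = p' ∧ a = a' ∧ d = d' ∧ q = q') ∨
    (p' = p ++ [a] ∧ d = a' ∧ q = d' :: q') ∨
    ∃ r, p' = p ++ a :: d :: r ∧ q = r ++ a' :: d' :: q'
  | [], q, [], q', a, d, a', d', h, _ => by left; simpa using h
  | [], q, [x], q', a, d, a', d', h, _ => by
    right; left
    simp at h
    simp [h]
  | [], q, x :: y :: r, q', a, d, a', d', h, _ => by
    right; right
    simp at h
    exact ⟨r, by simp [h]⟩
  | x :: p, q, [], q', a, d, a', d', h, hl => by simp at hl
  | x :: p, q, y :: p', q', a, d, a', d', h, hl => by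
    simp only [List.cons_append, List.cons.injEq] at h
    have := two_splits h.2 (by simpa using hl)
    simpa [h.1] using this

theorem relAt_context {M : Type*} [AddCommGroup M] {e : List ℕ → M} {p q w : List ℕ}
    (he : RelAt e (p ++ w ++ q)) : RelAt (fun u => e (p ++ u ++ q)) w := by
  rintro p' q' a d m hm rfl
  have := he (p ++ p') (q' ++ q) a d m hm (by simp)
  simpa using this

theorem code_context {u w : List ℕ} (p q : List ℕ) (hl : code u < code w)
    (h : u.length ≤ w.length) : code (p ++ u ++ q) < code (p ++ w ++ q) := by
  rw [code_append, code_append p, code_append _ q, code_append p]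
  have h3 : code p * 10 ^ u.length ≤ code p * 10 ^ w.length :=
    Nat.mul_le_mul_left _ (Nat.pow_le_pow_right (by norm_num) h)
  have := Nat.mul_lt_mul_of_pos_right (Nat.add_lt_add_of_le_of_lt h3 hl)
    (pow_pos (by norm_num : 0 < 10) q.length)
  omega

theorem pow_le_code : ∀ {w : List ℕ}, w ≠ [] → 10 ^ (w.length - 1) ≤ code w
  | x :: l, _ => by
    rw [code]
    simp only [List.length_cons, Nat.add_sub_cancel]
    nlinarith [Nat.zero_le (x * 10 ^ l.length), Nat.zero_le (code l)]

theorem rules_letters : ∀ r ∈ rules, r.1 < 9 ∧ r.2.1 < 9 := by decide +kernel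

theorem diamond_of_le {e : List ℕ → ℂ} {w p q p' q' : List ℕ} {a d a' d' : ℕ} {m m' : Poly}
    (he : ∀ u, code u < code w → RelAt e u)
    (hw : w = p ++ a :: d :: q) (hw' : w = p' ++ a' :: d' :: q')
    (hm : lookup a d = some m) (hm' : lookup a' d' = some m') (hl : p.length ≤ p'.length) :
    ev (fun u => e (p ++ u ++ q)) m = ev (fun u => e (p' ++ u ++ q')) m' := by
  rcases two_splits (hw.symm.trans hw') hl with ⟨rfl, rfl, rfl, rfl⟩ | ⟨rfl, rfl, rfl⟩ | ⟨r, rfl, rfl⟩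
  · rw [hm] at hm'
    rw [Option.some.inj hm']
  · have hr := lookup_some hm
    have hr' := lookup_some hm'
    have h1 := rules_letters _ hr
    have h2 := rules_letters _ hr'
    have hc := overlaps_check _ hr _ hr' rfl
    have h0 := ev_eq_zero_of_check (fun u => e (p ++ u ++ q')) (b := code [a, d, d']) (fun u hu => by
      refine relAt_context (he _ ?_)
      rw [hw, show p ++ a :: d :: d' :: q' = p ++ [a, d, d'] ++ q' by simp]
      refine code_context p q' hu ?_
      by_contra hlen
      simp only [List.length_cons, List.length_nil] at hlen
      have h3 := pow_le_code (w := u) (by rintro rfl; simp at hlen)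
      have h4 : 10 ^ 3 ≤ 10 ^ (u.length - 1) := Nat.pow_le_pow_right (by norm_num) (by omega)
      simp only [code, List.length_cons, List.length_nil] at hu
      simp only at h1 h2
      omega) _ _ hc
    rw [ev_append, ev_map (F := fun v => v ++ [d']), ev_scale_map (F := fun v => [a] ++ v)] at h0
    simp only [neg_smul, one_smul, add_neg_eq_zero] at h0
    simpa using h0
  · have h1 : ∀ t ∈ m, e (p ++ t.2 ++ (r ++ a' :: d' :: q')) =
        ev (fun v => e (p ++ t.2 ++ r ++ v ++ q')) m' := fun t ht =>
      he _ (hw ▸ code_rewrite hm ht _ _) _ _ _ _ _ hm' (by simp)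
    have h2 : ∀ t ∈ m', e (p ++ a :: d :: r ++ t.2 ++ q') =
        ev (fun v => e (p ++ v ++ (r ++ t.2 ++ q'))) m := fun t ht =>
      he _ (hw' ▸ code_rewrite hm' ht _ _) _ _ _ _ _ hm (by simp)
    rw [ev_congr (e' := fun u => ev (fun v => e (p ++ u ++ r ++ v ++ q')) m') h1,
      ev_congr (e := fun v => e (p ++ a :: d :: r ++ v ++ q'))
        (e' := fun v => ev (fun u => e (p ++ u ++ (r ++ v ++ q'))) m) h2, ev_comm]
    simp only [List.append_assoc]

theorem relAt_ext {n : ℕ} {g : List ℕ → ℂ} (hg : ∀ w : List ℕ, w.length ≤ n → RelAt g w)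
    (w : List ℕ) : RelAt (ext n g) w := by
  induction hc : code w using Nat.strong_induction_on generalizing w with
  | _ c ih =>
  subst hc
  have he : ∀ u, code u < code w → RelAt (ext n g) u := fun u hu => ih _ hu u rfl
  rintro p q a d m hm hw
  by_cases hl : w.length ≤ n
  · rw [ext_of_le g hl, hg w hl p q a d m hm hw]
    refine ev_congr fun t ht => (ext_of_le g ?_).symm
    have := (rules_decrease _ (lookup_some hm) t ht).1
    rw [hw] at hl
    simp only [List.length_append, List.length_cons] at hl ⊢
    omega
  · rcases hr : red? w with _ | P
    · rw [red?_none hr p q a d hw] at hm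
      simp at hm
    · rw [ext_of_red? g hl hr]
      obtain ⟨p', q', a', d', m', hm', hw', rfl⟩ := red?_some hr
      rw [ev_map (F := fun u => p' ++ u ++ q')]
      rcases le_total p.length p'.length with h | h
      · exact (diamond_of_le he hw hw' hm hm' h).symm
      · exact diamond_of_le he hw' hw hm' hm h

/-- Functions on words satisfying the rewriting relations. -/
def relSub : Submodule ℂ (List ℕ → ℂ) where
  carrier := {Ψ | ∀ w, RelAt Ψ w}
  zero_mem' := by
    intro w p q a d m _ _
    exact (ev_zero m).symm
  add_mem' := by
    intro Ψ Θ h h' w p q a d m hm hw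
    simp only [Pi.add_apply]
    rw [h w p q a d m hm hw, h' w p q a d m hm hw]
    clear hm
    induction m with
    | nil => simp
    | cons t m ih => simp only [ev_cons, smul_add, ← ih]; abel
  smul_mem' := by
    intro c Ψ h w p q a d m hm hw
    simp only [Pi.smul_apply]
    rw [h w p q a d m hm hw]
    clear hm
    induction m with
    | nil => simp
    | cons t m ih => simp only [ev_cons, smul_add, ← ih, smul_comm c t.1]

/-- Appending a letter, as an operator on functions of words. -/
def appendLetter (a : ℕ) : Module.End ℂ relSub where
  toFun Ψ := ⟨fun w => Ψ.1 (w ++ [a]), by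
    rintro w p q b d m hm rfl
    simpa using Ψ.2 _ p (q ++ [a]) b d m hm (by simp)⟩
  map_add' _ _ := rfl
  map_smul' _ _ := rfl

theorem prod_appendLetter (y : List ℕ) (Ψ : relSub) (w : List ℕ) :
    ((y.map appendLetter).prod Ψ).1 w = Ψ.1 (w ++ y) := by
  induction y generalizing w with
  | nil => simp
  | cons a y ih =>
    rw [List.map_cons, List.prod_cons, Module.End.mul_apply]
    change ((y.map appendLetter).prod Ψ).1 (w ++ [a]) = _
    rw [ih]
    simp

theorem ev_apply (e : List ℕ → Module.End ℂ relSub) (P : Poly) (Ψ : relSub) (w : List ℕ) :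
    (ev e P Ψ).1 w = ev (fun u => (e u Ψ).1 w) P := by
  induction P with
  | nil => simp
  | cons t P ih => simp [ih]

theorem appendLetter_rel {a d : ℕ} {m : Poly} (h : lookup a d = some m) :
    appendLetter a * appendLetter d = ev (fun u => (u.map appendLetter).prod) m := by
  refine LinearMap.ext fun Ψ => Subtype.ext (funext fun w => ?_)
  rw [ev_apply]
  simp only [prod_appendLetter]
  have := Ψ.2 _ w [] a d m h rfl
  simp only [List.append_nil] at this
  rw [← this]
  change Ψ.1 (w ++ [a] ++ [d]) = _
  simp

/-- Truncate a function on words to words of length `n` in the letters `0, 1, 2`. -/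
def trunc (n : ℕ) (g : List ℕ → ℂ) (w : List ℕ) : ℂ :=
  if w.length = n ∧ ∀ x ∈ w, x < 3 then g w else 0

theorem rules_grading : ∀ r ∈ rules,
    (r.1 = 2 ∧ r.2.1 = 1 ∧ r.2.2 = [(-1, [1, 2]), (-2, [0, 0])]) ∨
    ((3 ≤ r.1 ∨ 3 ≤ r.2.1) ∧ ∀ t ∈ r.2.2, t.2.length < 2 ∨ ∃ x ∈ t.2, 3 ≤ x) := by
  decide +kernel

theorem relAt_trunc {n : ℕ} {g : List ℕ → ℂ}
    (hg : ∀ p q : List ℕ, p.length + q.length + 2 = n → (∀ x ∈ p, x < 3) → (∀ x ∈ q, x < 3) →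
      g (p ++ 2 :: 1 :: q) = - g (p ++ 1 :: 2 :: q) - 2 * g (p ++ 0 :: 0 :: q))
    (w : List ℕ) (hw : w.length ≤ n) : RelAt (trunc n g) w := by
  rintro p q a d m hm rfl
  have hd := rules_decrease _ (lookup_some hm)
  rcases rules_grading _ (lookup_some hm) with ⟨h1, h2, h3⟩ | ⟨h1, h2⟩
  · simp only at h1 h2 h3
    subst h1 h2 h3
    by_cases h : (p.length + q.length + 2 = n) ∧ (∀ x ∈ p, x < 3) ∧ (∀ x ∈ q, x < 3)
    · obtain ⟨h1, h2, h3⟩ := h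
      have h4 : ∀ u : List ℕ, u.length = 2 → (∀ x ∈ u, x < 3) →
          trunc n g (p ++ u ++ q) = g (p ++ u ++ q) := by
        intro u hu hu'
        rw [trunc, if_pos]
        constructor
        · simp only [List.length_append]; omega
        · intro x hx
          simp only [List.mem_append] at hx
          rcases hx with (hx | hx) | hx
          exacts [h2 x hx, hu' x hx, h3 x hx]
      have h5 := h4 [2, 1] rfl (by decide)
      simp only [ev_cons, ev_nil]
      rw [h4 [1, 2] rfl (by decide), h4 [0, 0] rfl (by decide)]
      simp only [List.append_assoc, List.cons_append, List.nil_append] at h5 ⊢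
      rw [h5, hg p q h1 h2 h3]
      simp
      ring
    · have h4 : ∀ u : List ℕ, u.length = 2 → trunc n g (p ++ u ++ q) = 0 := by
        intro u hu
        rw [trunc, if_neg]
        rintro ⟨h1, h2⟩
        refine h ⟨?_, fun x hx => h2 x (by simp [hx]), fun x hx => h2 x (by simp [hx])⟩
        simp only [List.length_append] at h1
        omega
      have h5 := h4 [2, 1] rfl
      simp only [ev_cons, ev_nil]
      rw [h4 [1, 2] rfl, h4 [0, 0] rfl]
      simp only [List.append_assoc, List.cons_append, List.nil_append] at h5 ⊢
      rw [h5]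
      simp
  · rw [trunc, if_neg]
    · rw [ev_congr (e' := fun _ => 0), ev_zero]
      intro t ht
      rw [trunc, if_neg]
      rintro ⟨h3, h4⟩
      rcases h2 t ht with h | ⟨x, hx, hx'⟩
      · simp only [List.length_append, List.length_cons] at h3 hw
        omega
      · exact absurd (h4 x (by simp [hx])) (by omega)
    · rintro ⟨-, h3⟩
      simp only at h1
      have := h3 a (by simp)
      have := h3 d (by simp)
      omega

/-- For suitable `g` there is a vector in the representation of the twisted magic algebra whose
coefficients along products of the letters `0, 1, 2` are given by `g`. -/
theorem exists_vector {n : ℕ} {g : List ℕ → ℂ}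
    (hg : ∀ p q : List ℕ, p.length + q.length + 2 = n → (∀ x ∈ p, x < 3) → (∀ x ∈ q, x < 3) →
      g (p ++ 2 :: 1 :: q) = - g (p ++ 1 :: 2 :: q) - 2 * g (p ++ 0 :: 0 :: q)) :
    ∃ Ψ : relSub, ∀ w : List ℕ, w.length ≤ n → Ψ.1 w = trunc n g w :=
  ⟨⟨ext n (trunc n g), relAt_ext (relAt_trunc hg)⟩, fun _ h => ext_of_le _ h⟩

/-- A matrix of idempotents satisfying the orthogonality relations of a magic unitary. -/
structure IsMagic {M : ℕ} {B : Type*} [Ring B] (p : Fin M → Fin M → B) : Prop where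
  idem : ∀ i j, p i j * p i j = p i j
  row : ∀ i j, ∑ k, p i k * p j k = if i = j then 1 else 0
  col : ∀ i j, ∑ k, p k i * p k j = if i = j then 1 else 0

/-- The entries of the four monomial `2 × 2` blocks: a letter together with a sign. -/
def blk : Fin 4 → Fin 2 → Fin 2 → Fin 3 × ℤ :=
  ![![![(0, 1), (2, 1)], ![(1, 1), (0, -1)]],
    ![![(0, -1), (1, 1)], ![(2, 1), (0, 1)]],
    ![![(0, -1), (1, -1)], ![(2, -1), (0, 1)]],
    ![![(0, 1), (2, -1)], ![(1, -1), (0, -1)]]]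

/-- The numbering of the nine generators. -/
def gen : Fin 3 → Fin 3 → ℕ := ![![4, 0, 7], ![3, 1, 5], ![6, 2, 8]]

/-- The entries of four times the twisted magic unitary. -/
def entry (g h : Fin 4) (i j : Fin 2 × Fin 2) : Poly :=
  (if i = j then [(1, [])] else []) ++
    [((blk g i.2 j.2).2 * (blk h i.1 j.1).2, [gen (blk g i.2 j.2).1 (blk h i.1 j.1).1])]

/-- The product of polynomials. -/
def mulPoly (P R : Poly) : Poly := P.flatMap fun t => R.map fun r => (t.1 * r.1, t.2 ++ r.2)

/-- An entry of the product of two entries of the magic unitary. -/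
def entryMul (g h g' h' : Fin 4) (i j : Fin 2 × Fin 2) : Poly :=
  mulPoly (entry g h i (0, 0)) (entry g' h' (0, 0) j) ++
    mulPoly (entry g h i (0, 1)) (entry g' h' (0, 1) j) ++
    (mulPoly (entry g h i (1, 0)) (entry g' h' (1, 0) j) ++
    mulPoly (entry g h i (1, 1)) (entry g' h' (1, 1) j))

theorem check_idem : ∀ g h : Fin 4, ∀ i j : Fin 2 × Fin 2,
    check 1000 20 (collect
      (entryMul g h g h i j ++ (entry g h i j).map fun t => (-4 * t.1, t.2))) = true := by
  decide +kernel

theorem check_row : ∀ g h : Fin 4, ∀ i j : Fin 2 × Fin 2,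
    check 1000 20 (collect (entryMul g 0 h 0 i j ++ entryMul g 1 h 1 i j ++ entryMul g 2 h 2 i j ++
      entryMul g 3 h 3 i j ++
      if g = h ∧ i = j then [(-16, [])] else [])) = true := by
  decide +kernel

theorem check_col : ∀ g h : Fin 4, ∀ i j : Fin 2 × Fin 2,
    check 1000 20 (collect (entryMul 0 g 0 h i j ++ entryMul 1 g 1 h i j ++ entryMul 2 g 2 h i j ++
      entryMul 3 g 3 h i j ++
      if g = h ∧ i = j then [(-16, [])] else [])) = true := by
  decide +kernel

/-- The evaluation of words in the representation. -/
def word (u : List ℕ) : Module.End ℂ relSub := (u.map appendLetter).prod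

theorem relAt_word (w : List ℕ) : RelAt word w := by
  rintro p q a d m hm rfl
  have : word (p ++ a :: d :: q) = word p * (appendLetter a * appendLetter d) * word q := by
    simp [word, mul_assoc]
  rw [this, appendLetter_rel hm]
  change word p * ev word m * word q = _
  clear hm
  induction m with
  | nil => simp
  | cons t m ih =>
    rw [ev_cons, ev_cons, mul_add, add_mul, ih]
    simp [word, mul_assoc]

theorem ev_word_append (v : List ℕ) (R : Poly) :
    ev (fun u => word (v ++ u)) R = word v * ev word R := by
  induction R with
  | nil => simp
  | cons r R ih => rw [ev_cons, ev_cons, ih, mul_add]; simp [word]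

theorem ev_mulPoly (P R : Poly) : ev word (mulPoly P R) = ev word P * ev word R := by
  induction P with
  | nil => simp [mulPoly]
  | cons t P ih =>
    rw [mulPoly, List.flatMap_cons, ev_append, ev_scale_map (F := fun u => t.2 ++ u), ev_cons,
      add_mul, ← ih, mulPoly]
    congr 1
    rw [ev_word_append, smul_mul_assoc]

/-- The coefficient algebra of the twisted magic unitary. -/
abbrev TwistAlg := Matrix (Fin 2 × Fin 2) (Fin 2 × Fin 2) (Module.End ℂ relSub)

/-- Four times the twisted magic unitary. -/
def twist4 (g h : Fin 4) : TwistAlg := Matrix.of fun i j => ev word (entry g h i j)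

theorem twist4_mul (g h g' h' : Fin 4) (i j : Fin 2 × Fin 2) :
    (twist4 g h * twist4 g' h') i j = ev word (entryMul g h g' h' i j) := by
  simp only [Matrix.mul_apply, Fintype.sum_prod_type, Fin.sum_univ_two, entryMul, ev_append,
    ev_mulPoly, twist4, Matrix.of_apply]

theorem eq_smul_of_add_eq_zero {A : Type*} [Ring A] [Algebra ℂ A] {x y : A} {n : ℤ}
    (h : x + (-n) • y = 0) : x = (n : ℂ) • y := by
  rw [neg_smul, add_neg_eq_zero] at h
  rw [h, Int.cast_smul_eq_zsmul]

/-- A magic unitary of size four. -/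
def twist (g h : Fin 4) : TwistAlg := (1 / 4 : ℂ) • twist4 g h

theorem twist_isMagic : IsMagic twist where
  idem g h := by
    have : twist4 g h * twist4 g h = (4 : ℂ) • twist4 g h := by
      ext1 i j
      have := ev_eq_zero_of_check word (fun w _ => relAt_word w) _ _ (check_idem g h i j)
      rw [ev_collect, ev_append, ev_scale_map (F := fun u => u), ← twist4_mul] at this
      exact (eq_smul_of_add_eq_zero (n := 4) this).trans (by simp [twist4])
    rw [twist, smul_mul_smul_comm, this, smul_smul]
    norm_num
  row g h := by
    have : ∑ k, twist4 g k * twist4 h k = if g = h then (16 : ℂ) • 1 else 0 := by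
      ext1 i j
      have := ev_eq_zero_of_check word (fun w _ => relAt_word w) _ _ (check_row g h i j)
      simp only [ev_collect, ev_append, ← twist4_mul] at this
      rw [Fin.sum_univ_four, Matrix.add_apply, Matrix.add_apply, Matrix.add_apply]
      by_cases hgi : g = h ∧ i = j
      · rw [if_pos hgi, ev_cons, ev_nil, add_zero] at this
        rw [if_pos hgi.1, hgi.2, Matrix.smul_apply, Matrix.one_apply_eq]
        rw [hgi.2] at this
        exact (eq_smul_of_add_eq_zero (n := 16) this).trans (by simp [word])
      · rw [if_neg hgi, ev_nil, add_zero] at this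
        rw [this]
        by_cases hg : g = h
        · simp [hg, Matrix.one_apply_ne fun h => hgi ⟨hg, h⟩]
        · simp [hg]
    simp only [twist, smul_mul_smul_comm, ← Finset.smul_sum, this]
    split_ifs
    · rw [smul_smul]; norm_num
    · simp
  col g h := by
    have : ∑ k, twist4 k g * twist4 k h = if g = h then (16 : ℂ) • 1 else 0 := by
      ext1 i j
      have := ev_eq_zero_of_check word (fun w _ => relAt_word w) _ _ (check_col g h i j)
      simp only [ev_collect, ev_append, ← twist4_mul] at this
      rw [Fin.sum_univ_four, Matrix.add_apply, Matrix.add_apply, Matrix.add_apply]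
      by_cases hgi : g = h ∧ i = j
      · rw [if_pos hgi, ev_cons, ev_nil, add_zero] at this
        rw [if_pos hgi.1, hgi.2, Matrix.smul_apply, Matrix.one_apply_eq]
        rw [hgi.2] at this
        exact (eq_smul_of_add_eq_zero (n := 16) this).trans (by simp [word])
      · rw [if_neg hgi, ev_nil, add_zero] at this
        rw [this]
        by_cases hg : g = h
        · simp [hg, Matrix.one_apply_ne fun h => hgi ⟨hg, h⟩]
        · simp [hg]
    simp only [twist, smul_mul_smul_comm, ← Finset.smul_sum, this]
    split_ifs
    · rw [smul_smul]; norm_num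
    · simp

section evl
variable {ι : Type*} [Fintype ι] {M M' : Type*} [AddCommGroup M] [Module ℂ M] [AddCommGroup M']
  [Module ℂ M']

/-- Contract the arguments of a function on words against a list of vectors. -/
def evl : List (ι → ℂ) → (List ι → M) → M
  | [], G => G []
  | v :: V, G => ∑ c, v c • evl V fun w => G (c :: w)

theorem evl_congr {V : List (ι → ℂ)} {G G' : List ι → M}
    (h : ∀ w, w.length = V.length → G w = G' w) : evl V G = evl V G' := by
  induction V generalizing G G' with
  | nil => exact h [] rfl
  | cons v V ih =>
    simp only [evl]
    exact Finset.sum_congr rfl fun c _ => by rw [ih fun w hw => h (c :: w) (by simpa using hw)]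

theorem map_evl (L : M →ₗ[ℂ] M') (V : List (ι → ℂ)) (G : List ι → M) :
    L (evl V G) = evl V fun w => L (G w) := by
  induction V generalizing G with
  | nil => rfl
  | cons v V ih => simp only [evl, map_sum, map_smul, ih]

theorem evl_zero (V : List (ι → ℂ)) : evl V (fun _ => (0 : M)) = 0 := by
  induction V with
  | nil => rfl
  | cons v V ih => simp [evl, ih]

theorem evl_add (V : List (ι → ℂ)) (G G' : List ι → M) :
    evl V (fun w => G w + G' w) = evl V G + evl V G' := by
  induction V generalizing G G' with
  | nil => rfl
  | cons v V ih => simp only [evl, ih, smul_add, Finset.sum_add_distrib]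

theorem evl_smul (V : List (ι → ℂ)) (a : ℂ) (G : List ι → M) :
    evl V (fun w => a • G w) = a • evl V G :=
  (map_evl (LinearMap.lsmul ℂ M a) V G).symm

theorem evl_sum {α : Type*} (s : Finset α) (V : List (ι → ℂ)) (G : α → List ι → M) :
    evl V (fun w => ∑ a ∈ s, G a w) = ∑ a ∈ s, evl V (G a) := by
  classical
  induction s using Finset.induction_on with
  | empty => simp [evl_zero]
  | insert a s ha ih => simp only [Finset.sum_insert ha, evl_add, ih]

theorem evl_eq_zero {V : List (ι → ℂ)} {G : List ι → M}
    (h : ∀ w, w.length = V.length → G w = 0) : evl V G = 0 :=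
  (evl_congr h).trans (evl_zero V)

theorem evl_ones_eq_zero {h : List ι → ℂ} (h0 : ∀ w, ∃ r : ℝ, 0 ≤ r ∧ h w = r) (k : ℕ)
    (hk : evl (List.replicate k fun _ => 1) h = 0) (w : List ι) (hw : w.length = k) : h w = 0 := by
  have key : ∀ (k : ℕ) (h : List ι → ℂ), (∀ w, ∃ r : ℝ, 0 ≤ r ∧ h w = r) →
      ∃ R : ℝ, 0 ≤ R ∧ evl (List.replicate k fun _ => 1) h = R ∧
        ∀ w : List ι, w.length = k → ∃ r : ℝ, 0 ≤ r ∧ r ≤ R ∧ h w = r := by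
    intro k
    induction k with
    | zero =>
      intro h h0
      obtain ⟨r, hr, hr'⟩ := h0 []
      refine ⟨r, hr, hr', fun w hw => ⟨r, hr, le_rfl, ?_⟩⟩
      rw [List.length_eq_zero_iff.1 hw, hr']
    | succ k ih =>
      intro h h0
      choose R hR hR' hR'' using fun c => ih (fun w => h (c :: w)) fun w => h0 (c :: w)
      refine ⟨∑ c, R c, Finset.sum_nonneg fun c _ => hR c, ?_, ?_⟩
      · simp [List.replicate_succ, evl, hR']
      · rintro (_ | ⟨c, w⟩) hw
        · simp at hw
        · obtain ⟨r, hr, hr', hr''⟩ := hR'' c w (by simpa using hw)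
          exact ⟨r, hr, hr'.trans (Finset.single_le_sum (fun c _ => hR c) (Finset.mem_univ c)), hr''⟩
  obtain ⟨R, hR, hR', hR''⟩ := key k h h0
  obtain ⟨r, hr, hr', hr''⟩ := hR'' w hw
  rw [hk] at hR'
  rw [hr'', le_antisymm (hr'.trans (Complex.ofReal_eq_zero.1 hR'.symm).le) hr]
  simp

end evl

section act
variable {ι : Type*} [Fintype ι] {A : Type*} [Ring A] [Algebra ℂ A]

/-- The coaction given by the matrices `v e`, applied to a functional `f` on words and evaluated
at a word. -/
def act (v : Bool → ι → ι → A) : List Bool → List ι → (List ι → ℂ) → A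
  | [], [], f => f [] • (1 : A)
  | e :: ε, i :: w, f => ∑ j, v e j i * act v ε w fun u => f (j :: u)
  | _, _, _ => 0

/-- Invariance of a functional on words under the coaction. -/
def Inv (v : Bool → ι → ι → A) (ε : List Bool) (f : List ι → ℂ) : Prop :=
  ∀ w, w.length = ε.length → act v ε w f = f w • (1 : A)

/-- The coaction with columns contracted against vectors. -/
def colAct (v : Bool → ι → ι → A) : List Bool → List (ι → ℂ) → (List ι → ℂ) → A
  | [], [], f => f [] • (1 : A)
  | e :: ε, x :: V, f => ∑ j, (∑ i, x i • v e j i) * colAct v ε V fun u => f (j :: u)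
  | _, _, _ => 0

theorem evl_act (v : Bool → ι → ι → A) (ε : List Bool) (V : List (ι → ℂ))
    (h : V.length = ε.length) (f : List ι → ℂ) :
    evl V (fun w => act v ε w f) = colAct v ε V f := by
  induction ε generalizing V f with
  | nil =>
    rw [List.length_nil, List.length_eq_zero_iff] at h
    subst h
    rfl
  | cons e ε ih =>
    rcases V with _ | ⟨x, V⟩
    · simp at h
    · have h' : V.length = ε.length := by simpa using h
      simp only [evl, act, colAct, evl_sum, Finset.sum_mul, Finset.smul_sum]
      rw [Finset.sum_comm]
      refine Finset.sum_congr rfl fun j _ => Finset.sum_congr rfl fun i _ => ?_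
      rw [← ih V h', smul_mul_assoc]
      congr 1
      exact (map_evl (LinearMap.mulLeft ℂ (v e j i)) V _).symm

theorem Inv.colAct {v : Bool → ι → ι → A} {ε : List Bool} {f : List ι → ℂ} (hf : Inv v ε f)
    {V : List (ι → ℂ)} (h : V.length = ε.length) :
    colAct v ε V f = evl V f • (1 : A) := by
  rw [← evl_act v ε V h, evl_congr fun w hw => hf w (hw.trans h)]
  exact (map_evl (LinearMap.toSpanSingleton ℂ A 1) V f).symm

end act

/-- The coefficient of the letter `x` in an entry of a monomial block. -/
def mc (x : Fin 3) (b : Fin 4) (r t : Fin 2) : ℂ :=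
  if (blk b r t).1 = x then ((blk b r t).2 : ℂ) else 0

/-- The transform of a functional on words in four letters by the monomial blocks. -/
def hat : (List (Fin 4) → ℂ) → Fin 2 → Fin 2 → List (Fin 3) → ℂ
  | f, r, s, [] => if r = s then f [] else 0
  | f, r, s, x :: v => ∑ b, ∑ t, mc x b r t * hat (fun u => f (b :: u)) t s v

/-- All contractions of adjacent letters vanish on words of length `k`. -/
def CupFree {ι : Type*} [Fintype ι] (k : ℕ) (f : List ι → ℂ) : Prop :=
  ∀ u v : List ι, u.length + v.length + 2 = k → ∑ c, f (u ++ c :: c :: v) = 0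

/-- All sums over a single letter vanish on words of length `k`. -/
def SingleFree {ι : Type*} [Fintype ι] (k : ℕ) (f : List ι → ℂ) : Prop :=
  ∀ u v : List ι, u.length + v.length + 1 = k → ∑ c, f (u ++ c :: v) = 0

theorem CupFree.cons {ι : Type*} [Fintype ι] {k : ℕ} {f : List ι → ℂ} (h : CupFree (k + 1) f)
    (b : ι) : CupFree k fun u => f (b :: u) := fun u v hk =>
  h (b :: u) v (by simp only [List.length_cons]; omega)

theorem SingleFree.cons {ι : Type*} [Fintype ι] {k : ℕ} {f : List ι → ℂ}
    (h : SingleFree (k + 1) f) (b : ι) : SingleFree k fun u => f (b :: u) := fun u v hk =>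
  h (b :: u) v (by simp only [List.length_cons]; omega)

theorem hat_sum {α : Type*} (F : Finset α) (f : α → List (Fin 4) → ℂ) (r s : Fin 2)
    (v : List (Fin 3)) : ∑ a ∈ F, hat (f a) r s v = hat (fun u => ∑ a ∈ F, f a u) r s v := by
  induction v generalizing f r with
  | nil =>
    simp only [hat]
    split_ifs <;> simp
  | cons x v ih =>
    simp only [hat, ← ih, Finset.mul_sum]
    rw [Finset.sum_comm]
    refine Finset.sum_congr rfl fun b _ => Finset.sum_comm

theorem hat_eq_zero {f : List (Fin 4) → ℂ} {v : List (Fin 3)} (r s : Fin 2)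
    (h : ∀ u, u.length = v.length → f u = 0) : hat f r s v = 0 := by
  induction v generalizing f r with
  | nil => simp [hat, h [] rfl]
  | cons x v ih =>
    rw [hat]
    refine Finset.sum_eq_zero fun b _ => Finset.sum_eq_zero fun t _ => ?_
    rw [ih t fun u hu => h _ (by simpa using hu), mul_zero]

theorem mc_identity (b b' : Fin 4) (r t : Fin 2) :
    ∑ s, (2 * (mc 2 b r s * mc 1 b' s t) + 2 * (mc 1 b r s * mc 2 b' s t) +
      mc 0 b r s * mc 0 b' s t) = if r = t then (if b = b' then 3 else -1) else 0 := by
  rw [Fin.sum_univ_two]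
  fin_cases b <;> fin_cases b' <;> fin_cases r <;> fin_cases t <;> simp [mc, blk] <;> norm_num

theorem hat_cup {k : ℕ} {f : List (Fin 4) → ℂ} (hc : CupFree k f) (hs : SingleFree k f)
    (r s : Fin 2) (p q : List (Fin 3)) (h : p.length + q.length + 2 = k) :
    2 * hat f r s (p ++ 2 :: 1 :: q) + 2 * hat f r s (p ++ 1 :: 2 :: q) +
      hat f r s (p ++ 0 :: 0 :: q) = 0 := by
  induction p generalizing f r k with
  | nil =>
    have h1 : 2 * hat f r s ([] ++ 2 :: 1 :: q) + 2 * hat f r s ([] ++ 1 :: 2 :: q) +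
        hat f r s ([] ++ 0 :: 0 :: q) = ∑ b, ∑ b', ∑ t, (∑ t', (2 * (mc 2 b r t' * mc 1 b' t' t) +
          2 * (mc 1 b r t' * mc 2 b' t' t) + mc 0 b r t' * mc 0 b' t' t)) *
          hat (fun u => f (b :: b' :: u)) t s q := by
      simp only [List.nil_append, hat, Finset.mul_sum, Finset.sum_mul, ← Finset.sum_add_distrib]
      refine Finset.sum_congr rfl fun b _ => ?_
      rw [Finset.sum_comm]
      refine Finset.sum_congr rfl fun b' _ => ?_
      rw [Finset.sum_comm]
      refine Finset.sum_congr rfl fun t _ => Finset.sum_congr rfl fun t' _ => ?_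
      ring
    have h2 : ∀ b b' : Fin 4, ∑ t, (if r = t then (if b = b' then 3 else -1) else 0) *
          hat (fun u => f (b :: b' :: u)) t s q = (if b = b' then 4 else 0) *
          hat (fun u => f (b :: b' :: u)) r s q - hat (fun u => f (b :: b' :: u)) r s q := by
      intro b b'
      simp only [ite_mul, zero_mul, Finset.sum_ite_eq, Finset.mem_univ, if_true]
      split_ifs <;> ring
    rw [h1]
    simp only [mc_identity, h2]
    simp only [Finset.sum_sub_distrib, ite_mul, zero_mul, Finset.sum_ite_eq,
      Finset.mem_univ, if_true, ← Finset.mul_sum]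
    simp only [hat_sum]
    rw [hat_eq_zero, hat_eq_zero]
    · simp
    · intro u hu
      rw [Finset.sum_comm]
      refine Finset.sum_eq_zero fun b' _ => hs [] (b' :: u) ?_
      simp at h ⊢
      omega
    · intro u hu
      refine hc [] u ?_
      simp at h ⊢
      omega
  | cons x p ih =>
    obtain ⟨k, rfl⟩ : ∃ k', k = k' + 1 := ⟨k - 1, by omega⟩
    simp only [List.cons_append, hat, Finset.mul_sum, ← Finset.sum_add_distrib]
    refine Finset.sum_eq_zero fun b _ => Finset.sum_eq_zero fun t _ => ?_
    have := ih (hc.cons b) (hs.cons b) t (by simp at h; omega)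
    linear_combination mc x b r t * this

theorem eq_zero_of_hat {k : ℕ} {f : List (Fin 4) → ℂ} (hs : SingleFree k f)
    (h : ∀ r s v, v.length = k → hat f r s v = 0) (w : List (Fin 4)) (hw : w.length = k) :
    f w = 0 := by
  induction w generalizing f k with
  | nil =>
    have := h 0 0 [] hw
    simpa [hat] using this
  | cons b w ih =>
    rw [← hw, List.length_cons] at hs h
    refine ih (hs.cons b) (fun r s v hv => ?_) rfl
    have h0 : ∀ t, ∑ b, hat (fun u => f (b :: u)) t s v = 0 := by
      intro t
      rw [hat_sum]
      exact hat_eq_zero _ _ fun u hu => hs [] u (by simp; omega)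
    have h1 := fun x t => h t s (x :: v) (by simp [hv])
    simp only [hat, Fin.sum_univ_four, Fin.sum_univ_two] at h1 h0
    have h00 := h1 0 0
    have h01 := h1 0 1
    have h10 := h1 1 0
    have h11 := h1 1 1
    have h20 := h1 2 0
    have h21 := h1 2 1
    simp [mc, blk] at h00 h01 h10 h11 h20 h21
    have e0 := h0 0
    have e1 := h0 1
    fin_cases b <;> fin_cases r
    · change hat (fun u => f (0 :: u)) 0 s v = 0
      linear_combination (h00 + e0) / 4 + h11 / 2
    · change hat (fun u => f (0 :: u)) 1 s v = 0
      linear_combination (e1 - h01) / 4 + h20 / 2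
    · change hat (fun u => f (1 :: u)) 0 s v = 0
      linear_combination (e0 - h00) / 4 + h21 / 2
    · change hat (fun u => f (1 :: u)) 1 s v = 0
      linear_combination (e1 + h01) / 4 + h10 / 2
    · change hat (fun u => f (2 :: u)) 0 s v = 0
      linear_combination (e0 - h00) / 4 - h21 / 2
    · change hat (fun u => f (2 :: u)) 1 s v = 0
      linear_combination (e1 + h01) / 4 - h10 / 2
    · change hat (fun u => f (3 :: u)) 0 s v = 0
      linear_combination (h00 + e0) / 4 - h11 / 2
    · change hat (fun u => f (3 :: u)) 1 s v = 0
      linear_combination (e1 - h01) / 4 - h20 / 2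

/-- The vector against which the columns of the twisted magic unitary are contracted. -/
def beta : Fin 4 → ℂ := ![1, 1, -1, -1]

theorem twist_beta (b : Fin 4) (i j i' j' : Fin 2) :
    (∑ h, beta h • twist b h) (i, i') (j, j') = if j = i + 1 then
      (1 / 2 * ((blk b i' j').2 : ℂ)) • (appendLetter (gen (blk b i' j').1 1) +
        appendLetter (gen (blk b i' j').1 2)) else 0 := by
  have h1 : ∀ h, twist b h (i, i') (j, j') = (1 / 4 : ℂ) • ((if (i, i') = (j, j') then 1 else 0) +
      (((blk b i' j').2 * (blk h i j).2 : ℤ) : ℂ) •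
        appendLetter (gen (blk b i' j').1 (blk h i j).1)) := by
    intro h
    rw [twist, Matrix.smul_apply, twist4, Matrix.of_apply, entry, ev_append]
    split_ifs <;> simp [word, ← Int.cast_smul_eq_zsmul ℂ]
  rw [Matrix.sum_apply]
  simp only [Matrix.smul_apply, h1, smul_add]
  rw [Finset.sum_add_distrib]
  have h2 : ∑ h, beta h • (1 / 4 : ℂ) • (if (i, i') = (j, j') then (1 : Module.End ℂ relSub) else 0)
      = 0 := by
    rw [← Finset.sum_smul]
    simp [beta, Fin.sum_univ_four]
  rw [h2, zero_add]
  generalize blk b i' j' = z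
  obtain ⟨x, σ⟩ := z
  rw [Fin.sum_univ_four]
  fin_cases i <;> fin_cases j <;> simp [beta, blk] <;> module

/-- A matrix coefficient, applied to a vector and evaluated at a word. -/
def val (Ψ : relSub) (w : List ℕ) (R : TwistAlg) (i j : Fin 2 × Fin 2) : ℂ := ((R i j) Ψ).1 w

/-- The outer index after `k` flips. -/
def flips (k : ℕ) (i : Fin 2) : Fin 2 := (fun x => x + 1)^[k] i

theorem val_mul (Ψ : relSub) (w : List ℕ) (b : Fin 4) (R : TwistAlg) (i i' : Fin 2)
    (j : Fin 2 × Fin 2) :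
    val Ψ w ((∑ h, beta h • twist b h) * R) (i, i') j = ∑ t, (1 / 2 * ((blk b i' t).2 : ℂ)) *
      (val Ψ (w ++ [gen (blk b i' t).1 1]) R (i + 1, t) j +
        val Ψ (w ++ [gen (blk b i' t).1 2]) R (i + 1, t) j) := by
  rw [val, Matrix.mul_apply, Fintype.sum_prod_type]
  simp only [twist_beta]
  rw [Finset.sum_eq_single (i + 1)]
  · simp only [if_true, LinearMap.sum_apply, Submodule.coe_sum, Finset.sum_apply]
    refine Finset.sum_congr rfl fun t _ => ?_
    rfl
  · intro x _ hx
    simp [hx]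
  · simp

theorem val_sum (Ψ : relSub) (w : List ℕ) (R : Fin 4 → TwistAlg) (i j : Fin 2 × Fin 2) :
    val Ψ w (∑ b, R b) i j = ∑ b, val Ψ w (R b) i j := by
  simp [val, Matrix.sum_apply, LinearMap.sum_apply]

theorem val_smul_one (Ψ : relSub) (w : List ℕ) (c : ℂ) (i j : Fin 2 × Fin 2) :
    val Ψ w (c • 1) i j = if i = j then c * Ψ.1 w else 0 := by
  rw [val, Matrix.smul_apply, Matrix.one_apply]
  split_ifs <;> simp

theorem gen_two (x : Fin 3) : 3 ≤ gen x 2 := by fin_cases x <;> simp [gen]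

theorem gen_one (x : Fin 3) : gen x 1 = x := by fin_cases x <;> rfl

theorem val_colAct_zero {n : ℕ} {Ψ : relSub}
    (h0 : ∀ w : List ℕ, w.length = n → (∃ x ∈ w, 3 ≤ x) → Ψ.1 w = 0) (ε : List Bool)
    (f : List (Fin 4) → ℂ) (w : List ℕ) (hw : w.length + ε.length = n) (hx : ∃ x ∈ w, 3 ≤ x)
    (i j : Fin 2 × Fin 2) :
    val Ψ w (colAct (fun _ => twist) ε (List.replicate ε.length beta) f) i j = 0 := by
  induction ε generalizing f w i with
  | nil =>
    rw [List.length_nil, List.replicate_zero, colAct, val_smul_one, h0 w (by simpa using hw) hx]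
    simp
  | cons e ε ih =>
    obtain ⟨i, i'⟩ := i
    rw [List.length_cons, List.replicate_succ, colAct, val_sum]
    refine Finset.sum_eq_zero fun b _ => ?_
    rw [val_mul]
    refine Finset.sum_eq_zero fun t _ => ?_
    obtain ⟨x, hx, hx'⟩ := hx
    rw [ih _ _ _ ⟨x, by simp [hx], hx'⟩, ih _ _ _ ⟨x, by simp [hx], hx'⟩]
    · simp
    all_goals simp at hw ⊢; omega

theorem val_colAct {n : ℕ} {Ψ : relSub}
    (h0 : ∀ w : List ℕ, w.length = n → (∃ x ∈ w, 3 ≤ x) → Ψ.1 w = 0) (ε : List Bool)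
    (f : List (Fin 4) → ℂ) (w : List ℕ) (hw : w.length + ε.length = n) (i r s : Fin 2) :
    val Ψ w (colAct (fun _ => twist) ε (List.replicate ε.length beta) f) (i, r)
      (flips ε.length i, s) = (1 / 2) ^ ε.length * evl (List.replicate ε.length fun _ => 1)
        fun v : List (Fin 3) => hat f r s v * Ψ.1 (w ++ v.map Fin.val) := by
  induction ε generalizing f w i r with
  | nil =>
    rw [List.length_nil, List.replicate_zero, colAct, val_smul_one]
    by_cases h : r = s <;> simp [evl, hat, flips, h]
  | cons e ε ih =>
    rw [List.length_cons, List.replicate_succ, colAct, val_sum, List.replicate_succ, evl]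
    have h1 : ∀ x : Fin 3, (evl (List.replicate ε.length fun _ => 1)
        fun v : List (Fin 3) => hat f r s (x :: v) * Ψ.1 (w ++ (x :: v).map Fin.val)) =
        ∑ b, ∑ t, mc x b r t * evl (List.replicate ε.length fun _ => 1)
          fun v : List (Fin 3) => hat (fun u => f (b :: u)) t s v *
            Ψ.1 (w ++ [x.val] ++ v.map Fin.val) := by
      intro x
      simp only [hat, Finset.sum_mul, evl_sum]
      refine Finset.sum_congr rfl fun b _ => Finset.sum_congr rfl fun t _ => ?_
      rw [← smul_eq_mul, ← evl_smul]
      simp [mul_assoc]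
    simp only [h1, one_smul]
    rw [Finset.sum_comm, Finset.mul_sum]
    refine Finset.sum_congr rfl fun b _ => ?_
    rw [val_mul, Finset.sum_comm, Finset.mul_sum]
    refine Finset.sum_congr rfl fun t _ => ?_
    rw [show flips (ε.length + 1) i = flips ε.length (i + 1) from rfl, gen_one,
      ih _ _ (by simp at hw ⊢; omega),
      val_colAct_zero h0 _ _ _ (by simp at hw ⊢; omega) ⟨gen (blk b r t).1 2, by simp, gen_two _⟩, add_zero,
      Finset.sum_eq_single (blk b r t).1]
    · simp only [mc, if_true, pow_succ]
      ring
    · intro x _ hx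
      rw [mc, if_neg hx.symm, zero_mul]
    · simp

/-- The weight of a letter. -/
def weight (x : ℕ) : ℝ := if x = 0 then 1 else 2

theorem weight_pos (x : ℕ) : 0 < weight x := by
  rw [weight]; split_ifs <;> norm_num

/-- An invariant functional annihilated by all contractions and all letter sums vanishes. -/
theorem eq_zero_of_twist_inv {ε : List Bool} {f : List (Fin 4) → ℂ}
    (hf : Inv (fun _ => twist) ε f) (hε : ε ≠ []) (hc : CupFree ε.length f)
    (hs : SingleFree ε.length f) (w : List (Fin 4)) (hw : w.length = ε.length) : f w = 0 := by
  refine eq_zero_of_hat hs (fun r s v hv => ?_) w hw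
  set n := ε.length with hn
  let lift : List ℕ → List (Fin 3) := fun u => u.map fun x => Fin.ofNat 3 x
  have hlift : ∀ v : List (Fin 3), lift (v.map Fin.val) = v := fun v => by
    simp [lift, Function.comp_def]
  let g : List ℕ → ℂ := fun u => ((u.map weight).prod : ℝ) * star (hat f r s (lift u))
  have hg : ∀ p q : List ℕ, p.length + q.length + 2 = n → (∀ x ∈ p, x < 3) → (∀ x ∈ q, x < 3) →
      g (p ++ 2 :: 1 :: q) = - g (p ++ 1 :: 2 :: q) - 2 * g (p ++ 0 :: 0 :: q) := by
    intro p q hpq _ _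
    have := congrArg star (hat_cup hc hs r s (lift p) (lift q) (by simpa [lift] using hpq))
    simp only [star_add, star_mul', star_zero] at this
    have e2 : star (2 : ℂ) = 2 := by simp
    rw [e2] at this
    have h1 : ∀ a b : ℕ, g (p ++ a :: b :: q) = (p.map weight).prod * (weight a * (weight b *
        (q.map weight).prod)) * star (hat f r s (lift p ++ Fin.ofNat 3 a :: Fin.ofNat 3 b :: lift q)) := by
      intro a b
      simp [g, lift]
    rw [h1, h1, h1]
    have h2 : (weight 0 : ℂ) = 1 := by simp [weight]
    have h3 : (weight 1 : ℂ) = 2 := by simp [weight]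
    have h4 : (weight 2 : ℂ) = 2 := by simp [weight]
    rw [h2, h3, h4]
    have h5 : Fin.ofNat 3 0 = 0 ∧ Fin.ofNat 3 1 = 1 ∧ Fin.ofNat 3 2 = 2 := ⟨rfl, rfl, rfl⟩
    rw [h5.1, h5.2.1, h5.2.2]
    linear_combination 2 * ((p.map weight).prod : ℂ) * (q.map weight).prod * this
  obtain ⟨Ψ, hΨ⟩ := exists_vector hg
  have h0 : ∀ w : List ℕ, w.length = n → (∃ x ∈ w, 3 ≤ x) → Ψ.1 w = 0 := by
    rintro w hw ⟨x, hx, hx'⟩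
    rw [hΨ w hw.le, trunc, if_neg]
    rintro ⟨-, h⟩
    exact absurd (h x hx) (by omega)
  have h1 := val_colAct h0 ε f [] (by simp [hn]) 0 r s
  have hn0 : 0 ≠ n := fun h => hε (List.length_eq_zero_iff.1 h.symm)
  have h2 : Ψ.1 [] = 0 := by
    rw [hΨ [] (by simp), trunc, if_neg]
    rintro ⟨h, -⟩
    exact hn0 h
  rw [hf.colAct (by simp), val_smul_one, h2, mul_zero, ite_self] at h1
  have h3 := (mul_eq_zero.1 h1.symm).resolve_left (pow_ne_zero _ (by norm_num))
  have h4 : ∀ v : List (Fin 3), v.length = n →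
      Ψ.1 (v.map Fin.val) = g (v.map Fin.val) := by
    intro v hv
    rw [hΨ _ (by simp [hv]), trunc, if_pos]
    refine ⟨by simpa using hv, ?_⟩
    intro x hx
    obtain ⟨y, -, rfl⟩ := List.mem_map.1 hx
    exact y.2
  have h5 := evl_ones_eq_zero (h := fun v : List (Fin 3) => hat f r s v * g (v.map Fin.val)) (k := n)
    (fun v => ⟨(((v.map Fin.val).map weight).prod : ℝ) * Complex.normSq (hat f r s v), by
      refine mul_nonneg (List.prod_nonneg ?_) (Complex.normSq_nonneg _)
      intro a ha
      obtain ⟨y, -, rfl⟩ := List.mem_map.1 ha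
      exact (weight_pos y).le, by
      simp only [g, hlift, Complex.ofReal_mul, ← Complex.mul_conj]
      rw [starRingEnd_apply]
      ring⟩)
    ((evl_congr fun v hv => by simp [← h4 v (by simpa using hv)]).trans h3) v hv
  simp only [g, hlift] at h5
  rcases mul_eq_zero.1 h5 with h | h
  · exact h
  · rcases mul_eq_zero.1 h with h | h
    · exfalso
      rw [Complex.ofReal_eq_zero] at h
      have : 0 < ((v.map Fin.val).map weight).prod := List.prod_pos (fun a ha => by
        obtain ⟨y, -, rfl⟩ := List.mem_map.1 ha
        exact weight_pos y)
      exact this.ne' h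
    · simpa using h

/-- The functional on words attached to a Motzkin path, relative to a stack of open letters:
an up step opens a block at the current letter, a down step closes the last open block, whose
letter has to agree with the current one, and a level step is a singleton block. -/
def run {ι : Type*} [DecidableEq ι] : List SignType → List ι → List ι → ℂ
  | [], [], [] => 1
  | .pos :: d, stk, c :: w => run d (c :: stk) w
  | .neg :: d, t :: stk, c :: w => if t = c then run d stk w else 0
  | .zero :: d, stk, _ :: w => run d stk w
  | _, _, _ => 0

/-- Motzkin paths, relative to a stack of open signs, whose closed blocks satisfy `pr` and whose
singletons satisfy `sg`. -/
def Adm (pr : Bool → Bool → Prop) (sg : Bool → Prop) : List SignType → List Bool → List Bool → Prop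
  | [], [], [] => True
  | .pos :: d, ss, e :: ε => Adm pr sg d (e :: ss) ε
  | .neg :: d, s :: ss, e :: ε => pr s e ∧ Adm pr sg d ss ε
  | .zero :: d, ss, e :: ε => sg e ∧ Adm pr sg d ss ε
  | _, _, _ => False

/-- All Motzkin paths are allowed. -/
abbrev Path : List SignType → List Bool → List Bool → Prop := Adm (fun _ _ => True) fun _ => True

theorem path_of_run_ne_zero {ι : Type*} [DecidableEq ι] {d : List SignType} {stk w : List ι}
    {ss ε : List Bool} (hs : ss.length = stk.length) (hw : ε.length = w.length)
    (h : run d stk w ≠ 0) : Path d ss ε := by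
  induction d generalizing stk w ss ε with
  | nil =>
    rcases stk with _ | ⟨t, stk⟩ <;> rcases w with _ | ⟨c, w⟩
    · rw [List.length_eq_zero_iff.1 hs, List.length_eq_zero_iff.1 hw]
      trivial
    all_goals exact absurd rfl h
  | cons x d ih =>
    rcases w with _ | ⟨c, w⟩
    · cases x <;> rcases stk with _ | ⟨t, stk⟩ <;> exact absurd rfl h
    obtain ⟨e, ε, rfl⟩ := List.exists_cons_of_length_eq_add_one hw
    have hw' : ε.length = w.length := by simpa using hw
    cases x with
    | pos => exact ih (ss := e :: ss) (by simp [hs]) hw' h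
    | zero => exact ⟨trivial, ih hs hw' h⟩
    | neg =>
      rcases stk with _ | ⟨t, stk⟩
      · exact absurd rfl h
      obtain ⟨s, ss, rfl⟩ := List.exists_cons_of_length_eq_add_one hs
      refine ⟨trivial, ih (stk := stk) (by simpa using hs) hw' ?_⟩
      rw [run] at h
      split_ifs at h
      · exact h
      · exact absurd rfl h

section act
variable {ι : Type*} [Fintype ι] {A : Type*} [Ring A] [Algebra ℂ A]

theorem act_add (v : Bool → ι → ι → A) (ε : List Bool) (w : List ι) (f g : List ι → ℂ) :
    act v ε w (fun u => f u + g u) = act v ε w f + act v ε w g := by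
  induction ε generalizing w f g with
  | nil => cases w <;> simp [act, add_smul]
  | cons e ε ih =>
    cases w with
    | nil => simp [act]
    | cons i w => simp only [act, ih, mul_add, Finset.sum_add_distrib]

theorem act_smul (v : Bool → ι → ι → A) (ε : List Bool) (w : List ι) (a : ℂ) (f : List ι → ℂ) :
    act v ε w (fun u => a * f u) = a • act v ε w f := by
  induction ε generalizing w f with
  | nil => cases w <;> simp [act, mul_smul]
  | cons e ε ih =>
    cases w with
    | nil => simp [act]
    | cons i w => simp only [act, ih, mul_smul_comm, Finset.smul_sum]

theorem act_congr {v : Bool → ι → ι → A} {ε : List Bool} {w : List ι} {f g : List ι → ℂ}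
    (h : ∀ u, u.length = w.length → f u = g u) : act v ε w f = act v ε w g := by
  induction ε generalizing w f g with
  | nil =>
    cases w
    · simp [act, h]
    · rfl
  | cons e ε ih =>
    cases w with
    | nil => rfl
    | cons i w =>
      simp only [act]
      exact Finset.sum_congr rfl fun j _ => by rw [ih fun u hu => h (j :: u) (by simpa using hu)]

theorem act_zero (v : Bool → ι → ι → A) (ε : List Bool) (w : List ι) :
    act v ε w (fun _ => 0) = 0 := by
  simpa using act_smul v ε w 0 fun _ => 0

theorem act_sum {α : Type*} (s : Finset α) (v : Bool → ι → ι → A) (ε : List Bool) (w : List ι)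
    (f : α → List ι → ℂ) : act v ε w (fun u => ∑ a ∈ s, f a u) = ∑ a ∈ s, act v ε w (f a) := by
  classical
  induction s using Finset.induction_on with
  | empty => simp [act_zero]
  | insert a s ha ih => simp only [Finset.sum_insert ha, act_add, ih]

theorem Inv.congr {v : Bool → ι → ι → A} {ε : List Bool} {f g : List ι → ℂ} (hf : Inv v ε f)
    (h : ∀ w, w.length = ε.length → f w = g w) : Inv v ε g := fun w hw => by
  rw [← act_congr fun u hu => h u (hu.trans hw), hf w hw, h w hw]

theorem Inv.add {v : Bool → ι → ι → A} {ε : List Bool} {f g : List ι → ℂ} (hf : Inv v ε f)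
    (hg : Inv v ε g) : Inv v ε fun w => f w + g w := fun w hw => by
  rw [act_add, hf w hw, hg w hw, add_smul]

theorem Inv.const_mul {v : Bool → ι → ι → A} {ε : List Bool} {f : List ι → ℂ} (hf : Inv v ε f)
    (a : ℂ) : Inv v ε fun w => a * f w := fun w hw => by
  rw [act_smul, hf w hw, mul_smul]

theorem Inv.sum {α : Type*} {s : Finset α} {v : Bool → ι → ι → A} {ε : List Bool}
    {f : α → List ι → ℂ} (hf : ∀ a ∈ s, Inv v ε (f a)) : Inv v ε fun w => ∑ a ∈ s, f a w :=
  fun w hw => by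
    rw [act_sum, Finset.sum_smul]
    exact Finset.sum_congr rfl fun a ha => hf a ha w hw

/-- Contract the letters of a functional with values in `A` against columns of `v`. -/
def stackAct (v : Bool → ι → ι → A) : List (Bool × ι) → (List ι → A) → A
  | [], H => H []
  | y :: ys, H => stackAct v ys fun us => ∑ j, v y.1 j y.2 * H (j :: us)

omit [Algebra ℂ A] in
theorem stackAct_zero (v : Bool → ι → ι → A) (ys : List (Bool × ι)) :
    stackAct v ys (fun _ => 0) = 0 := by
  induction ys with
  | nil => rfl
  | cons y ys ih => simpa [stackAct] using ih

theorem stackAct_run [DecidableEq ι] {pr : Bool → Bool → Prop} {sg : Bool → Prop}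
    {v : Bool → ι → ι → A}
    (hpr : ∀ e e', pr e e' → ∀ x y, ∑ j, v e j x * v e' j y = if x = y then 1 else 0)
    (hsg : ∀ e, sg e → ∀ x, ∑ j, v e j x = 1) {d : List SignType} {ys : List (Bool × ι)}
    {ε : List Bool} (hd : Adm pr sg d (ys.map Prod.fst) ε) {w : List ι}
    (hw : w.length = ε.length) :
    stackAct v ys (fun us => act v ε w (run d us)) = run d (ys.map Prod.snd) w • (1 : A) := by
  induction d generalizing ys ε w with
  | nil =>
    rcases ε with _ | ⟨e, ε⟩ <;> rcases ys with _ | ⟨y, ys⟩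
    · rw [List.length_eq_zero_iff.1 hw]
      rfl
    all_goals exact hd.elim
  | cons x d ih =>
    rcases ε with _ | ⟨e, ε⟩
    · cases x <;> rcases ys with _ | ⟨y, ys⟩ <;> exact hd.elim
    obtain ⟨i, w, rfl⟩ := List.exists_cons_of_length_eq_add_one hw
    have hw' : w.length = ε.length := by simpa using hw
    cases x with
    | pos => exact ih (ys := (e, i) :: ys) hd hw'
    | zero =>
      rw [show run (.zero :: d) (ys.map Prod.snd) (i :: w) = run d (ys.map Prod.snd) w from rfl,
        ← ih hd.2 hw']
      congr 1
      funext us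
      change ∑ j, v e j i * act v ε w (run d us) = _
      rw [← Finset.sum_mul, hsg e hd.1, one_mul]
    | neg =>
      rcases ys with _ | ⟨⟨e', t⟩, ys⟩
      · exact hd.elim
      have h1 : ∀ us, ∑ j, v e' j t * act v (e :: ε) (i :: w) (run (.neg :: d) (j :: us)) =
          if t = i then act v ε w (run d us) else 0 := by
        intro us
        have h2 : ∀ j j' : ι, act v ε w (fun u => run (.neg :: d) (j :: us) (j' :: u)) =
            if j = j' then act v ε w (run d us) else 0 := by
          intro j j'
          simp only [run]
          split_ifs
          · rfl
          · exact act_zero _ _ _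
        simp only [act, h2, mul_ite, mul_zero, Finset.sum_ite_eq, Finset.mem_univ, if_true]
        simp only [← mul_assoc, ← Finset.sum_mul, hpr e' e hd.1, ite_mul, one_mul, zero_mul]
      simp only [stackAct, h1, List.map_cons, run]
      split_ifs
      · exact ih hd.2 hw'
      · rw [stackAct_zero, zero_smul]

/-- Functionals attached to allowed Motzkin paths are invariant. -/
theorem inv_run [DecidableEq ι] {pr : Bool → Bool → Prop} {sg : Bool → Prop}
    {v : Bool → ι → ι → A}
    (hpr : ∀ e e', pr e e' → ∀ x y, ∑ j, v e j x * v e' j y = if x = y then 1 else 0)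
    (hsg : ∀ e, sg e → ∀ x, ∑ j, v e j x = 1) {d : List SignType}
    {ε : List Bool} (hd : Adm pr sg d [] ε) : Inv v ε (run d []) := fun _ hw =>
  stackAct_run (ys := []) hpr hsg hd hw

end act

/-- A linear combination of functionals attached to Motzkin paths. -/
def comb {ι : Type*} [DecidableEq ι] (c : List SignType →₀ ℂ) (w : List ι) : ℂ :=
  ∑ d ∈ c.support, c d * run d [] w

/-- On words of length `k`, the functional is a linear combination of functionals attached to
Motzkin paths. -/
def IsComb {ι : Type*} [DecidableEq ι] (k : ℕ) (f : List ι → ℂ) : Prop :=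
  ∃ c : List SignType →₀ ℂ, ∀ w, w.length = k → f w = comb c w

section modify
variable {ι : Type*}

/-- Apply an operation to the functional after the first `a` letters. -/
def atPos (op : (List ι → ℂ) → List ι → ℂ) : ℕ → (List ι → ℂ) → List ι → ℂ
  | 0, f, w => op f w
  | a + 1, f, i :: w => atPos op a (fun u => f (i :: u)) w
  | _ + 1, _, [] => 0

theorem atPos_append (op : (List ι → ℂ) → List ι → ℂ) (f : List ι → ℂ) (u w : List ι) :
    atPos op u.length f (u ++ w) = op (fun x => f (u ++ x)) w := by
  induction u generalizing f with
  | nil => rfl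
  | cons i u ih => exact ih _

variable [Fintype ι]

/-- Contraction of the first two letters. -/
def cup (f : List ι → ℂ) (w : List ι) : ℂ := ∑ c, f (c :: c :: w)

/-- Sum over the first letter. -/
def single (f : List ι → ℂ) (w : List ι) : ℂ := ∑ c, f (c :: w)

variable {A : Type*} [Ring A] [Algebra ℂ A]

theorem Inv.cup [DecidableEq ι] {v : Bool → ι → ι → A} (hv : ∀ e e' x y, ∑ j, v e x j * v e' y j =
    if x = y then 1 else 0) {ε₁ ε₂ : List Bool} {e e' : Bool} {f : List ι → ℂ}
    (hf : Inv v (ε₁ ++ e :: e' :: ε₂) f) : Inv v (ε₁ ++ ε₂) (atPos cup ε₁.length f) := by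
  have key : ∀ (ε₁ : List Bool) (f : List ι → ℂ) (w₁ w₂ : List ι), w₁.length = ε₁.length →
      act v (ε₁ ++ ε₂) (w₁ ++ w₂) (atPos TopGen.cup ε₁.length f) =
        ∑ x, act v (ε₁ ++ e :: e' :: ε₂) (w₁ ++ x :: x :: w₂) f := by
    intro ε₁
    induction ε₁ with
    | nil =>
      intro f w₁ w₂ h
      rw [List.length_eq_zero_iff.1 h]
      simp only [List.nil_append, act, Finset.mul_sum]
      rw [Finset.sum_comm]
      refine (act_sum _ _ _ _ _).trans (Finset.sum_congr rfl fun j _ => ?_)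
      rw [Finset.sum_comm]
      simp only [← mul_assoc, ← Finset.sum_mul, hv, ite_mul, one_mul, zero_mul,
        Finset.sum_ite_eq, Finset.mem_univ, if_true]
    | cons e₁ ε₁ ih =>
      intro f w₁ w₂ h
      obtain ⟨i, w₁, rfl⟩ := List.exists_cons_of_length_eq_add_one h
      simp only [List.cons_append, act, List.length_cons]
      rw [Finset.sum_comm]
      refine Finset.sum_congr rfl fun j _ => ?_
      rw [← Finset.mul_sum, ← ih _ w₁ w₂ (by simpa using h)]
      rfl
  intro w hw
  obtain ⟨w₁, w₂, rfl, hl⟩ : ∃ w₁ w₂, w = w₁ ++ w₂ ∧ w₁.length = ε₁.length :=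
    ⟨w.take ε₁.length, w.drop ε₁.length, by simp, by simp at hw ⊢; omega⟩
  rw [key _ _ _ _ hl, ← hl, atPos_append, TopGen.cup, Finset.sum_smul]
  refine Finset.sum_congr rfl fun x _ => hf _ ?_
  simp at hw ⊢; omega

theorem Inv.single {v : Bool → ι → ι → A} (hv : ∀ e x, ∑ j, v e x j = 1)
    {ε₁ ε₂ : List Bool} {e : Bool} {f : List ι → ℂ}
    (hf : Inv v (ε₁ ++ e :: ε₂) f) : Inv v (ε₁ ++ ε₂) (atPos single ε₁.length f) := by
  have key : ∀ (ε₁ : List Bool) (f : List ι → ℂ) (w₁ w₂ : List ι), w₁.length = ε₁.length →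
      act v (ε₁ ++ ε₂) (w₁ ++ w₂) (atPos TopGen.single ε₁.length f) =
        ∑ x, act v (ε₁ ++ e :: ε₂) (w₁ ++ x :: w₂) f := by
    intro ε₁
    induction ε₁ with
    | nil =>
      intro f w₁ w₂ h
      rw [List.length_eq_zero_iff.1 h]
      simp only [List.nil_append, act]
      rw [Finset.sum_comm]
      refine (act_sum _ _ _ _ _).trans (Finset.sum_congr rfl fun j _ => ?_)
      rw [← Finset.sum_mul, hv, one_mul]
    | cons e₁ ε₁ ih =>
      intro f w₁ w₂ h
      obtain ⟨i, w₁, rfl⟩ := List.exists_cons_of_length_eq_add_one h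
      simp only [List.cons_append, act, List.length_cons]
      rw [Finset.sum_comm]
      refine Finset.sum_congr rfl fun j _ => ?_
      rw [← Finset.mul_sum, ← ih _ w₁ w₂ (by simpa using h)]
      rfl
  intro w hw
  obtain ⟨w₁, w₂, rfl, hl⟩ : ∃ w₁ w₂, w = w₁ ++ w₂ ∧ w₁.length = ε₁.length :=
    ⟨w.take ε₁.length, w.drop ε₁.length, by simp, by simp at hw ⊢; omega⟩
  rw [key _ _ _ _ hl, ← hl, atPos_append, TopGen.single, Finset.sum_smul]
  refine Finset.sum_congr rfl fun x _ => hf _ ?_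
  simp at hw ⊢; omega

end modify

section words
variable {ι : Type*} [Fintype ι] {M : Type*} [AddCommGroup M] [Module ℂ M]

/-- The sum of a functional over all words of length `k`. -/
def total (k : ℕ) (G : List ι → ℂ) : ℂ := evl (List.replicate k fun _ => 1) G

theorem total_succ (k : ℕ) (G : List ι → ℂ) :
    total (k + 1) G = ∑ c, total k fun w => G (c :: w) := by
  simp [total, List.replicate_succ, evl]

theorem total_eq_sum (k : ℕ) (G : List ι → ℂ) :
    total k G = ∑ w : Fin k → ι, G (List.ofFn w) := by
  induction k generalizing G with
  | zero => simp [total, evl]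
  | succ k ih =>
    rw [total_succ, ← (Fin.consEquiv fun _ => ι).sum_comp, Fintype.sum_prod_type]
    simp [ih, Fin.consEquiv, List.ofFn_succ]

theorem total_congr {k : ℕ} {G G' : List ι → ℂ} (h : ∀ w, w.length = k → G w = G' w) :
    total k G = total k G' := evl_congr fun w hw => h w (by simpa using hw)

theorem total_zero (k : ℕ) : total k (fun _ : List ι => 0) = 0 := evl_zero _

theorem total_sum {α : Type*} (s : Finset α) (k : ℕ) (G : α → List ι → ℂ) :
    total k (fun w => ∑ a ∈ s, G a w) = ∑ a ∈ s, total k (G a) := evl_sum _ _ _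

theorem total_mul (k : ℕ) (a : ℂ) (G : List ι → ℂ) :
    total k (fun w => a * G w) = a * total k G := evl_smul _ _ _

variable [DecidableEq ι]

omit [Fintype ι] in
theorem run_real (d : List SignType) (stk w : List ι) : star (run d stk w) = run d stk w := by
  induction d generalizing stk w with
  | nil => rcases stk with _ | ⟨t, stk⟩ <;> rcases w with _ | ⟨c, w⟩ <;> simp [run]
  | cons x d ih =>
    cases x <;> rcases stk with _ | ⟨t, stk⟩ <;> rcases w with _ | ⟨c, w⟩ <;>
      simp only [run, star_zero, ih]
    split_ifs <;> simp [ih]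

theorem exists_orthogonal (k : ℕ) (f : List ι → ℂ) : ∃ c : List SignType →₀ ℂ,
    ∀ d, total k (fun w => (f w - comb c w) * run d [] w) = 0 := by
  let F : List SignType → EuclideanSpace ℂ (Fin k → ι) := fun d =>
    WithLp.toLp 2 fun w => run d [] (List.ofFn w)
  let K := Submodule.span ℂ (Set.range F)
  obtain ⟨y, hy, z, hz, hyz⟩ := K.exists_add_mem_mem_orthogonal
    (WithLp.toLp 2 fun w => f (List.ofFn w))
  obtain ⟨c, rfl⟩ := (Finsupp.mem_span_range_iff_exists_finsupp).1 hy
  refine ⟨c, fun d => ?_⟩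
  have h1 := (Submodule.mem_orthogonal K z).1 hz (F d) (Submodule.subset_span ⟨d, rfl⟩)
  rw [← h1, PiLp.inner_apply, total_eq_sum]
  refine Finset.sum_congr rfl fun w _ => ?_
  have h2 := congrArg (fun x : EuclideanSpace ℂ (Fin k → ι) => x w) hyz
  simp only [PiLp.add_apply] at h2
  rw [h2, Finsupp.sum]
  simp only [F, RCLike.inner_apply, starRingEnd_apply, run_real, comb, WithLp.ofLp_sum, WithLp.ofLp_smul, Finset.sum_apply, Pi.smul_apply, smul_eq_mul, add_sub_cancel_left]

theorem eq_zero_of_isComb {k : ℕ} {f : List ι → ℂ} (hf : IsComb k f)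
    (h : ∀ d, total k (fun w => f w * run d [] w) = 0) (w : List ι) (hw : w.length = k) :
    f w = 0 := by
  obtain ⟨c, hc⟩ := hf
  have h1 : total k (fun w => f w * star (f w)) = 0 := by
    rw [total_congr (G' := fun w => ∑ d ∈ c.support, star (c d) * (f w * run d [] w)), total_sum]
    · simp [total_mul, h]
    · intro w hw
      conv_lhs => rw [hc w hw, comb, star_sum, Finset.mul_sum, ← comb, ← hc w hw]
      refine Finset.sum_congr rfl fun d _ => ?_
      rw [star_mul', run_real]
      ring
  have h2 := evl_ones_eq_zero (fun w => ⟨Complex.normSq (f w), Complex.normSq_nonneg _,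
    Complex.mul_conj _⟩) k h1 w hw
  simpa using h2

theorem total_cup (a k : ℕ) (ha : a ≤ k) (f : List ι → ℂ) (d : List SignType)
    (hd : d.length = k) (stk : List ι) :
    total k (fun w => atPos cup a f w * run d stk w) =
      total (k + 2) fun w => f w * run (d.take a ++ .pos :: .neg :: d.drop a) stk w := by
  induction a generalizing k f d stk with
  | zero =>
    simp only [List.take_zero, List.drop_zero, List.nil_append, total_succ, run, mul_ite, mul_zero,
      atPos, cup, Finset.sum_mul, total_sum]
    refine Finset.sum_congr rfl fun c _ => ?_
    rw [Finset.sum_eq_single c]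
    · simp
    · intro b _ hb
      simp only [if_neg hb.symm]
      exact evl_zero _
    · simp
  | succ a ih =>
    obtain ⟨k, rfl⟩ : ∃ k', k = k' + 1 := ⟨k - 1, by omega⟩
    obtain ⟨x, d, rfl⟩ := List.exists_cons_of_length_eq_add_one hd
    rw [total_succ, total_succ]
    refine Finset.sum_congr rfl fun c _ => ?_
    have h1 := fun stk => ih k (by omega) (fun u => f (c :: u)) d (by simpa using hd) stk
    cases x with
    | pos => exact h1 (c :: stk)
    | zero => exact h1 stk
    | neg =>
      rcases stk with _ | ⟨t, stk⟩
      · simp [run, total_zero]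
      · simp only [List.take_succ_cons, List.drop_succ_cons, List.cons_append, run]
        split_ifs
        · exact h1 stk
        · simp [total_zero]

theorem total_single (a k : ℕ) (ha : a ≤ k) (f : List ι → ℂ) (d : List SignType)
    (hd : d.length = k) (stk : List ι) :
    total k (fun w => atPos single a f w * run d stk w) =
      total (k + 1) fun w => f w * run (d.take a ++ .zero :: d.drop a) stk w := by
  induction a generalizing k f d stk with
  | zero =>
    simp only [List.take_zero, List.drop_zero, List.nil_append, total_succ, run,
      atPos, single, Finset.sum_mul, total_sum]
  | succ a ih =>
    obtain ⟨k, rfl⟩ : ∃ k', k = k' + 1 := ⟨k - 1, by omega⟩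
    obtain ⟨x, d, rfl⟩ := List.exists_cons_of_length_eq_add_one hd
    rw [total_succ, total_succ]
    refine Finset.sum_congr rfl fun c _ => ?_
    have h1 := fun stk => ih k (by omega) (fun u => f (c :: u)) d (by simpa using hd) stk
    cases x with
    | pos => exact h1 (c :: stk)
    | zero => exact h1 stk
    | neg =>
      rcases stk with _ | ⟨t, stk⟩
      · simp [run, total_zero]
      · simp only [List.take_succ_cons, List.drop_succ_cons, List.cons_append, run]
        split_ifs
        · exact h1 stk
        · simp [total_zero]

omit [Fintype ι] in
theorem run_eq_zero_of_length {d : List SignType} {stk w : List ι} (h : d.length ≠ w.length) :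
    run d stk w = 0 := by
  induction d generalizing stk w with
  | nil => rcases stk with _ | ⟨t, stk⟩ <;> rcases w with _ | ⟨c, w⟩ <;> simp [run] at h ⊢
  | cons x d ih =>
    rcases w with _ | ⟨c, w⟩
    · cases x <;> rcases stk with _ | ⟨t, stk⟩ <;> rfl
    have h' : d.length ≠ w.length := by simpa using h
    cases x <;> rcases stk with _ | ⟨t, stk⟩ <;> simp [run, ih h']

/-- Induction principle for invariant functionals: if the orthogonal complement of the functionals
attached to Motzkin paths contains no nonzero invariant functional annihilated by contractions,
then all invariant functionals are combinations of those. -/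
theorem isComb_of_inv {A : Type*} [Ring A] [Algebra ℂ A] {v : Bool → ι → ι → A}
    (hv : ∀ e e' x y, ∑ j, v e x j * v e' y j = if x = y then 1 else 0)
    (hv' : ∀ e e' x y, ∑ j, v e j x * v e' j y = if x = y then 1 else 0)
    (hv₁ : ∀ e x, ∑ j, v e x j = 1) (hv₁' : ∀ e x, ∑ j, v e j x = 1)
    (van : ∀ (ε : List Bool) (f : List ι → ℂ), Inv v ε f → ε ≠ [] → CupFree ε.length f →
      SingleFree ε.length f → ∀ w, w.length = ε.length → f w = 0)
    {ε : List Bool} {f : List ι → ℂ} (hf : Inv v ε f) : IsComb ε.length f := by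
  induction hn : ε.length using Nat.strong_induction_on generalizing ε f with
  | _ n ih =>
    subst hn
    by_cases hε : ε = []
    · subst hε
      refine ⟨Finsupp.single [] (f []), fun w hw => ?_⟩
      rw [List.length_eq_zero_iff.1 hw]
      by_cases h : f [] = 0
      · simp [comb, h]
      · rw [comb, Finsupp.support_single _ h]
        simp [run]
    obtain ⟨c, hc⟩ := exists_orthogonal ε.length f
    have h1 : Inv v ε fun w => f w - comb c w := by
      have h2 : ∀ d, Inv v ε (run d [] : List ι → ℂ) := by
        intro d
        by_cases hd : Path d [] ε
        · exact inv_run (fun e e' _ => hv' e e') (fun e _ => hv₁' e) hd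
        · have h0 : ∀ w : List ι, w.length = ε.length → run d [] w = 0 := fun w hw => by
            by_contra h
            exact hd (path_of_run_ne_zero (stk := ([] : List ι)) (ss := []) rfl hw.symm h)
          intro w hw
          rw [act_congr fun u hu => h0 u (hu.trans hw), act_zero, h0 w hw, zero_smul]
      have h3 := hf.add ((Inv.sum (s := c.support) fun d _ => (h2 d).const_mul (c d)).const_mul (-1))
      refine h3.congr fun w _ => ?_
      rw [comb]
      ring
    refine ⟨c, fun w hw => sub_eq_zero.1 (van ε _ h1 hε ?_ ?_ w hw)⟩
    · intro u w huw
      obtain ⟨e₁, e, e', e₂, rfl, he⟩ : ∃ e₁ e e' e₂, ε = e₁ ++ e :: e' :: e₂ ∧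
          e₁.length = u.length := by
        have h3 : (ε.drop u.length).length = w.length + 1 + 1 := by simp; omega
        obtain ⟨e, l, hl⟩ := List.exists_cons_of_length_eq_add_one h3
        rw [hl] at h3
        obtain ⟨e', l', rfl⟩ := List.exists_cons_of_length_eq_add_one (by simpa using h3)
        exact ⟨ε.take u.length, e, e', l', by rw [← hl, List.take_append_drop], by simp; omega⟩
      have h4 := h1.cup hv
      have h5 := ih _ (by simp) h4 rfl
      have h6 := eq_zero_of_isComb h5 (fun d => ?_) (u ++ w) (by simp at huw ⊢; omega)
      · rw [he, atPos_append] at h6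
        exact h6
      · by_cases hd : d.length = (e₁ ++ e₂).length
        · rw [total_cup _ _ (by simp) _ _ hd]
          convert hc _ using 2
          simp
          omega
        · refine evl_eq_zero fun w hw => ?_
          rw [run_eq_zero_of_length, mul_zero]
          simpa [hw] using hd
    · intro u w huw
      obtain ⟨e₁, e, e₂, rfl, he⟩ : ∃ e₁ e e₂, ε = e₁ ++ e :: e₂ ∧
          e₁.length = u.length := by
        have h3 : (ε.drop u.length).length = w.length + 1 := by simp; omega
        obtain ⟨e, l, hl⟩ := List.exists_cons_of_length_eq_add_one h3
        exact ⟨ε.take u.length, e, l, by rw [← hl, List.take_append_drop], by simp; omega⟩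
      have h4 := h1.single hv₁
      have h5 := ih _ (by simp) h4 rfl
      have h6 := eq_zero_of_isComb h5 (fun d => ?_) (u ++ w) (by simp at huw ⊢; omega)
      · rw [he, atPos_append] at h6
        exact h6
      · by_cases hd : d.length = (e₁ ++ e₂).length
        · rw [total_single _ _ (by simp) _ _ hd]
          convert hc _ using 2
          simp
          omega
        · refine evl_eq_zero fun w hw => ?_
          rw [run_eq_zero_of_length, mul_zero]
          simpa [hw] using hd

end words

theorem IsMagic.row_sum {M : ℕ} {B : Type*} [Ring B] {p : Fin M → Fin M → B} (hp : IsMagic p)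
    (i : Fin M) : ∑ j, p i j = 1 := by
  rw [← (hp.row i i).trans (if_pos rfl)]
  exact Finset.sum_congr rfl fun j _ => (hp.idem i j).symm

theorem IsMagic.col_sum {M : ℕ} {B : Type*} [Ring B] {p : Fin M → Fin M → B} (hp : IsMagic p)
    (i : Fin M) : ∑ j, p j i = 1 := by
  rw [← (hp.col i i).trans (if_pos rfl)]
  exact Finset.sum_congr rfl fun j _ => (hp.idem j i).symm

/-- Functionals invariant under the twisted magic unitary are combinations of noncrossing pairings
with singletons. -/
theorem isComb_of_twist_inv {ε : List Bool} {f : List (Fin 4) → ℂ}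
    (hf : Inv (fun _ => twist) ε f) : IsComb ε.length f :=
  isComb_of_inv (fun _ _ => twist_isMagic.row) (fun _ _ => twist_isMagic.col)
    (fun _ => twist_isMagic.row_sum) (fun _ => twist_isMagic.col_sum)
    (fun _ _ h hε hc hs => eq_zero_of_twist_inv h hε hc hs) hf

section triangular
variable {ι : Type*} [Fintype ι]

/-- The evaluation of a Motzkin path on vectors, relative to a stack of vectors. -/
def runV : List SignType → List (ι → ℂ) → List (ι → ℂ) → ℂ
  | [], [], [] => 1
  | .pos :: d, stk, v :: V => runV d (v :: stk) V
  | .neg :: d, t :: stk, v :: V => (t ⬝ᵥ v) * runV d stk V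
  | .zero :: d, stk, v :: V => (∑ c, v c) * runV d stk V
  | _, _, _ => 0

theorem evl_evl_run [DecidableEq ι] (d : List SignType) (stk V : List (ι → ℂ)) :
    evl stk (fun u => evl V fun w => run d u w) = runV d stk V := by
  induction d generalizing stk V with
  | nil =>
    rcases stk with _ | ⟨t, stk⟩ <;> rcases V with _ | ⟨v, V⟩ <;> simp [run, runV, evl, evl_zero]
  | cons x d ih =>
    rcases V with _ | ⟨v, V⟩
    · cases x <;> rcases stk with _ | ⟨t, stk⟩ <;> simp [run, runV, evl, evl_zero]
    cases x with
    | pos =>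
      rw [runV, ← ih]
      simp only [evl, evl_sum, run]
      exact Finset.sum_congr rfl fun c _ => evl_smul _ _ _
    | zero =>
      rw [runV, ← ih]
      simp only [evl, run]
      simp only [← Finset.sum_smul]
      exact evl_smul _ _ _
    | neg =>
      rcases stk with _ | ⟨t, stk⟩
      · simp [run, runV, evl, evl_zero]
      rw [runV, ← ih]
      have h1 : ∀ (b : ι) (u : List ι), (∑ c, v c • evl V fun w => run (.neg :: d) (b :: u) (c :: w))
          = v b • evl V (run d u) := by
        intro b u
        rw [Finset.sum_eq_single b]
        · simp [run]
        · intro c _ hc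
          simp [run, if_neg hc.symm, evl_zero]
        · simp
      simp only [evl, h1, evl_smul, ← smul_assoc]
      rw [← Finset.sum_smul]
      rfl

/-- The vectors `V` are adapted to a Motzkin path, relative to a stack of vectors. -/
def Adapted : List SignType → List (ι → ℂ) → List (ι → ℂ) → Prop
  | [], [], [] => True
  | .pos :: d, stk, v :: V => ∑ c, v c = 0 ∧ (∀ t ∈ stk.head?, t ⬝ᵥ v = 0) ∧ Adapted d (v :: stk) V
  | .neg :: d, t :: stk, v :: V => ∑ c, v c = 0 ∧ t ⬝ᵥ v ≠ 0 ∧ Adapted d stk V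
  | .zero :: d, stk, v :: V => ∑ c, v c ≠ 0 ∧ (∀ t ∈ stk.head?, t ⬝ᵥ v = 0) ∧ Adapted d stk V
  | _, _, _ => False

theorem Adapted.runV_ne_zero {d : List SignType} {stk V : List (ι → ℂ)} (h : Adapted d stk V) :
    runV d stk V ≠ 0 := by
  induction d generalizing stk V with
  | nil =>
    rcases stk with _ | ⟨t, stk⟩ <;> rcases V with _ | ⟨v, V⟩ <;> simp [Adapted, runV] at h ⊢
  | cons x d ih =>
    rcases V with _ | ⟨v, V⟩
    · cases x <;> rcases stk with _ | ⟨t, stk⟩ <;> exact h.elim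
    cases x with
    | pos => exact ih h.2.2
    | zero => exact mul_ne_zero h.1 (ih h.2.2)
    | neg =>
      rcases stk with _ | ⟨t, stk⟩
      · exact h.elim
      · exact mul_ne_zero h.2.1 (ih h.2.2)

theorem Adapted.le_of_runV_ne_zero {d d' : List SignType} {stk V : List (ι → ℂ)}
    (h : Adapted d stk V) (h' : runV d' stk V ≠ 0) : d = d' ∨ d < d' := by
  induction d generalizing d' stk V with
  | nil =>
    rcases stk with _ | ⟨t, stk⟩ <;> rcases V with _ | ⟨v, V⟩ <;> try exact h.elim
    rcases d' with _ | ⟨x, d'⟩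
    · exact Or.inl rfl
    · cases x <;> exact absurd rfl h'
  | cons x d ih =>
    rcases V with _ | ⟨v, V⟩
    · cases x <;> rcases stk with _ | ⟨t, stk⟩ <;> exact h.elim
    rcases d' with _ | ⟨y, d'⟩
    · cases stk <;> exact absurd rfl h'
    have same : (d = d' ∨ d < d') → (x :: d = x :: d' ∨ x :: d < x :: d') := by
      rintro (rfl | h)
      · exact Or.inl rfl
      · exact Or.inr (List.Lex.cons h)
    cases x with
    | pos =>
      cases y with
      | pos => exact same (ih h.2.2 h')
      | zero => simp [runV, h.1] at h'
      | neg =>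
        rcases stk with _ | ⟨t, stk⟩
        · exact absurd rfl h'
        · simp [runV, h.2.1 t (by simp)] at h'
    | zero =>
      cases y with
      | pos => exact Or.inr (List.Lex.rel (by decide))
      | zero => exact same (ih h.2.2 (right_ne_zero_of_mul h'))
      | neg =>
        rcases stk with _ | ⟨t, stk⟩
        · exact absurd rfl h'
        · simp [runV, h.2.1 t (by simp)] at h'
    | neg =>
      cases y with
      | pos => exact Or.inr (List.Lex.rel (by decide))
      | zero => exact Or.inr (List.Lex.rel (by decide))
      | neg =>
        rcases stk with _ | ⟨t, stk⟩
        · exact absurd rfl h'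
        · exact same (ih h.2.2 (right_ne_zero_of_mul h'))

/-- If the contraction of a combination against vectors adapted to the largest Motzkin path
vanishes, then the coefficient of that path vanishes. -/
theorem coeff_eq_zero_of_adapted [DecidableEq ι] {c : List SignType →₀ ℂ} {d : List SignType}
    {V : List (ι → ℂ)} (h : Adapted d [] V) (hd : ∀ d' ∈ c.support, ¬ d < d')
    (h0 : evl V (comb c) = 0) : c d = 0 := by
  have h1 : evl V (comb c) = ∑ d' ∈ c.support, c d' * runV d' [] V := by
    change evl V (fun w => ∑ d' ∈ c.support, c d' * run d' [] w) = _
    rw [evl_sum]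
    refine Finset.sum_congr rfl fun d' _ => ?_
    rw [← evl_evl_run]
    exact evl_smul _ _ _
  rw [h0, Finset.sum_eq_single d] at h1
  · exact (mul_eq_zero.1 h1.symm).resolve_right h.runV_ne_zero
  · intro d' hd' hne
    by_contra h2
    rcases h.le_of_runV_ne_zero (right_ne_zero_of_mul h2) with h3 | h3
    · exact hne h3.symm
    · exact hd d' hd' h3
  · intro h2
    rw [Finsupp.notMem_support_iff.1 h2, zero_mul]

/-- Vectors used to label the blocks of a Motzkin path. -/
structure IsLabelling (p : ℕ → ι → ℂ) (r : ι → ℂ) : Prop where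
  sum_p : ∀ n, ∑ c, p n c = 0
  sum_r : ∑ c, r c ≠ 0
  dot_self : ∀ n, p n ⬝ᵥ p n ≠ 0
  dot_succ : ∀ n, p n ⬝ᵥ p (n + 1) = 0
  dot_r : ∀ n, p n ⬝ᵥ r = 0

/-- The labels of the open blocks at height `n`. -/
def openLabels (p : ℕ → ι → ℂ) : ℕ → List (ι → ℂ)
  | 0 => []
  | n + 1 => p n :: openLabels p n

/-- The labels of a Motzkin path started at height `n`. -/
def labels (p : ℕ → ι → ℂ) (r : ι → ℂ) : List SignType → ℕ → List (ι → ℂ)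
  | [], _ => []
  | .pos :: d, n => p n :: labels p r d (n + 1)
  | .zero :: d, n => r :: labels p r d n
  | .neg :: d, n => p (n - 1) :: labels p r d (n - 1)

theorem IsLabelling.adapted {p : ℕ → ι → ℂ} {r : ι → ℂ} (h : IsLabelling p r)
    {d : List SignType} {ss ε : List Bool} (hd : Path d ss ε) :
    Adapted d (openLabels p ss.length) (labels p r d ss.length) := by
  induction d generalizing ss ε with
  | nil =>
    rcases ss with _ | ⟨s, ss⟩
    · trivial
    · cases ε <;> exact hd.elim
  | cons x d ih =>
    rcases ε with _ | ⟨e, ε⟩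
    · cases x <;> cases ss <;> exact hd.elim
    cases x with
    | pos =>
      refine ⟨h.sum_p _, ?_, ih (ss := e :: ss) hd⟩
      rcases ss with _ | ⟨s, ss⟩
      · simp [openLabels]
      · simp [openLabels, h.dot_succ]
    | zero =>
      refine ⟨h.sum_r, ?_, ih hd.2⟩
      rcases ss with _ | ⟨s, ss⟩
      · simp [openLabels]
      · simp [openLabels, h.dot_r]
    | neg =>
      rcases ss with _ | ⟨s, ss⟩
      · exact hd.elim
      · exact ⟨h.sum_p _, h.dot_self _, ih hd.2⟩

theorem length_labels (p : ℕ → ι → ℂ) (r : ι → ℂ) (d : List SignType) (n : ℕ) :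
    (labels p r d n).length = d.length := by
  induction d generalizing n with
  | nil => rfl
  | cons x d ih => cases x <;> simp [labels, ih]

theorem labels_mem {p : ℕ → ι → ℂ} {r : ι → ℂ} {P : (ι → ℂ) → Prop} (hp : ∀ n, P (p n))
    (hr : P r) (d : List SignType) (n : ℕ) : ∀ v ∈ labels p r d n, P v := by
  induction d generalizing n with
  | nil => simp [labels]
  | cons x d ih => cases x <;> simp [labels, hp, hr] <;> exact ih _

variable [DecidableEq ι]

/-- The labels of pairs built from three letters. -/
def pairLabel (e : Fin 3 → ι) (n : ℕ) : ι → ℂ :=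
  if Even n then Pi.single (e 0) 1 - Pi.single (e 1) 1
  else Pi.single (e 0) 1 + Pi.single (e 1) 1 - Pi.single (e 2) 2

/-- The label of singletons built from three letters. -/
def singleLabel (e : Fin 3 → ι) : ι → ℂ :=
  Pi.single (e 0) 1 + Pi.single (e 1) 1 + Pi.single (e 2) 1

theorem isLabelling {e : Fin 3 → ι} (he : Function.Injective e) :
    IsLabelling (pairLabel e) (singleLabel e) := by
  have h01 : e 0 ≠ e 1 := he.ne (by decide)
  have h02 : e 0 ≠ e 2 := he.ne (by decide)
  have h12 : e 1 ≠ e 2 := he.ne (by decide)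
  constructor
  · intro n
    rw [pairLabel]
    split_ifs <;> simp [Finset.sum_add_distrib] <;> norm_num
  · simp [singleLabel, Finset.sum_add_distrib]; norm_num
  · intro n
    rw [pairLabel]
    split_ifs <;> simp [add_dotProduct, sub_dotProduct, h01, h02, h12, h01.symm, h02.symm, h12.symm] <;> norm_num
  · intro n
    rw [pairLabel, pairLabel]
    split_ifs with h1 h2 h2
    · exact absurd h2 (by rw [Nat.even_add_one]; exact not_not.2 h1)
    · simp [add_dotProduct, sub_dotProduct, h01, h02, h12, h01.symm, h02.symm, h12.symm]
    · simp [add_dotProduct, sub_dotProduct, h01, h02, h12, h01.symm, h02.symm, h12.symm]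
    · exact absurd (Nat.even_add_one.2 h1) h2
  · intro n
    rw [pairLabel, singleLabel]
    split_ifs <;> simp [add_dotProduct, sub_dotProduct, h01, h02, h12, h01.symm, h02.symm, h12.symm] <;> norm_num

theorem evl_eq_zero_of_support {M : Type*} [AddCommGroup M] [Module ℂ M] {V : List (ι → ℂ)}
    {G : List ι → M} (h : ∀ w, List.Forall₂ (fun (v : ι → ℂ) x => v x ≠ 0) V w → G w = 0) :
    evl V G = 0 := by
  induction V generalizing G with
  | nil => exact h [] List.Forall₂.nil
  | cons v V ih =>
    refine Finset.sum_eq_zero fun c _ => ?_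
    by_cases hc : v c = 0
    · rw [hc, zero_smul]
    · rw [ih fun w hw => h (c :: w) (List.Forall₂.cons hc hw), smul_zero]

omit [Fintype ι] in
theorem comb_filter {P : List SignType → Prop} [DecidablePred P] (c : List SignType →₀ ℂ)
    {w : List ι} (h : ∀ d, ¬ P d → run d [] w = 0) : comb (c.filter P) w = comb c w := by
  rw [comb, comb, Finsupp.support_filter, Finset.sum_filter]
  refine Finset.sum_congr rfl fun d _ => ?_
  split_ifs with hd
  · rw [Finsupp.filter_apply_pos _ _ hd]
  · rw [h d hd, mul_zero]

theorem exists_not_lt {s : Finset (List SignType)} (hs : s.Nonempty) :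
    ∃ d ∈ s, ∀ d' ∈ s, ¬ d < d' :=
  ⟨s.max' hs, s.max'_mem hs, fun d' hd' => not_lt.2 (s.le_max' d' hd')⟩

theorem mem_of_pairLabel_ne_zero {e : Fin 3 → ι} {n : ℕ} {x : ι} (h : pairLabel e n x ≠ 0) :
    x ∈ Set.range e := by
  by_contra hx
  have hx' : ∀ i, x ≠ e i := fun i hi => hx ⟨i, hi.symm⟩
  rw [pairLabel] at h
  split_ifs at h <;> simp [hx'] at h

theorem mem_of_singleLabel_ne_zero {e : Fin 3 → ι} {x : ι} (h : singleLabel e x ≠ 0) :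
    x ∈ Set.range e := by
  by_contra hx
  have hx' : ∀ i, x ≠ e i := fun i hi => hx ⟨i, hi.symm⟩
  simp [singleLabel, hx'] at h

theorem length_of_adm {pr : Bool → Bool → Prop} {sg : Bool → Prop} {d : List SignType}
    {ss ε : List Bool} (h : Adm pr sg d ss ε) : d.length = ε.length := by
  induction d generalizing ss ε with
  | nil =>
    rcases ss with _ | ⟨s, ss⟩ <;> rcases ε with _ | ⟨e, ε⟩ <;> first | rfl | exact h.elim
  | cons x d ih =>
    rcases ε with _ | ⟨e, ε⟩
    · cases x <;> cases ss <;> exact h.elim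
    cases x with
    | pos => exact congrArg (· + 1) (ih (ss := e :: ss) h)
    | zero => exact congrArg (· + 1) (ih h.2)
    | neg =>
      rcases ss with _ | ⟨s, ss⟩
      · exact h.elim
      · exact congrArg (· + 1) (ih h.2)

omit [Fintype ι] in
theorem run_eq_zero_of_not_path {d : List SignType} {ε : List Bool} (h : ¬ Path d [] ε)
    {w : List ι} (hw : w.length = ε.length) : run d [] w = 0 := by
  by_contra h'
  exact h (path_of_run_ne_zero (stk := ([] : List ι)) rfl hw.symm h')

omit [Fintype ι] [DecidableEq ι] in
theorem exists_mem_of_forall₂ {α : Type*} {R : α → ι → Prop} {V : List α} {w : List ι}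
    (h : List.Forall₂ R V w) {x : ι} (hx : x ∈ w) : ∃ v ∈ V, R v x := by
  induction h with
  | nil => simp at hx
  | @cons v y V w hvy h ih =>
    rcases List.mem_cons.1 hx with rfl | hx
    · exact ⟨v, by simp, hvy⟩
    · obtain ⟨v, hv, hvx⟩ := ih hx
      exact ⟨v, by simp [hv], hvx⟩

/-- A combination vanishing on all words in three letters vanishes. -/
theorem comb_eq_zero {k : ℕ} {c : List SignType →₀ ℂ} {e : Fin 3 → ι}
    (he : Function.Injective e)
    (h : ∀ w : List ι, w.length = k → (∀ x ∈ w, x ∈ Set.range e) → comb c w = 0)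
    {κ : Type*} [DecidableEq κ] (w : List κ) (hw : w.length = k) : comb c w = 0 := by
  classical
  set P : List SignType → Prop := fun d => Path d [] (List.replicate k true) with hP
  rw [← comb_filter (P := P) c fun d hd => run_eq_zero_of_not_path hd (by simp [hw])]
  by_cases hs : (c.filter P).support.Nonempty
  · exfalso
    obtain ⟨d, hd, hmax⟩ := exists_not_lt hs
    have hd' : Path d [] (List.replicate k true) := by
      rw [Finsupp.support_filter, Finset.mem_filter] at hd
      exact hd.2
    refine Finsupp.mem_support_iff.1 hd
      (coeff_eq_zero_of_adapted ((isLabelling he).adapted hd') hmax ?_)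
    refine evl_eq_zero_of_support fun w hw => ?_
    have hwk : w.length = k := by
      rw [← hw.length_eq, length_labels, length_of_adm hd', List.length_replicate]
    rw [comb_filter c fun d hd => run_eq_zero_of_not_path hd (by simp [hwk])]
    refine h w hwk fun x hx => ?_
    obtain ⟨v, hv, hvx⟩ := exists_mem_of_forall₂ hw hx
    exact labels_mem (P := fun v => v x ≠ 0 → x ∈ Set.range e)
      (fun n => mem_of_pairLabel_ne_zero) mem_of_singleLabel_ne_zero d _ v hv hvx
  · rw [Finset.not_nonempty_iff_eq_empty] at hs
    rw [comb, hs, Finset.sum_empty]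

end triangular

section extension
variable {ι : Type*} [DecidableEq ι]

theorem run_map {κ : Type*} [DecidableEq κ] {g : κ → ι} (hg : Function.Injective g)
    (d : List SignType) (stk w : List κ) : run d (stk.map g) (w.map g) = run d stk w := by
  induction d generalizing stk w with
  | nil => cases stk <;> cases w <;> rfl
  | cons x d ih =>
    rcases w with _ | ⟨c, w⟩
    · cases x <;> cases stk <;> rfl
    cases x with
    | pos => exact ih (c :: stk) w
    | zero => cases stk <;> exact ih _ w
    | neg =>
      cases stk with
      | nil => rfl
      | cons t stk => simp only [List.map_cons, run, hg.eq_iff, ih]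

theorem comb_map {κ : Type*} [DecidableEq κ] {g : κ → ι} (hg : Function.Injective g)
    (c : List SignType →₀ ℂ) (w : List κ) : comb c (w.map g) = comb c w := by
  simp only [comb, ← run_map hg _ [] w, List.map_nil]

omit [DecidableEq ι] in
/-- Fill the holes of a pattern with letters. -/
def plug {κ : Type*} (g : κ → ι) : List (Option ι) → List κ → List ι
  | some b :: p, x => b :: plug g p x
  | none :: p, c :: x => g c :: plug g p x
  | _, _ => []

/-- The entries at the holes of a pattern. -/
def holes {α : Type*} : List (Option ι) → List α → List α
  | some _ :: p, _ :: ε => holes p ε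
  | none :: p, e :: ε => e :: holes p ε
  | _, _ => []

variable [Fintype ι] {κ : Type*} [Fintype κ] {A : Type*} [Ring A] [Algebra ℂ A]

/-- The matrices `P` extend the matrices `T` by the identity outside of the range of `g`. -/
structure Extends (g : κ → ι) (P : Bool → ι → ι → A) (T : Bool → κ → κ → A) : Prop where
  inside : ∀ e c (G : ι → A), ∑ j, P e j (g c) * G j = ∑ a, T e a c * G (g a)
  outside : ∀ e b, b ∉ Set.range g → ∀ G : ι → A, ∑ j, P e j b * G j = G b

omit [DecidableEq ι] [Fintype ι] [Fintype κ] in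
theorem length_plug {α : Type*} (g : κ → ι) {p : List (Option ι)} {ε : List α}
    (hε : p.length = ε.length) {x : List κ} (hx : x.length = (holes p ε).length) :
    (plug g p x).length = ε.length := by
  induction p generalizing ε x with
  | nil => simpa [plug] using hε
  | cons o p ih =>
    obtain ⟨e, ε, rfl⟩ := List.exists_cons_of_length_eq_add_one hε.symm
    cases o with
    | some b => exact congrArg (· + 1) (ih (by simpa using hε) hx)
    | none =>
      obtain ⟨c, x, rfl⟩ := List.exists_cons_of_length_eq_add_one hx
      exact congrArg (· + 1) (ih (by simpa using hε) (by simpa [holes] using hx))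

omit [DecidableEq ι] in
theorem Extends.act_plug {g : κ → ι} {P : Bool → ι → ι → A} {T : Bool → κ → κ → A}
    (h : Extends g P T) {p : List (Option ι)} (hp : ∀ b, some b ∈ p → b ∉ Set.range g)
    {ε : List Bool} (hε : p.length = ε.length) {x : List κ} (hx : x.length = (holes p ε).length)
    (f : List ι → ℂ) :
    act P ε (plug g p x) f = act T (holes p ε) x fun u => f (plug g p u) := by
  induction p generalizing ε x f with
  | nil =>
    rw [List.length_eq_zero_iff.1 hε.symm] at hx ⊢
    rw [List.length_eq_zero_iff.1 hx]
    rfl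
  | cons o p ih =>
    obtain ⟨e, ε, rfl⟩ := List.exists_cons_of_length_eq_add_one hε.symm
    have hp' : ∀ b, some b ∈ p → b ∉ Set.range g := fun b hb => hp b (by simp [hb])
    cases o with
    | some b =>
      simp only [plug, act, holes]
      rw [h.outside e b (hp b (by simp)), ih hp' (by simpa using hε) hx]
    | none =>
      obtain ⟨c, x, rfl⟩ := List.exists_cons_of_length_eq_add_one hx
      simp only [plug, act, holes]
      rw [h.inside e c]
      exact Finset.sum_congr rfl fun a _ => by
        rw [ih hp' (by simpa using hε) (by simpa [holes] using hx)]

omit [DecidableEq ι] in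
theorem Extends.inv_plug {g : κ → ι} {P : Bool → ι → ι → A} {T : Bool → κ → κ → A}
    (h : Extends g P T) {p : List (Option ι)} (hp : ∀ b, some b ∈ p → b ∉ Set.range g)
    {ε : List Bool} (hε : p.length = ε.length) {f : List ι → ℂ} (hf : Inv P ε f) :
    Inv T (holes p ε) fun u => f (plug g p u) := by
  intro x hx
  rw [← h.act_plug hp hε hx, hf _ (length_plug g hε hx)]

/-- Every word is a pattern without letters in the range of `g`, with the holes filled. -/
theorem exists_plug {α : Type*} (g : κ → ι) (w : List ι) (ε : List α) (hw : w.length = ε.length) :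
    ∃ p x, p.length = ε.length ∧ x.length = (holes p ε).length ∧ plug g p x = w ∧
      (∀ b, some b ∈ p → b ∉ Set.range g ∧ b ∈ w) ∧
      ∀ y : List κ, ∀ b ∈ plug g p y, (b ∈ w ∧ b ∉ Set.range g) ∨ ∃ a ∈ y, b = g a := by
  induction w generalizing ε with
  | nil =>
    refine ⟨[], [], hw, rfl, rfl, by simp, ?_⟩
    intro y b hb
    simp [plug] at hb
  | cons b w ih =>
    obtain ⟨e, ε, rfl⟩ := List.exists_cons_of_length_eq_add_one hw.symm
    obtain ⟨p, x, h1, h2, h3, h4, h5⟩ := ih ε (by simpa using hw)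
    by_cases hb : b ∈ Set.range g
    · obtain ⟨c, rfl⟩ := hb
      refine ⟨none :: p, c :: x, by simp [h1], by simp [holes, h2], by simp [plug, h3], ?_, ?_⟩
      · intro b hb
        obtain ⟨h6, h7⟩ := h4 b (by simpa using hb)
        exact ⟨h6, by simp [h7]⟩
      · intro y b hb
        rcases y with _ | ⟨a, y⟩
        · simp [plug] at hb
        · rcases List.mem_cons.1 hb with rfl | hb
          · exact Or.inr ⟨a, by simp, rfl⟩
          · rcases h5 y b hb with h | ⟨a', ha', h⟩
            · exact Or.inl ⟨by simp [h.1], h.2⟩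
            · exact Or.inr ⟨a', by simp [ha'], h⟩
    · refine ⟨some b :: p, x, by simp [h1], by simp [holes, h2], by simp [plug, h3], ?_, ?_⟩
      · intro b' hb'
        rcases List.mem_cons.1 hb' with h | h
        · obtain rfl := Option.some_inj.1 h
          exact ⟨hb, by simp⟩
        · exact ⟨(h4 b' h).1, by simp [(h4 b' h).2]⟩
      · intro y b' hb'
        rcases List.mem_cons.1 hb' with rfl | hb'
        · exact Or.inl ⟨by simp, hb⟩
        · rcases h5 y b' hb' with h | h
          · exact Or.inl ⟨by simp [h.1], h.2⟩
          · exact Or.inr h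

theorem exists_perm (S : Finset ι) (g : κ → ι) (hg : Function.Injective g) :
    ∃ σ : Equiv.Perm ι, (S.card ≤ Fintype.card κ → ∀ x ∈ S, σ x ∈ Set.range g) ∧
      (Fintype.card κ ≤ S.card → ∀ a, ∃ x ∈ S, σ x = g a) := by
  classical
  have hc : (Finset.univ.image g).card = Fintype.card κ := Finset.card_image_of_injective _ hg
  have hκ : Fintype.card κ ≤ Fintype.card ι := Fintype.card_le_of_injective g hg
  have key : ∀ T : Finset ι, T.card = Fintype.card κ →
      ∃ σ : Equiv.Perm ι, T.image σ = Finset.univ.image g := by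
    intro T hT
    have e : {x // x ∈ T} ≃ {x // x ∈ Finset.univ.image g} :=
      Finset.equivOfCardEq (hT.trans hc.symm)
    refine ⟨e.extendSubtype, Finset.eq_of_subset_of_card_le ?_ ?_⟩
    · intro y hy
      obtain ⟨x, hx, rfl⟩ := Finset.mem_image.1 hy
      exact e.extendSubtype_mem x hx
    · rw [Finset.card_image_of_injective _ (Equiv.injective _), hT, hc]
  rcases le_total S.card (Fintype.card κ) with h | h
  · obtain ⟨T, hST, -, hT⟩ := Finset.exists_subsuperset_card_eq (Finset.subset_univ S) h
      (by simpa using hκ)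
    obtain ⟨σ, hσ⟩ := key T hT
    have h1 : ∀ x ∈ S, σ x ∈ Set.range g := fun x hx => by
      have := hσ ▸ Finset.mem_image_of_mem σ (hST hx)
      simpa using this
    refine ⟨σ, fun _ => h1, fun h' a => ?_⟩
    have hS : S = T := Finset.eq_of_subset_of_card_le hST (by omega)
    have : g a ∈ T.image σ := hσ ▸ Finset.mem_image_of_mem g (Finset.mem_univ a)
    obtain ⟨x, hx, hx'⟩ := Finset.mem_image.1 this
    exact ⟨x, hS ▸ hx, hx'⟩
  · obtain ⟨T, hST, hT⟩ := Finset.exists_subset_card_eq h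
    obtain ⟨σ, hσ⟩ := key T hT
    refine ⟨σ, fun h' x hx => ?_, fun _ a => ?_⟩
    · have hS : T = S := Finset.eq_of_subset_of_card_le hST (by omega)
      have := hσ ▸ Finset.mem_image_of_mem σ (hS ▸ hx)
      simpa using this
    · have : g a ∈ T.image σ := hσ ▸ Finset.mem_image_of_mem g (Finset.mem_univ a)
      obtain ⟨x, hx, hx'⟩ := Finset.mem_image.1 this
      exact ⟨x, hST hx, hx'⟩

/-- A functional which is invariant under permutations of the letters and under an extension of
the twisted magic unitary is a combination of noncrossing pairings with singletons. -/
theorem isComb_of_extends {g : Fin 4 → ι} (hg : Function.Injective g)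
    {P : Bool → ι → ι → TwistAlg} (hP : Extends g P fun _ => twist)
    (hP₂ : ∀ e e' x y, ∑ j, P e j x * P e' j y = if x = y then 1 else 0)
    (hP₁ : ∀ e x, ∑ j, P e j x = 1) {ε : List Bool} {f : List ι → ℂ} (hf : Inv P ε f)
    (hσ : ∀ (σ : Equiv.Perm ι) (w : List ι), w.length = ε.length → f (w.map σ) = f w) :
    IsComb ε.length f := by
  have hnone : ∀ x : List (Fin 4), plug g (List.replicate x.length none) x = x.map g := by
    intro x
    induction x with
    | nil => rfl
    | cons c x ih => simp [List.replicate_succ, plug, ih]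
  have hholes : ∀ ε : List Bool, holes (List.replicate ε.length (none : Option ι)) ε = ε := by
    intro ε
    induction ε with
    | nil => rfl
    | cons c x ih => simp [List.replicate_succ, holes, ih]
  obtain ⟨c, hc⟩ := isComb_of_twist_inv (hP.inv_plug (p := List.replicate ε.length none)
    (by simp) (by simp) hf)
  rw [hholes] at hc
  have hbase : ∀ x : List (Fin 4), x.length = ε.length → f (x.map g) = comb c (x.map g) := by
    intro x hx
    rw [comb_map hg, ← hc x hx, ← hx]
    exact congrArg f (hnone x).symm
  have hinv : Inv P ε fun w => f w - comb c w := by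
    have h2 : ∀ d, Inv P ε (run d [] : List ι → ℂ) := by
      intro d
      by_cases hd : Path d [] ε
      · exact inv_run (fun e e' _ => hP₂ e e') (fun e _ => hP₁ e) hd
      · intro w hw
        rw [act_congr fun u hu => run_eq_zero_of_not_path hd (hu.trans hw), act_zero,
          run_eq_zero_of_not_path hd hw, zero_smul]
    have h3 := hf.add ((Inv.sum (s := c.support) fun d _ => (h2 d).const_mul (c d)).const_mul (-1))
    refine h3.congr fun w _ => ?_
    rw [comb]
    ring
  have hperm : ∀ (σ : Equiv.Perm ι) (w : List ι), w.length = ε.length →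
      f (w.map σ) - comb c (w.map σ) = f w - comb c w := fun σ w hw => by
    rw [hσ σ w hw, comb_map σ.injective]
  have key : ∀ (n : ℕ) (w : List ι), w.length = ε.length → w.toFinset.card ≤ n →
      f w - comb c w = 0 := by
    intro n
    induction n using Nat.strong_induction_on with
    | _ n ih =>
      intro w hw hn
      obtain ⟨σ, h1, h2⟩ := exists_perm w.toFinset g hg
      rw [← hperm σ w hw]
      rw [Fintype.card_fin] at h1 h2
      by_cases h4 : w.toFinset.card ≤ 4
      · have h5 : ∃ x : List (Fin 4), x.map g = w.map σ := by
          have := h1 h4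
          have h6 : ∀ y ∈ w.map σ, y ∈ Set.range g := by
            intro y hy
            obtain ⟨x, hx, rfl⟩ := List.mem_map.1 hy
            exact this x (by simpa using hx)
          rw [← Set.mem_range, Set.range_list_map]
          exact h6
        obtain ⟨x, hx⟩ := h5
        rw [← hx, hbase x (by rw [← hw, ← List.length_map (f := g), hx, List.length_map]), sub_self]
      · have h3 := h2 (by omega)
        have hw' : (w.map σ).length = ε.length := by simpa using hw
        obtain ⟨p, x, e1, e2, e3, e4, e5⟩ := exists_plug g (w.map σ) ε hw'
        obtain ⟨c', hc'⟩ := isComb_of_twist_inv (hP.inv_plug (p := p)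
          (fun b hb => (e4 b hb).1) e1 hinv)
        rw [← e3]
        refine (hc' x e2).trans (comb_eq_zero (Fin.castSucc_injective 3) ?_ x e2)
        intro y hy hy'
        rw [← hc' y hy]
        have hcard : (plug g p y).toFinset.card < w.toFinset.card := by
          rw [← Finset.card_image_of_injective w.toFinset σ.injective]
          refine Finset.card_lt_card ⟨?_, ?_⟩
          · intro b hb
            rcases e5 y b (by simpa using hb) with h | ⟨a, -, rfl⟩
            · simpa using h.1
            · obtain ⟨z, hz, hz'⟩ := h3 a
              exact Finset.mem_image.2 ⟨z, hz, hz'⟩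
          · intro hsub
            obtain ⟨z, hz, hz'⟩ := h3 3
            have := hsub (Finset.mem_image.2 ⟨z, hz, hz'⟩)
            rcases e5 y (g 3) (by simpa using this) with h | ⟨a, ha, h⟩
            · exact h.2 ⟨3, rfl⟩
            · obtain ⟨b, hb⟩ := hy' a ha
              rw [← hb] at h
              have := hg h
              fin_cases b <;> simp at this
        refine ih _ (by omega) _ ?_ le_rfl
        exact length_plug g e1 hy
  exact ⟨c, fun w hw => sub_eq_zero.1 (key _ w hw le_rfl)⟩

end extension

section transvection
variable {ι : Type*} [DecidableEq ι]

/-- An infinitesimal transvection and its inverse transpose. -/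
def transv (δ : Bool) (i j : ι) (e : Bool) (y z : ι) : DualNumber ℂ :=
  (if y = z then 1 else 0) + if e = δ then (if y = i ∧ z = j then DualNumber.eps else 0)
    else if y = j ∧ z = i then -DualNumber.eps else 0

theorem transv_of_ne {δ : Bool} {i j : ι} {e : Bool} {z : ι} (h : z ≠ j) (h' : z = i → e = δ)
    (y : ι) : transv δ i j e y z = if y = z then 1 else 0 := by
  rw [transv]
  by_cases he : e = δ
  · simp [he, h]
  · have : z ≠ i := fun hz => he (h' hz)
    simp [he, this]

variable [Fintype ι]

theorem sum_transv {δ : Bool} {i j : ι} (e : Bool) (z : ι) (G : ι → DualNumber ℂ) :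
    ∑ y, transv δ i j e y z * G y = G z + if e = δ then (if z = j then DualNumber.eps * G i else 0)
      else if z = i then -(DualNumber.eps * G j) else 0 := by
  simp only [transv, add_mul, Finset.sum_add_distrib, ite_mul, one_mul, zero_mul,
    Finset.sum_ite_eq', Finset.mem_univ, if_true]
  congr 1
  split_ifs with h1 h2 h2
  · subst h2
    simp
  · simp [h2]
  · subst h2
    simp
  · simp [h2]

theorem sum_transv' {δ : Bool} {i j : ι} (e : Bool) (z : ι) (G : ι → DualNumber ℂ) :
    ∑ y, transv δ i j e z y * G y = G z + if e = δ then (if z = i then DualNumber.eps * G j else 0)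
      else if z = j then -(DualNumber.eps * G i) else 0 := by
  simp only [transv, add_mul, Finset.sum_add_distrib, ite_mul, one_mul, zero_mul,
    Finset.sum_ite_eq, Finset.mem_univ, if_true]
  congr 1
  split_ifs with h1 h2 h2
  · subst h2
    simp
  · simp [h2]
  · subst h2
    simp
  · simp [h2]

theorem transv_col {δ : Bool} {i j : ι} (hij : i ≠ j) {e e' : Bool} (he : e ≠ e') (x y : ι) :
    ∑ z, transv δ i j e z x * transv δ i j e' z y = if x = y then 1 else 0 := by
  rw [sum_transv]
  have h1 : e' = !e := by cases e <;> cases e' <;> simp_all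
  subst h1
  by_cases h : e = δ
  · subst h
    by_cases hx : x = j
    · subst hx
      simp [transv, mul_add, hij.symm, eq_comm (a := y)]
      split_ifs <;> simp_all
    · simp [transv, hx]
  · have h' : (!e) = δ := by cases e <;> cases δ <;> simp_all
    by_cases hx : x = i
    · subst hx
      simp [transv, h, h', mul_add, hij, eq_comm (a := y)]
    · simp [transv, h, h', hx]

theorem transv_row {δ : Bool} {i j : ι} (hij : i ≠ j) {e e' : Bool} (he : e ≠ e') (x y : ι) :
    ∑ z, transv δ i j e x z * transv δ i j e' y z = if x = y then 1 else 0 := by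
  rw [sum_transv']
  have h1 : e' = !e := by cases e <;> cases e' <;> simp_all
  subst h1
  by_cases h : e = δ
  · subst h
    by_cases hx : x = i
    · subst hx
      simp [transv, mul_add, hij, eq_comm (a := x)]
      split_ifs <;> simp_all
    · simp [transv, hx, eq_comm (a := x)]
  · have h' : (!e) = δ := by cases e <;> cases δ <;> simp_all
    by_cases hx : x = j
    · subst hx
      simp [transv, h, h', mul_add, hij.symm, eq_comm (a := x)]
    · simp [transv, h, h', hx, eq_comm (a := x)]

theorem act_transv_fixed {δ : Bool} {i j : ι} {ε : List Bool} {w : List ι}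
    (h : List.Forall₂ (fun e x => x ≠ j ∧ (x = i → e = δ)) ε w) (f : List ι → ℂ) :
    act (transv δ i j) ε w f = f w • (1 : DualNumber ℂ) := by
  induction h generalizing f with
  | nil => rfl
  | cons h1 h ih => simp [act, transv_of_ne h1.1 h1.2, ih]

theorem exists_act_transv {δ : Bool} {i j : ι} {ε : List Bool} {w : List ι}
    (h : List.Forall₂ (fun e x => x ≠ j ∧ (x = i → e = δ)) ε w) (hi : i ∈ w) (f : List ι → ℂ) :
    ∃ w', w'.length = w.length ∧ act (transv δ i j) ε w' f =
      f w' • (1 : DualNumber ℂ) + f w • DualNumber.eps := by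
  induction h generalizing f with
  | nil => simp at hi
  | @cons e y ε w h1 h ih =>
    by_cases hw : i ∈ w
    · obtain ⟨w', h2, h3⟩ := ih hw fun u => f (y :: u)
      refine ⟨y :: w', by simp [h2], ?_⟩
      simp [act, transv_of_ne h1.1 h1.2, h3]
    · obtain rfl : i = y := by simpa [hw] using hi
      refine ⟨j :: w, by simp, ?_⟩
      obtain rfl : e = δ := h1.2 rfl
      rw [act, sum_transv]
      simp [act_transv_fixed h]

theorem Inv.eq_zero_of_transv {δ : Bool} {i j : ι} {ε : List Bool} {f : List ι → ℂ}
    (hf : Inv (transv δ i j) ε f) {w : List ι}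
    (h : List.Forall₂ (fun e x => x ≠ j ∧ (x = i → e = δ)) ε w) (hi : i ∈ w) : f w = 0 := by
  obtain ⟨w', h1, h2⟩ := exists_act_transv h hi f
  rw [hf w' (h1.trans h.length_eq.symm)] at h2
  have h3 : f w • (DualNumber.eps : DualNumber ℂ) = 0 := by simpa using h2
  have h4 := congrArg TrivSqZeroExt.snd h3
  simpa using h4

/-- The labels of the open blocks, some of which are marked. -/
def markedLabels (p : ℕ → ι → ℂ) (m : ι → ℂ) : List Bool → List (ι → ℂ)
  | [] => []
  | b :: ms => (if b then m else p ms.length) :: markedLabels p m ms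

omit [DecidableEq ι] [Fintype ι] in
theorem markedLabels_replicate (p : ℕ → ι → ℂ) (m : ι → ℂ) (n : ℕ) :
    markedLabels p m (List.replicate n false) = openLabels p n := by
  induction n with
  | zero => rfl
  | succ n ih => simp [List.replicate_succ, markedLabels, openLabels, ih]

/-- A block of a Motzkin path which is a singleton or a pair with equal signs can be labelled by
two additional letters. -/
theorem exists_marked {p : ℕ → ι → ℂ} {r : ι → ℂ} (h : IsLabelling p r) {i₁ i₂ j : ι}
    (h12 : i₁ ≠ i₂) (h1j : i₁ ≠ j) (h2j : i₂ ≠ j)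
    (hp : ∀ n, p n i₁ = 0 ∧ p n i₂ = 0 ∧ p n j = 0) (hr : r i₁ = 0 ∧ r i₂ = 0 ∧ r j = 0)
    {d : List SignType} {ss ε : List Bool} (hd : Path d ss ε) :
    Adm (· ≠ ·) (fun _ => False) d ss ε ∨ ∃ (δ : Bool) (V : List (ι → ℂ)) (ms : List Bool),
      Adapted d (markedLabels p (Pi.single i₁ 1 - Pi.single i₂ 1) ms) V ∧ ms.count true ≤ 1 ∧
      List.Forall₂ (fun b s => b = true → s = δ) ms ss ∧
      List.Forall₂ (fun e v => v j = 0 ∧ (e ≠ δ → v i₁ = 0 ∧ v i₂ = 0)) ε V ∧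
      ∃ v ∈ V, ∀ x, v x ≠ 0 → x = i₁ ∨ x = i₂ := by
  set m : ι → ℂ := Pi.single i₁ 1 - Pi.single i₂ 1 with hm
  have hm1 : ∑ c, m c = 0 := by simp [hm]
  have hmm : m ⬝ᵥ m ≠ 0 := by simp [hm, sub_dotProduct, h12, h12.symm]
  have hmp : ∀ n, m ⬝ᵥ p n = 0 := fun n => by simp [hm, sub_dotProduct, hp]
  have hpm : ∀ n, p n ⬝ᵥ m = 0 := fun n => by rw [dotProduct_comm, hmp]
  have hmj : m j = 0 := by simp [hm, h1j.symm, h2j.symm]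
  have hms : ∀ x, m x ≠ 0 → x = i₁ ∨ x = i₂ := by
    intro x hx
    by_contra! h
    simp [hm, h.1, h.2] at hx
  have hlab : ∀ (δ : Bool) {d : List SignType} {ss ε : List Bool}, Path d ss ε →
      List.Forall₂ (fun e v => v j = 0 ∧ (e ≠ δ → v i₁ = 0 ∧ v i₂ = 0)) ε
        (labels p r d ss.length) := by
    intro δ d ss ε hd
    refine (List.forall₂_iff_get).2 ⟨?_, fun n h1 h2 => ?_⟩
    · rw [length_labels, length_of_adm hd]
    · have := labels_mem (P := fun v => v j = 0 ∧ v i₁ = 0 ∧ v i₂ = 0)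
        (fun n => ⟨(hp n).2.2, (hp n).1, (hp n).2.1⟩) ⟨hr.2.2, hr.1, hr.2.1⟩ d ss.length _
        (List.get_mem _ ⟨n, h2⟩)
      exact ⟨this.1, fun _ => this.2⟩
  have hrep : ∀ (δ : Bool) (ss : List Bool),
      List.Forall₂ (fun b s => b = true → s = δ) (List.replicate ss.length false) ss := by
    intro δ ss
    induction ss with
    | nil => exact List.Forall₂.nil
    | cons s ss ih => exact List.Forall₂.cons (by simp) ih
  induction d generalizing ss ε with
  | nil =>
    left
    rcases ss with _ | ⟨s, ss⟩ <;> rcases ε with _ | ⟨e, ε⟩ <;> exact hd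
  | cons x d ih =>
    rcases ε with _ | ⟨e, ε⟩
    · cases x <;> cases ss <;> exact hd.elim
    cases x with
    | pos =>
      rcases ih (ss := e :: ss) hd with hg | ⟨δ, V, ms, h1, h2, h3, h4, h5⟩
      · exact Or.inl hg
      · right
        rcases h3 with _ | @⟨b, _, ms, _, h6, h3⟩
        refine ⟨δ, (if b then m else p ms.length) :: V, ms, ⟨?_, ?_, h1⟩, ?_, h3,
          List.Forall₂.cons ⟨?_, fun he => ?_⟩ h4, ?_⟩
        · split_ifs <;> simp [hm1, h.sum_p]
        · rcases ms with _ | ⟨b', ms⟩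
          · simp [markedLabels]
          · cases b <;> cases b' <;> simp [markedLabels, h.dot_succ, hmp, hpm] at h2 ⊢
        · exact le_trans (by rw [List.count_cons]; omega) h2
        · split_ifs
          · exact hmj
          · exact (hp _).2.2
        · cases b
          · exact ⟨(hp _).1, (hp _).2.1⟩
          · exact absurd (h6 rfl) he
        · obtain ⟨v, hv, hv'⟩ := h5
          exact ⟨v, by simp [hv], hv'⟩
    | zero =>
      right
      refine ⟨e, Pi.single i₁ 1 :: labels p r d ss.length, List.replicate ss.length false,
        ⟨by simp, ?_, ?_⟩, ?_, hrep _ _, List.Forall₂.cons ⟨by simp [h1j.symm], by simp⟩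
        (hlab e hd.2), Pi.single i₁ 1, by simp, ?_⟩
      · rw [markedLabels_replicate]
        cases ss <;> simp [openLabels, hp]
      · rw [markedLabels_replicate]
        exact h.adapted hd.2
      · rw [List.count_replicate]
        simp
      · intro x hx
        left
        by_contra h
        simp [h] at hx
    | neg =>
      rcases ss with _ | ⟨s, ss⟩
      · exact hd.elim
      by_cases hse : s = e
      · right
        subst hse
        refine ⟨s, m :: labels p r d ss.length, true :: List.replicate ss.length false,
          ⟨hm1, hmm, ?_⟩, ?_, List.Forall₂.cons (by simp) (hrep _ _),
          List.Forall₂.cons ⟨hmj, by simp⟩ (hlab s hd.2), m, by simp, hms⟩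
        · rw [markedLabels_replicate]
          exact h.adapted hd.2
        · rw [List.count_cons, List.count_replicate]
          simp
      · rcases ih (ss := ss) hd.2 with hg | ⟨δ, V, ms, h1, h2, h3, h4, h5⟩
        · exact Or.inl ⟨hse, hg⟩
        · right
          refine ⟨δ, p ms.length :: V, false :: ms, ⟨h.sum_p _, h.dot_self _, h1⟩, ?_,
            List.Forall₂.cons (by simp) h3, List.Forall₂.cons ⟨(hp _).2.2, fun _ =>
            ⟨(hp _).1, (hp _).2.1⟩⟩ h4, ?_⟩
          · simpa using h2
          · obtain ⟨v, hv, hv'⟩ := h5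
            exact ⟨v, by simp [hv], hv'⟩

theorem forall₂_comp {α β γ : Type*} {R : α → β → Prop} {S : β → γ → Prop} {T : α → γ → Prop}
    (h : ∀ a b c, R a b → S b c → T a c) {l₁ : List α} {l₂ : List β} {l₃ : List γ}
    (h₁ : List.Forall₂ R l₁ l₂) (h₂ : List.Forall₂ S l₂ l₃) : List.Forall₂ T l₁ l₃ := by
  induction h₁ generalizing l₃ with
  | nil => cases h₂; exact List.Forall₂.nil
  | cons h1 _ ih =>
    rcases h₂ with _ | ⟨h2, h₂⟩
    exact List.Forall₂.cons (h _ _ _ h1 h2) (ih h₂)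

omit [DecidableEq ι] [Fintype ι] in
theorem exists_mem_right_of_forall₂ {α : Type*} {R : α → ι → Prop} {V : List α} {w : List ι}
    (h : List.Forall₂ R V w) {v : α} (hv : v ∈ V) : ∃ x ∈ w, R v x := by
  induction h with
  | nil => simp at hv
  | @cons u y V w hvy h ih =>
    rcases List.mem_cons.1 hv with rfl | hv
    · exact ⟨y, by simp, hvy⟩
    · obtain ⟨x, hx, hvx⟩ := ih hv
      exact ⟨x, by simp [hx], hvx⟩

theorem inv_comb {A : Type*} [Ring A] [Algebra ℂ A] {v : Bool → ι → ι → A}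
    {pr : Bool → Bool → Prop} {sg : Bool → Prop}
    (hpr : ∀ e e', pr e e' → ∀ x y, ∑ j, v e j x * v e' j y = if x = y then 1 else 0)
    (hsg : ∀ e, sg e → ∀ x, ∑ j, v e j x = 1) {ε : List Bool} {c : List SignType →₀ ℂ}
    (hc : ∀ d ∈ c.support, Adm pr sg d [] ε) : Inv v ε (comb c) :=
  Inv.sum fun d hd => (inv_run hpr hsg (hc d hd)).const_mul _

/-- A combination which is invariant under transvections only involves pairs of opposite signs. -/
theorem inv_of_transv {A : Type*} [Ring A] [Algebra ℂ A] {e : Fin 3 → ι}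
    (he : Function.Injective e) {i₁ i₂ j : ι} (h12 : i₁ ≠ i₂) (h1j : i₁ ≠ j) (h2j : i₂ ≠ j)
    (h₁ : i₁ ∉ Set.range e) (h₂ : i₂ ∉ Set.range e) (hj : j ∉ Set.range e) {ε : List Bool}
    {f : List ι → ℂ} (hf : IsComb ε.length f)
    (hf₁ : ∀ δ, Inv (transv δ i₁ j) ε f) (hf₂ : ∀ δ, Inv (transv δ i₂ j) ε f)
    {v : Bool → ι → ι → A}
    (hv : ∀ e e', e ≠ e' → ∀ x y, ∑ j, v e j x * v e' j y = if x = y then 1 else 0) :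
    Inv v ε f := by
  classical
  obtain ⟨c, hc⟩ := hf
  set Good : List SignType → Prop := fun d => Adm (· ≠ ·) (fun _ => False) d [] ε with hGood
  set c' := (c.filter fun d => ¬ Good d).filter fun d => Path d [] ε with hc'
  have hsplit : ∀ w : List ι, w.length = ε.length → f w = comb (c.filter Good) w + comb c' w := by
    intro w hw
    rw [hc w hw, hc', comb_filter _ fun d hd => run_eq_zero_of_not_path hd hw]
    simp only [comb, Finsupp.support_filter]
    rw [← Finset.sum_filter_add_sum_filter_not c.support Good]
    congr 1
    · exact Finset.sum_congr rfl fun d hd => by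
        rw [Finsupp.filter_apply_pos _ _ (Finset.mem_filter.1 hd).2]
    · exact Finset.sum_congr rfl fun d hd => by
        rw [Finsupp.filter_apply_pos (fun d => ¬ Good d) c (Finset.mem_filter.1 hd).2]
  have hgood : ∀ d ∈ (c.filter Good).support, Good d := fun d hd => by
    rw [Finsupp.support_filter, Finset.mem_filter] at hd
    exact hd.2
  have hbad : ∀ {δ : Bool} {i : ι}, i ≠ j → Inv (transv δ i j) ε f →
      Inv (transv δ i j) ε (comb c') := by
    intro δ i hij hf
    refine (hf.add ((inv_comb (fun e e' he => transv_col hij he)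
      (fun _ h => h.elim) hgood).const_mul (-1))).congr
      fun w hw => ?_
    · rw [hsplit w hw]
      change comb (c.filter Good) w + comb c' w + -1 * comb (c.filter Good) w = comb c' w
      ring
  have hzero : c' = 0 := by
    by_contra hne
    obtain ⟨d, hd, hmax⟩ := exists_not_lt (Finsupp.support_nonempty_iff.2 hne)
    have hd' : ¬ Good d ∧ Path d [] ε := by
      rw [hc', Finsupp.support_filter, Finset.mem_filter, Finsupp.support_filter,
        Finset.mem_filter] at hd
      exact ⟨hd.1.2, hd.2⟩
    have hp : ∀ (x : ι), x ∉ Set.range e → ∀ n, pairLabel e n x = 0 := fun x hx n => by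
      by_contra h
      exact hx (mem_of_pairLabel_ne_zero h)
    have hr : ∀ (x : ι), x ∉ Set.range e → singleLabel e x = 0 := fun x hx => by
      by_contra h
      exact hx (mem_of_singleLabel_ne_zero h)
    obtain ⟨δ, V, ms, k1, k2, k3, k4, v, hv, hv'⟩ := (exists_marked (isLabelling he) h12 h1j h2j
      (fun n => ⟨hp _ h₁ n, hp _ h₂ n, hp _ hj n⟩) ⟨hr _ h₁, hr _ h₂, hr _ hj⟩ hd'.2).resolve_left
      hd'.1
    obtain rfl : ms = [] := List.length_eq_zero_iff.1 k3.length_eq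
    refine Finsupp.mem_support_iff.1 hd (coeff_eq_zero_of_adapted k1 hmax ?_)
    refine evl_eq_zero_of_support fun w hw => ?_
    obtain ⟨x, hx, hvx⟩ := exists_mem_right_of_forall₂ hw hv
    rcases hv' x hvx with rfl | rfl
    · refine (hbad h1j (hf₁ δ)).eq_zero_of_transv (forall₂_comp ?_ k4 hw) hx
      rintro e v y ⟨h3, h4⟩ h5
      refine ⟨?_, ?_⟩
      · rintro rfl
        exact h5 h3
      · rintro rfl
        by_contra h6
        exact h5 (h4 h6).1
    · refine (hbad h2j (hf₂ δ)).eq_zero_of_transv (forall₂_comp ?_ k4 hw) hx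
      rintro e v y ⟨h3, h4⟩ h5
      refine ⟨?_, ?_⟩
      · rintro rfl
        exact h5 h3
      · rintro rfl
        by_contra h6
        exact h5 (h4 h6).2
  refine (inv_comb hv (fun _ h => h.elim) hgood).congr fun w hw => ?_
  rw [hsplit w hw, hzero]
  simp [comb]

end transvection

theorem ordProd_succ {B : Type} [Monoid B] {k : ℕ} (g : Fin (k + 1) → B) :
    ordProd g = g 0 * ordProd fun a => g a.succ := by
  simp [ordProd, List.finRange_succ, Function.comp_def]

theorem act_ofFn {B ι : Type} [Ring B] [Algebra ℂ B] [Fintype ι] (v : Bool → ι → ι → B) {k : ℕ}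
    (ε : Fin k → Bool) (i : Fin k → ι) (f : List ι → ℂ) :
    act v (List.ofFn ε) (List.ofFn i) f =
      ∑ j : Fin k → ι, f (List.ofFn j) • ordProd fun a => v (ε a) (j a) (i a) := by
  induction k generalizing f with
  | zero => simp [act, ordProd]
  | succ k ih =>
    rw [List.ofFn_succ, List.ofFn_succ, act, ← (Fin.consEquiv fun _ => ι).sum_comp,
      Fintype.sum_prod_type]
    refine Finset.sum_congr rfl fun x _ => ?_
    rw [ih, Finset.mul_sum]
    refine Finset.sum_congr rfl fun j _ => ?_
    rw [mul_smul_comm]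
    simp [ordProd_succ, List.ofFn_succ, Fin.consEquiv]

/-- The functional on words attached to a tensor. -/
def onWords {ι : Type} {k : ℕ} (f : (Fin k → ι) → ℂ) (w : List ι) : ℂ :=
  if h : w.length = k then f fun a => w.get (a.cast h.symm) else 0

theorem onWords_ofFn {ι : Type} {k : ℕ} (f : (Fin k → ι) → ℂ) (j : Fin k → ι) :
    onWords f (List.ofFn j) = f j := by
  simp [onWords]

theorem exists_ofFn_eq {ι : Type} {k : ℕ} {w : List ι} (h : w.length = k) :
    ∃ j : Fin k → ι, List.ofFn j = w := by
  subst h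
  exact ⟨w.get, List.ofFn_get w⟩

theorem inv_onWords_iff {B ι : Type} [Ring B] [Algebra ℂ B] [Fintype ι] {v : Bool → ι → ι → B}
    {k : ℕ} {ε : Fin k → Bool} {f : (Fin k → ι) → ℂ} :
    Inv v (List.ofFn ε) (onWords f) ↔ ∀ i : Fin k → ι,
      ∑ j : Fin k → ι, f j • ordProd (fun a => v (ε a) (j a) (i a)) = f i • (1 : B) := by
  constructor
  · intro h i
    simpa [act_ofFn, onWords_ofFn] using h (List.ofFn i) (by simp)
  · intro h w hw
    obtain ⟨i, rfl⟩ := exists_ofFn_eq (hw.trans (List.length_ofFn))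
    simpa [act_ofFn, onWords_ofFn] using h i

theorem onWords_map {N k : ℕ} {f : (Fin k → Fin N) → ℂ} (hf : IsSymmInvariant f)
    (σ : Equiv.Perm (Fin N)) {w : List (Fin N)} (hw : w.length = k) :
    onWords f (w.map σ) = onWords f w := by
  obtain ⟨j, rfl⟩ := exists_ofFn_eq hw
  rw [List.map_ofFn, onWords_ofFn, onWords_ofFn, hf]

/-- A reflection together with its adjoint, in an algebra which need not have an involution. -/
structure IsReflectionPair {M : ℕ} {A : Type} [Ring A] (s : Option ℕ) (a b : Fin M → Fin M → A) :
    Prop where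
  comm : ∀ i j, a i j * b i j = b i j * a i j
  row : ∀ i j, ∑ k, a i k * b j k = if i = j then 1 else 0
  col : ∀ i j, ∑ k, b k i * a k j = if i = j then 1 else 0
  row' : ∀ i j, ∑ k, b i k * a j k = if i = j then 1 else 0
  col' : ∀ i j, ∑ k, a k i * b k j = if i = j then 1 else 0
  idem : ∀ i j, (a i j * b i j) * (a i j * b i j) = a i j * b i j
  pow : ∀ t : ℕ, s = some t → ∀ i j, a i j ^ t = a i j * b i j
  pow' : ∀ t : ℕ, s = some t → ∀ i j, b i j ^ t = a i j * b i j

/-- The product of an algebra and its opposite, with the flip as involution. -/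
def Double (A : Type) : Type := A × Aᵐᵒᵖ

section Double

open MulOpposite

variable {A : Type} [Ring A] [Algebra ℂ A]

instance : Ring (Double A) := inferInstanceAs (Ring (A × Aᵐᵒᵖ))

instance : Algebra ℂ (Double A) :=
  RingHom.toAlgebra' (((algebraMap ℂ A).prod ((algebraMap ℂ Aᵐᵒᵖ).comp (starRingEnd ℂ)) :
    ℂ →+* A × Aᵐᵒᵖ)) fun c x => Prod.ext (Algebra.commutes c x.1) (Algebra.commutes (starRingEnd ℂ c) x.2)

instance : StarRing (Double A) where
  star x := (unop x.2, op x.1)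
  star_involutive _ := rfl
  star_mul _ _ := rfl
  star_add _ _ := rfl

theorem Double.smul_def (c : ℂ) (x : Double A) :
    c • x = ((algebraMap ℂ A c * x.1, op (unop x.2 * algebraMap ℂ A (star c))) : A × Aᵐᵒᵖ) := rfl

instance : StarModule ℂ (Double A) where
  star_smul c x := by
    rw [Double.smul_def, Double.smul_def]
    refine Prod.ext ?_ ?_
    · exact (Algebra.commutes (star c) (unop x.2)).symm
    · change op _ = op _
      rw [star_star]
      exact congrArg op (Algebra.commutes c x.1)

/-- The projection to the first factor. -/
def Double.fst : Double A →ₐ[ℂ] A where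
  toFun x := x.1
  map_one' := rfl
  map_mul' _ _ := rfl
  map_zero' := rfl
  map_add' _ _ := rfl
  commutes' _ := rfl

/-- The projection to the second factor. -/
def Double.snd : Double A →+* Aᵐᵒᵖ := RingHom.snd A Aᵐᵒᵖ

theorem Double.ext {x y : Double A} (h : Double.fst x = Double.fst y)
    (h' : Double.snd x = Double.snd y) : x = y := Prod.ext h h'

/-- The family in the double attached to a pair of families. -/
def Double.mk {M : ℕ} (a b : Fin M → Fin M → A) (i j : Fin M) : Double A := (a i j, op (b i j))

section mk

variable {M : ℕ} (a b : Fin M → Fin M → A) (i j : Fin M)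

theorem Double.fst_mk : Double.fst (Double.mk a b i j) = a i j := rfl

theorem Double.snd_mk : Double.snd (Double.mk a b i j) = op (b i j) := rfl

theorem Double.fst_star_mk : Double.fst (star (Double.mk a b i j)) = b i j := rfl

theorem Double.snd_star_mk : Double.snd (star (Double.mk a b i j)) = op (a i j) := rfl

end mk

theorem IsReflectionPair.isReflection {M : ℕ} {s : Option ℕ} {a b : Fin M → Fin M → A}
    (h : IsReflectionPair s a b) : IsReflection s (Double.mk a b) := by
  refine ⟨fun i j => ?_, fun i j => ?_, fun i j => ?_, fun i j => ?_, fun i j => ?_, fun i j => ?_,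
    fun t ht i j => ?_⟩ <;> apply Double.ext <;>
    simp only [map_mul, map_sum, map_pow, Double.fst_mk, Double.snd_mk, Double.fst_star_mk,
      Double.snd_star_mk, apply_ite Double.fst, apply_ite Double.snd, map_one, map_zero,
      ← op_mul, ← Finset.op_sum, ← op_pow, h.row, h.col, h.row', h.col', h.idem]
  · exact h.comm i j
  · rw [h.comm]
  iterate 4 simp [apply_ite op, eq_comm]
  · exact h.pow t ht i j
  · rw [h.pow' t ht]

end Double

theorem map_ordProd {A B F : Type} [Monoid A] [Monoid B] [FunLike F A B] [MonoidHomClass F A B]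
    (ψ : F) {k : ℕ} (g : Fin k → A) : ψ (ordProd g) = ordProd fun a => ψ (g a) := by
  simp [ordProd, map_list_prod, Function.comp_def]

theorem map_restrFam {A B : Type} [Ring A] [Ring B] (ψ : A →+* B) {M : ℕ} (N : ℕ)
    (u : Fin M → Fin M → A) (i j : Fin N) :
    ψ (restrFam N u i j) = restrFam N (fun x y => ψ (u x y)) i j := by
  simp only [restrFam]
  split_ifs <;> simp

theorem star_restrFam {A : Type} [Ring A] [StarRing A] {M : ℕ} (N : ℕ) (u : Fin M → Fin M → A)
    (i j : Fin N) : star (restrFam N u i j) = restrFam N (fun x y => star (u x y)) i j := by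
  simp only [restrFam]
  split_ifs <;> simp

/-- Invariance passes from the universal reflection to all reflection pairs. -/
theorem inv_restrFam {N M k : ℕ} {s : Option ℕ} {ε : Fin k → Bool} {Q : QuantumReflection M s}
    {f : (Fin k → Fin N) → ℂ} (hf : IsStarInvariant (restrFam N Q.u) ε f) {A : Type} [Ring A]
    [Algebra ℂ A] {v : Bool → Fin M → Fin M → A} (h : IsReflectionPair s (v true) (v false)) :
    Inv (fun e => restrFam N (v e)) (List.ofFn ε) (onWords f) := by
  obtain ⟨φ, hφ, -⟩ := Q.univ (Double A) _ h.isReflection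
  rw [inv_onWords_iff]
  intro i
  have h1 := congrArg (Double.fst.comp φ.toAlgHom) (hf i)
  simp only [map_sum, map_smul, map_one, map_ordProd] at h1
  rw [← h1]
  refine Finset.sum_congr rfl fun j _ => ?_
  congr 2
  funext a
  cases hε : ε a
  · rw [if_neg (by simp), star_restrFam]
    refine Eq.trans ?_ (map_restrFam (Double.fst.comp φ.toAlgHom).toRingHom N _ _ _).symm
    congr 1
    funext x y
    change _ = Double.fst (φ (star (Q.u x y)))
    rw [map_star, hφ]
    rfl
  · rw [if_pos rfl]
    refine Eq.trans ?_ (map_restrFam (Double.fst.comp φ.toAlgHom).toRingHom N _ _ _).symm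
    congr 1
    funext x y
    change _ = Double.fst (φ (Q.u x y))
    rw [hφ]
    rfl

section magic

variable {A : Type} [Ring A] {M N : ℕ}

theorem restrFam_castLE (h : M ≤ N) (p : Fin M → Fin M → A) (x y : Fin M) :
    restrFam N p (x.castLE h) (y.castLE h) = p x y := by
  simp [restrFam]

theorem restrFam_left (p : Fin M → Fin M → A) {x : Fin N} (hx : M ≤ x) (y : Fin N) :
    restrFam N p x y = if x = y then 1 else 0 := by
  simp [restrFam, hx.not_gt, Fin.ext_iff]

theorem restrFam_right (p : Fin M → Fin M → A) (x : Fin N) {y : Fin N} (hy : M ≤ y) :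
    restrFam N p x y = if x = y then 1 else 0 := by
  simp [restrFam, hy.not_gt, Fin.ext_iff]

theorem restrFam_swap (p : Fin M → Fin M → A) (x y : Fin N) :
    restrFam N (fun i j => p j i) x y = restrFam N p y x := by
  simp only [restrFam, and_comm, eq_comm]

theorem exists_castLE_or_le (h : M ≤ N) (x : Fin N) : (∃ y, Fin.castLE h y = x) ∨ M ≤ x := by
  rcases lt_or_ge (x : ℕ) M with hx | hx
  · exact Or.inl ⟨⟨x, hx⟩, rfl⟩
  · exact Or.inr hx

theorem restrFam_restrFam {L : ℕ} (h : L ≤ M) (p : Fin L → Fin L → A) :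
    restrFam N (restrFam M p) = restrFam N p := by
  funext x y
  simp only [restrFam]
  split_ifs with h1 h2 h3 h4 h4 <;> first | rfl | omega

theorem sum_restrFam_castLE (h : M ≤ N) (p : Fin M → Fin M → A) (y : Fin M) (G : Fin N → A) :
    ∑ x, restrFam N p x (y.castLE h) * G x = ∑ x, p x y * G (x.castLE h) := by
  refine (Fintype.sum_of_injective _ (Fin.castLE_injective h) _ _ (fun x hx => ?_)
    fun x => ?_).symm
  · rcases exists_castLE_or_le h x with ⟨y, rfl⟩ | hx'
    · exact (hx ⟨y, rfl⟩).elim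
    · rw [restrFam_left p hx', if_neg, zero_mul]
      rintro rfl
      exact hx ⟨y, rfl⟩
  · rw [restrFam_castLE]

theorem sum_restrFam_of_le (p : Fin M → Fin M → A) {y : Fin N} (hy : M ≤ y) (G : Fin N → A) :
    ∑ x, restrFam N p x y * G x = G y := by
  simp [restrFam_right p _ hy]

theorem sum_restrFam_mul_restrFam (h : M ≤ N) {p : Fin M → Fin M → A}
    (hp : ∀ i j, ∑ k, p k i * p k j = if i = j then 1 else 0) (i j : Fin N) :
    ∑ k, restrFam N p k i * restrFam N p k j = if i = j then 1 else 0 := by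
  rcases exists_castLE_or_le h i with ⟨x, rfl⟩ | hi
  · rw [sum_restrFam_castLE h p x fun k => restrFam N p k j]
    rcases exists_castLE_or_le h j with ⟨y, rfl⟩ | hj
    · simp [restrFam_castLE, hp, (Fin.castLE_injective h).eq_iff]
    · have h1 : ∀ x : Fin M, x.castLE h ≠ j := by
        rintro x rfl
        exact hj.not_gt x.2
      simp [restrFam_right p _ hj, h1]
  · rw [sum_restrFam_of_le p hi fun k => restrFam N p k j, restrFam_left p hi]

theorem IsMagic.restrFam (h : M ≤ N) {p : Fin M → Fin M → A} (hp : IsMagic p) :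
    IsMagic (restrFam N p) where
  idem i j := by
    simp only [_root_.restrFam]
    split_ifs
    · exact hp.idem _ _
    · simp
    · simp
  row i j := by
    simpa only [restrFam_swap] using
      sum_restrFam_mul_restrFam (p := fun i j => p j i) h hp.row i j
  col := sum_restrFam_mul_restrFam h hp.col

theorem extends_restrFam (h : M ≤ N) (p : Fin M → Fin M → A) :
    Extends (Fin.castLE h) (fun _ => restrFam N p) fun _ => p where
  inside _ := sum_restrFam_castLE h p
  outside _ b hb := sum_restrFam_of_le p ((exists_castLE_or_le h b).resolve_left hb)

theorem IsMagic.isReflectionPair {s : Option ℕ} (hs : ∀ t ∈ s, 1 ≤ t) {p : Fin M → Fin M → A}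
    (hp : IsMagic p) : IsReflectionPair s p p := by
  have hpow : ∀ t : ℕ, s = some t → ∀ i j, p i j ^ t = p i j * p i j := fun t ht i j => by
    obtain ⟨n, rfl⟩ := Nat.exists_eq_add_of_le' (hs t ht)
    have h1 : IsIdempotentElem (p i j) := hp.idem i j
    rw [h1.pow_succ_eq, hp.idem]
  exact ⟨fun _ _ => rfl, hp.row, hp.col, hp.row, hp.col,
    fun i j => by rw [hp.idem, hp.idem], hpow, hpow⟩

end magic

theorem restrFam_transv {M N : ℕ} (h : M ≤ N) (δ : Bool) (i j : Fin M) (e : Bool) :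
    restrFam N (transv δ i j e) = transv δ (i.castLE h) (j.castLE h) e := by
  funext x y
  rcases exists_castLE_or_le h x with ⟨x, rfl⟩ | hx
  · rcases exists_castLE_or_le h y with ⟨y, rfl⟩ | hy
    · simp [restrFam_castLE, transv, (Fin.castLE_injective h).eq_iff]
    · have h1 : ∀ z : Fin M, y ≠ z.castLE h := by
        rintro x rfl
        exact hy.not_gt x.2
      simp [restrFam_right _ _ hy, transv, h1]
  · have h1 : ∀ z : Fin M, x ≠ z.castLE h := by
      rintro x rfl
      exact hx.not_gt x.2
    simp [restrFam_left _ hx, transv, h1]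

theorem isReflectionPair_transv {M : ℕ} {s : Option ℕ} (hs : ∀ t ∈ s, 2 ≤ t) (δ : Bool)
    {i j : Fin M} (hij : i ≠ j) :
    IsReflectionPair s (transv δ i j true) (transv δ i j false) := by
  have h1 : ∀ e x, transv δ i j e x x = 1 := fun e x => by
    have h1 : ¬ (x = i ∧ x = j) := fun h => hij (h.1.symm.trans h.2)
    have h2 : ¬ (x = j ∧ x = i) := fun h => hij (h.2.symm.trans h.1)
    simp [transv, h1, h2]
  have h2 : ∀ e e' x y, x ≠ y → transv δ i j e x y * transv δ i j e' x y = 0 := by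
    intro e e' x y hxy
    simp only [transv, if_neg hxy, zero_add]
    split_ifs <;> simp [DualNumber.eps_mul_eps]
  have h3 : ∀ x y, transv δ i j true x y * transv δ i j false x y = if x = y then 1 else 0 := by
    intro x y
    split_ifs with h
    · subst h
      rw [h1, h1, one_mul]
    · exact h2 _ _ _ _ h
  have h4 : ∀ t : ℕ, s = some t → ∀ e x y, transv δ i j e x y ^ t = if x = y then 1 else 0 := by
    intro t ht e x y
    obtain ⟨n, rfl⟩ := Nat.exists_eq_add_of_le' (hs t ht)
    split_ifs with h
    · subst h
      rw [h1, one_pow]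
    · rw [pow_add, pow_two, h2 _ _ _ _ h, mul_zero]
  refine ⟨fun _ _ => mul_comm _ _, transv_row hij (by simp), transv_col hij (by simp),
    transv_row hij (by simp), transv_col hij (by simp), fun x y => ?_, fun t ht x y => ?_,
    fun t ht x y => ?_⟩
  · rw [h3]
    split_ifs <;> simp
  · rw [h3, h4 t ht]
  · rw [h3, h4 t ht]

theorem IsComb.inv {A ι : Type} [Fintype ι] [DecidableEq ι] [Ring A] [Algebra ℂ A]
    {v : Bool → ι → ι → A} {ε : List Bool} {f : List ι → ℂ} (hf : IsComb ε.length f)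
    (hv : ∀ e e' x y, ∑ j, v e j x * v e' j y = if x = y then 1 else 0)
    (hv' : ∀ e x, ∑ j, v e j x = 1) : Inv v ε f := by
  classical
  obtain ⟨c, hc⟩ := hf
  refine (inv_comb (pr := fun _ _ => True) (sg := fun _ => True) (c := c.filter fun d => Path d [] ε)
    (fun e e' _ => hv e e') (fun e _ => hv' e) fun d hd => ?_).congr fun w hw => ?_
  · rw [Finsupp.support_filter, Finset.mem_filter] at hd
    exact hd.2
  · rw [hc w hw, comb_filter _ fun d hd => run_eq_zero_of_not_path hd hw]

end TopGen

/-- Coinvariant formulation of Theorem 3.8: for `N ≥ 6` and `1 ≤ s ≤ ∞` (where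
`s = none` encodes `∞`), the quantum reflection group `H_N^{s+}` is topologically
generated by its quantum subgroups `H_{N-1}^{s+}` and `S_N`. -/
theorem topGen_reflection (N k : ℕ) (hN : 6 ≤ N) (s : Option ℕ)
    (hs : ∀ t ∈ s, 1 ≤ t) (ε : Fin k → Bool)
    (Q : QuantumReflection N s) (Q' : QuantumReflection (N - 1) s)
    (f : (Fin k → Fin N) → ℂ)
    (hSym : IsSymmInvariant f)
    (hSub : IsStarInvariant (restrFam N Q'.u) ε f) :
    IsStarInvariant Q.u ε f := by
  have hM : 4 ≤ N - 1 := by omega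
  have hMN : N - 1 ≤ N := Nat.sub_le _ _
  obtain ⟨-, -, hcol, -, hcol', -, hpow⟩ := Q.refl
  have hcomb : TopGen.IsComb (List.ofFn ε).length (TopGen.onWords f) := by
    have hp := TopGen.twist_isMagic.restrFam (hM.trans hMN)
    refine TopGen.isComb_of_extends (Fin.castLE_injective _)
      (TopGen.extends_restrFam (hM.trans hMN) TopGen.twist) (fun _ _ => hp.col)
      (fun _ => hp.col_sum) ?_ fun σ w hw => TopGen.onWords_map hSym σ (by simpa using hw)
    rw [← TopGen.restrFam_restrFam hM]
    exact TopGen.inv_restrFam (v := fun _ => restrFam (N - 1) TopGen.twist) hSub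
      ((TopGen.twist_isMagic.restrFam hM).isReflectionPair hs)
  have key : TopGen.Inv (fun e x y => if e then Q.u x y else star (Q.u x y)) (List.ofFn ε)
      (TopGen.onWords f) := by
    by_cases hs1 : s = some 1
    · have hu : ∀ i j, Q.u i j = Q.u i j * star (Q.u i j) := fun i j => by
        rw [← hpow 1 hs1 i j, pow_one]
      have hstar : ∀ i j, star (Q.u i j) = Q.u i j := fun i j => by
        conv_lhs => rw [hu i j, star_mul, star_star]
        exact (hu i j).symm
      refine hcomb.inv (fun e e' x y => ?_) fun e x => ?_
      · simpa [hstar] using hcol x y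
      · have h1 := hcol' x x
        simp only [← hu] at h1
        simpa [hstar] using h1
    · have hs2 : ∀ t ∈ s, 2 ≤ t := fun t ht => by
        have h1 := hs t ht
        have h2 : t ≠ 1 := by
          rintro rfl
          exact hs1 ht
        omega
      have htr : ∀ (δ : Bool) (i j : Fin (N - 1)), i ≠ j →
          TopGen.Inv (TopGen.transv δ (i.castLE hMN) (j.castLE hMN)) (List.ofFn ε)
            (TopGen.onWords f) := fun δ i j hij => by
        have h1 := TopGen.inv_restrFam hSub (TopGen.isReflectionPair_transv hs2 δ hij)
        simpa only [TopGen.restrFam_transv hMN] using h1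
      have hx : ∀ x, 2 ≤ x → x ≤ 4 → ∀ h : x < N - 1, Fin.castLE hMN ⟨x, h⟩ ∉
          Set.range (![⟨0, by omega⟩, ⟨1, by omega⟩, ⟨5, by omega⟩] : Fin 3 → Fin N) := by
        rintro x h1 h2 h ⟨y, hy⟩
        fin_cases y <;> simp [Fin.ext_iff] at hy <;> omega
      refine TopGen.inv_of_transv ?_ (i₁ := Fin.castLE hMN ⟨2, by omega⟩)
        (i₂ := Fin.castLE hMN ⟨3, by omega⟩) (j := Fin.castLE hMN ⟨4, by omega⟩) (by simp)
        (by simp) (by simp) (hx 2 (by omega) (by omega) _) (hx 3 (by omega) (by omega) _)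
        (hx 4 (by omega) (by omega) _) hcomb (fun δ => htr δ _ _ (by simp))
        (fun δ => htr δ _ _ (by simp)) fun e e' he x y => ?_
      · intro a b hab
        fin_cases a <;> fin_cases b <;> simp [Fin.ext_iff] at hab ⊢
      · cases e <;> cases e' <;> simp at he ⊢
        · exact hcol x y
        · exact hcol' x y
  exact TopGen.inv_onWords_iff.1 key
end
end

section
/- Suppose given unital ℂ-algebras D, A, B, A', B' with injective unital algebra homomorphisms D → A, D → B, A → A', B → B' and injective unital maps D → A', D → B' making the evident squares commute. If D is finite-dimensional and semisimple, then the canonical algebra homomorphism A ∗_D B → A' ∗_D B' induced by the embeddings A → A' and B → B' is injective. -/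
noncomputable section

/-- The amalgamated free product `A ∗_D B` of unital ℂ-algebras: the pushout of
`A ← D → B` in the category of unital ℂ-algebras (equivalently, the quotient of the
free product `A ∗ B` by the ideal generated by `ι_A(d) - ι_B(d)`, `d ∈ D`),
characterized by its universal property. -/
structure AlgPushout (D A B : Type) [Ring D] [Algebra ℂ D] [Ring A] [Algebra ℂ A]
    [Ring B] [Algebra ℂ B] (f : D →ₐ[ℂ] A) (g : D →ₐ[ℂ] B) where
  carrier : Type
  [ringP : Ring carrier]
  [algP : Algebra ℂ carrier]
  inl : A →ₐ[ℂ] carrier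
  inr : B →ₐ[ℂ] carrier
  comm : inl.comp f = inr.comp g
  univ : ∀ (T : Type) [Ring T] [Algebra ℂ T] (jA : A →ₐ[ℂ] T) (jB : B →ₐ[ℂ] T),
      jA.comp f = jB.comp g →
      ∃! φ : carrier →ₐ[ℂ] T, φ.comp inl = jA ∧ φ.comp inr = jB

attribute [instance] AlgPushout.ringP AlgPushout.algP

open Cardinal

theorem mk_finsupp_le {κ α β : Type} [Zero β] [Infinite κ] (hα : #α ≤ #κ) (hβ : #β ≤ #κ) :
    #(α →₀ β) ≤ #κ := by
  obtain ⟨i⟩ := hα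
  obtain ⟨j⟩ := hβ
  have h : Function.Injective fun u : α →₀ β => u.graph.map (i.prodMap j) :=
    (Finset.map_injective _).comp (Finsupp.graph_injective α β)
  simpa using mk_le_of_injective h

theorem mk_prod_le {κ α β : Type} [Infinite κ] (hα : #α ≤ #κ) (hβ : #β ≤ #κ) :
    #(α × β) ≤ #κ := by
  rw [mk_prod, lift_id, lift_id]
  exact (mul_le_mul' hα hβ).trans (mul_mk_eq_max.trans (max_self _)).le

/-- A retraction `r` of a linear map `s` splits its source as the product of its target and
its kernel. -/
def LinearMap.equivProdKer {R X Y : Type*} [Ring R] [AddCommGroup X] [Module R X]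
    [AddCommGroup Y] [Module R Y] (s : X →ₗ[R] Y) (r : Y →ₗ[R] X) (h : ∀ x, r (s x) = x) :
    Y ≃ₗ[R] X × LinearMap.ker r where
  toFun y := (r y, ⟨y - s (r y), by simp [h]⟩)
  invFun p := s p.1 + p.2
  map_add' y z := by ext <;> simp [add_sub_add_comm]
  map_smul' c y := by ext <;> simp [smul_sub]
  left_inv y := by simp
  right_inv := by
    rintro ⟨x, k, hk⟩
    rw [LinearMap.mem_ker] at hk
    ext <;> simp [h, hk]

/-- Finitely supported functions into a product are pairs of finitely supported functions. -/
def finsuppProdEquiv (R ι X Y : Type*) [Ring R] [AddCommGroup X] [Module R X]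
    [AddCommGroup Y] [Module R Y] : (ι →₀ X × Y) ≃ₗ[R] (ι →₀ X) × (ι →₀ Y) :=
  LinearEquiv.ofLinearMap
    ((Finsupp.mapRange.linearMap (LinearMap.fst R X Y)).prod
      (Finsupp.mapRange.linearMap (LinearMap.snd R X Y)))
    ((Finsupp.mapRange.linearMap (LinearMap.inl R X Y)).coprod
      (Finsupp.mapRange.linearMap (LinearMap.inr R X Y)))
    (by ext <;> simp)
    (by ext <;> simp)

/-- A countable direct sum of copies of `X` absorbs one more copy. -/
def finsuppNatEquiv (R X : Type*) [Ring R] [AddCommGroup X] [Module R X] :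
    (ℕ →₀ X) ≃ₗ[R] X × (ℕ →₀ X) :=
  Finsupp.domLCongr (Equiv.natSumPUnitEquivNat.symm.trans (Equiv.sumComm ℕ Unit)) ≪≫ₗ
    Finsupp.sumFinsuppLEquivProdFinsupp R ≪≫ₗ
    (Finsupp.uniqueLinearEquiv R X ()).prodCongr (LinearEquiv.refl R _)

section Semisimple

variable {D κ : Type} [Ring D] [IsSemisimpleRing D] [Infinite κ]

/-- Eilenberg swindle: a large free module over a semisimple ring absorbs small modules. -/
theorem nonempty_prod_finsupp_equiv (X : Type) [AddCommGroup X] [Module D X] (hX : #X ≤ #κ) :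
    Nonempty ((X × (κ →₀ D)) ≃ₗ[D] (κ →₀ D)) := by
  have := Module.projective_of_isSemisimpleRing D X
  obtain ⟨s, hs⟩ := Module.projective_def'.1 this
  let e := s.equivProdKer (Finsupp.linearCombination D id) fun x => LinearMap.congr_fun hs x
  let K := LinearMap.ker (Finsupp.linearCombination D (id : X → X))
  have hκ : #(κ ⊕ (ℕ × X)) = #κ := by
    rw [mk_sum, lift_id, lift_id]
    exact add_eq_left (aleph0_le_mk κ) (mk_prod_le (by simp) hX)
  obtain ⟨c⟩ := Cardinal.eq.1 hκ
  let free : (κ →₀ D) ≃ₗ[D] (κ →₀ D) × (ℕ →₀ X) × (ℕ →₀ K) :=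
    Finsupp.domLCongr c.symm ≪≫ₗ Finsupp.sumFinsuppLEquivProdFinsupp D ≪≫ₗ
      (LinearEquiv.refl D _).prodCongr
        (Finsupp.curryLinearEquiv D ≪≫ₗ Finsupp.mapRange.linearEquiv e ≪≫ₗ
          finsuppProdEquiv D ℕ X K)
  let shuffle : (X × (κ →₀ D) × (ℕ →₀ X) × (ℕ →₀ K)) ≃ₗ[D]
      (κ →₀ D) × (X × (ℕ →₀ X)) × (ℕ →₀ K) :=
    { toFun := fun p => (p.2.1, (p.1, p.2.2.1), p.2.2.2)
      invFun := fun p => (p.2.1.1, p.1, p.2.1.2, p.2.2)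
      map_add' := fun _ _ => rfl
      map_smul' := fun _ _ => rfl
      left_inv := fun _ => rfl
      right_inv := fun _ => rfl }
  exact ⟨(LinearEquiv.refl D X).prodCongr free ≪≫ₗ shuffle ≪≫ₗ
    (LinearEquiv.refl D _).prodCongr
      ((finsuppNatEquiv D X).symm.prodCongr (LinearEquiv.refl D _)) ≪≫ₗ free.symm⟩

/-- A module of cardinality at most `κ` over a semisimple ring that contains a free module of
rank `κ` is itself free of rank `κ`. -/
theorem nonempty_equiv_finsupp (Y : Type) [AddCommGroup Y] [Module D Y] (hY : #Y ≤ #κ)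
    (j : (κ →₀ D) →ₗ[D] Y) (hj : Function.Injective j) : Nonempty (Y ≃ₗ[D] (κ →₀ D)) := by
  obtain ⟨r, hr⟩ := IsSemisimpleModule.extension_property j hj LinearMap.id
  obtain ⟨e⟩ := nonempty_prod_finsupp_equiv (D := D) (κ := κ) (LinearMap.ker r)
    ((mk_le_of_injective Subtype.val_injective).trans hY)
  exact ⟨j.equivProdKer r (LinearMap.congr_fun hr) ≪≫ₗ
    LinearEquiv.prodComm D (κ →₀ D) (LinearMap.ker r) ≪≫ₗ e⟩

variable {A : Type} [AddCommGroup A] [Module D A]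

theorem nonempty_prod_finsupp_equiv_of_injective (hA : #A ≤ #κ) (j : D →ₗ[D] A)
    (hj : Function.Injective j) (X : Type) [AddCommGroup X] [Module D X] (hX : #X ≤ #κ) :
    Nonempty ((X × (κ →₀ A)) ≃ₗ[D] (κ →₀ D)) :=
  nonempty_equiv_finsupp _ (mk_prod_le hX (mk_finsupp_le le_rfl hA))
    (LinearMap.inr D X _ ∘ₗ Finsupp.mapRange.linearMap j)
    (LinearMap.inr_injective.comp (Finsupp.mapRange_injective j j.map_zero hj))

theorem exists_equiv_of_surjective (hA : #A ≤ #κ) (j : D →ₗ[D] A) (hj : Function.Injective j)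
    {X M : Type} [AddCommGroup X] [Module D X] (hX : #X ≤ #κ) [AddCommGroup M] [Module D M]
    (p : X →ₗ[D] M) (hp : Function.Surjective p) :
    ∃ e : (X × (κ →₀ A)) ≃ₗ[D] M × (κ →₀ D), ∀ y, (e y).1 = p y.1 := by
  have := Module.projective_of_isSemisimpleRing D M
  obtain ⟨s, hs⟩ := Module.projective_lifting_property p LinearMap.id hp
  obtain ⟨e⟩ := nonempty_prod_finsupp_equiv_of_injective hA j hj (LinearMap.ker p)
    ((mk_le_of_injective Subtype.val_injective).trans hX)
  exact ⟨(s.equivProdKer p (LinearMap.congr_fun hs)).prodCongr (LinearEquiv.refl D _) ≪≫ₗ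
    LinearEquiv.prodAssoc D _ _ _ ≪≫ₗ (LinearEquiv.refl D M).prodCongr e, fun _ => rfl⟩

theorem exists_equiv_of_injective (hA : #A ≤ #κ) (j : D →ₗ[D] A) (hj : Function.Injective j)
    {Y Z : Type} [AddCommGroup Y] [Module D Y] [AddCommGroup Z] [Module D Z] (hZ : #Z ≤ #κ)
    (i : Y →ₗ[D] Z) (hi : Function.Injective i) :
    ∃ e : (Y × (κ →₀ D)) ≃ₗ[D] Z × (κ →₀ A), ∀ y, e (y, 0) = (i y, 0) := by
  obtain ⟨r, hr⟩ := IsSemisimpleModule.extension_property i hi LinearMap.id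
  obtain ⟨e⟩ := nonempty_prod_finsupp_equiv_of_injective hA j hj (LinearMap.ker r)
    ((mk_le_of_injective Subtype.val_injective).trans hZ)
  refine ⟨(LinearEquiv.refl D Y).prodCongr e.symm ≪≫ₗ (LinearEquiv.prodAssoc D _ _ _).symm ≪≫ₗ
    (i.equivProdKer r (LinearMap.congr_fun hr)).symm.prodCongr (LinearEquiv.refl D _), fun y => ?_⟩
  simp [LinearMap.equivProdKer, LinearEquiv.prodAssoc, AddEquiv.prodAssoc]

end Semisimple

/-- Any `A`-module `M` is a subquotient of the restriction of an `A'`-module, whose underlying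
`D`-module `M × (κ →₀ D) × (κ →₀ D)` does not depend on `A` and `A'`. -/
theorem exists_algHom_end {D A A' M κ : Type} [Ring D] [Algebra ℂ D] [IsSemisimpleRing D]
    [Ring A] [Algebra ℂ A] [Ring A'] [Algebra ℂ A'] [AddCommGroup M] [Module ℂ M] [Module D M]
    [IsScalarTower ℂ D M] [Infinite κ]
    (f : D →ₐ[ℂ] A) (f' : A →ₐ[ℂ] A') (hf : Function.Injective f) (hf' : Function.Injective f')
    (ρ : A →ₐ[ℂ] Module.End ℂ M) (hρ : ∀ d m, ρ (f d) m = d • m)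
    (hA' : #A' ≤ #κ) (hM : #M ≤ #κ) :
    ∃ ρ' : A' →ₐ[ℂ] Module.End ℂ (M × (κ →₀ D) × (κ →₀ D)),
      (∀ d w, ρ' (f' (f d)) w = d • w) ∧
      ∀ a m x, ∃ y, ρ' (f' a) (m, x, 0) = (ρ a m, y, 0) := by
  let _ : Module A M := Module.compHom M ρ.toRingHom
  let _ : Module D A := Module.compHom A f.toRingHom
  let _ : Module D A' := Module.compHom A' (f'.comp f).toRingHom
  have smulM (a : A) (m : M) : a • m = ρ a m := rfl
  have smulA (d : D) (a : A) : d • a = f d * a := rfl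
  have smulA' (d : D) (a : A') : d • a = f' (f d) * a := rfl
  have : IsScalarTower D A M := ⟨fun d a m => by simp [smulM, smulA, hρ]⟩
  have : IsScalarTower ℂ D A' := ⟨fun c d a => by simp [smulA']⟩
  have hA : #A ≤ #κ := (mk_le_of_injective hf').trans hA'
  let j : D →ₗ[D] A :=
    { toFun := f, map_add' := map_add f, map_smul' := fun d x => by simp [smulA] }
  let k : A →ₗ[D] A' :=
    { toFun := f', map_add' := map_add f', map_smul' := fun d x => by simp [smulA, smulA'] }
  let π : (M →₀ A) →ₗ[A] M := Finsupp.linearCombination A id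
  obtain ⟨e, he⟩ := exists_equiv_of_surjective hA j hf (mk_finsupp_le hM hA)
    (π.restrictScalars D) (Finsupp.linearCombination_id_surjective A M)
  let i : ((M →₀ A) × (κ →₀ A)) →ₗ[D] (M →₀ A') × (κ →₀ A') :=
    (Finsupp.mapRange.linearMap k).prodMap (Finsupp.mapRange.linearMap k)
  have hi : Function.Injective i :=
    (Finsupp.mapRange_injective _ (map_zero k) hf').prodMap
      (Finsupp.mapRange_injective _ (map_zero k) hf')
  have hia (a : A) (y) : i (a • y) = f' a • i y := by
    ext <;> simp [i, k]
  obtain ⟨e', he'⟩ := exists_equiv_of_injective hA' (k ∘ₗ j) (hf'.comp hf)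
    (mk_prod_le (mk_finsupp_le hM hA') (mk_finsupp_le le_rfl hA')) i hi
  let E : (M × (κ →₀ D) × (κ →₀ D)) ≃ₗ[D] ((M →₀ A') × (κ →₀ A')) × (κ →₀ A') :=
    (LinearEquiv.prodAssoc D _ _ _).symm ≪≫ₗ e.symm.prodCongr (LinearEquiv.refl D _) ≪≫ₗ e'
  have hE (m x) : E (m, x, 0) = (i (e.symm (m, x)), 0) := he' _
  let Eℂ := E.restrictScalars ℂ
  refine ⟨(Eℂ.symm.conjAlgEquiv ℂ).toAlgHom.comp (Algebra.lsmul ℂ ℂ _), fun d w => ?_,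
    fun a m x => ⟨(e (a • e.symm (m, x))).2, ?_⟩⟩
  · change E.symm (f' (f d) • E w) = d • w
    rw [LinearEquiv.symm_apply_eq, map_smul]
    ext <;> simp [smulA']
  · change E.symm (f' a • E (m, x, 0)) = _
    have h : (e (a • e.symm (m, x))).1 = ρ a m := by
      have hm : π (e.symm (m, x)).1 = m := by
        simpa using (he (e.symm (m, x))).symm
      rw [he]
      simp [hm, smulM]
    rw [LinearEquiv.symm_apply_eq, ← h, hE, hE, Prod.mk.eta, LinearEquiv.symm_apply_apply, hia,
      Prod.smul_mk, smul_zero]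

namespace AlgPushout

variable {D A B : Type} [Ring D] [Algebra ℂ D] [Ring A] [Algebra ℂ A] [Ring B] [Algebra ℂ B]
  {f : D →ₐ[ℂ] A} {g : D →ₐ[ℂ] B}

theorem subalgebra_eq_top (P : AlgPushout D A B f g) (S : Subalgebra ℂ P.carrier)
    (hl : ∀ a, P.inl a ∈ S) (hr : ∀ b, P.inr b ∈ S) : S = ⊤ := by
  obtain ⟨ψ, ⟨hψl, hψr⟩, -⟩ := P.univ S (P.inl.codRestrict S hl) (P.inr.codRestrict S hr) <| by
    ext d
    exact AlgHom.congr_fun P.comm d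
  have h : S.val.comp ψ = AlgHom.id ℂ _ := by
    refine (P.univ _ P.inl P.inr P.comm).unique ⟨?_, ?_⟩ ⟨?_, ?_⟩
    · rw [AlgHom.comp_assoc, hψl, AlgHom.val_comp_codRestrict]
    · rw [AlgHom.comp_assoc, hψr, AlgHom.val_comp_codRestrict]
    · rfl
    · rfl
  refine Algebra.eq_top_iff.2 fun x => ?_
  rw [← AlgHom.id_apply (R := ℂ) x, ← h]
  exact (ψ x).2

end AlgPushout

/-- Lemma 2.13 of the paper: given embeddings `D → A → A'`, `D → B → B'` with `D`
finite-dimensional and semisimple, the canonical map `A ∗_D B → A' ∗_D B'` is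
injective. -/
theorem algPushout_map_injective (D A B A' B' : Type)
    [Ring D] [Algebra ℂ D] [Ring A] [Algebra ℂ A] [Ring B] [Algebra ℂ B]
    [Ring A'] [Algebra ℂ A'] [Ring B'] [Algebra ℂ B']
    (f : D →ₐ[ℂ] A) (g : D →ₐ[ℂ] B) (f' : A →ₐ[ℂ] A') (g' : B →ₐ[ℂ] B')
    (hf : Function.Injective f) (hg : Function.Injective g)
    (hf' : Function.Injective f') (hg' : Function.Injective g')
    [FiniteDimensional ℂ D] [IsSemisimpleRing D]
    (P : AlgPushout D A B f g) (P' : AlgPushout D A' B' (f'.comp f) (g'.comp g))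
    (φ : P.carrier →ₐ[ℂ] P'.carrier)
    (hφl : φ.comp P.inl = P'.inl.comp f') (hφr : φ.comp P.inr = P'.inr.comp g') :
    Function.Injective φ := by
  let κ := ℕ × (A' ⊕ B' ⊕ P.carrier ⊕ PUnit)
  have hκ : #(A' ⊕ B' ⊕ P.carrier ⊕ PUnit) ≤ #κ :=
    mk_le_of_injective (Prod.mk_right_injective 0)
  have hA' : #A' ≤ #κ := (mk_le_of_injective Sum.inl_injective).trans hκ
  have hB' : #B' ≤ #κ :=
    (mk_le_of_injective (Sum.inr_injective.comp Sum.inl_injective)).trans hκ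
  have hP : #P.carrier ≤ #κ :=
    (mk_le_of_injective
      (Sum.inr_injective.comp (Sum.inr_injective.comp Sum.inl_injective))).trans hκ
  let _ : Module D P.carrier := Module.compHom P.carrier (P.inl.comp f).toRingHom
  have smulP (d : D) (p : P.carrier) : d • p = P.inl (f d) * p := rfl
  have : IsScalarTower ℂ D P.carrier := ⟨fun c d p => by simp [smulP]⟩
  obtain ⟨ρ, hρ, hρP⟩ := exists_algHom_end (κ := κ) f f' hf hf'
    ((Algebra.lmul ℂ P.carrier).comp P.inl) (fun _ _ => rfl) hA' hP
  obtain ⟨σ, hσ, hσP⟩ := exists_algHom_end (κ := κ) g g' hg hg'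
    ((Algebra.lmul ℂ P.carrier).comp P.inr)
    (fun d p => congrArg (· * p) (AlgHom.congr_fun P.comm d).symm) hB' hP
  obtain ⟨Ψ, ⟨hΨl, hΨr⟩, -⟩ := P'.univ (Module.End ℂ (P.carrier × (κ →₀ D) × (κ →₀ D))) ρ σ <| by
    ext1 d
    exact LinearMap.ext fun w => (hρ d w).trans (hσ d w).symm
  let S : Subalgebra ℂ P.carrier :=
    { carrier := {p | ∀ m x, ∃ y, Ψ (φ p) (m, x, 0) = (p * m, y, 0)}
      mul_mem' := fun {p q} hp hq m x => by
        obtain ⟨y, hy⟩ := hq m x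
        obtain ⟨z, hz⟩ := hp (q * m) y
        exact ⟨z, by rw [map_mul, map_mul, Module.End.mul_apply, hy, hz, mul_assoc]⟩
      add_mem' := fun {p q} hp hq m x => by
        obtain ⟨y, hy⟩ := hp m x
        obtain ⟨z, hz⟩ := hq m x
        exact ⟨y + z, by simp [hy, hz, add_mul]⟩
      algebraMap_mem' := fun c m x => ⟨c • x, by
        simp [Module.algebraMap_end_apply, Algebra.smul_def]⟩ }
  have hS : S = ⊤ := by
    refine P.subalgebra_eq_top S (fun a m x => ?_) fun b m x => ?_
    · have h : Ψ (φ (P.inl a)) = ρ (f' a) := by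
        rw [← hΨl]
        exact congrArg Ψ (AlgHom.congr_fun hφl a)
      rw [h]
      exact hρP a m x
    · have h : Ψ (φ (P.inr b)) = σ (g' b) := by
        rw [← hΨr]
        exact congrArg Ψ (AlgHom.congr_fun hφr b)
      rw [h]
      exact hσP b m x
  refine (injective_iff_map_eq_zero φ).2 fun p hp => ?_
  obtain ⟨y, hy⟩ : ∃ y, Ψ (φ p) (1, 0, 0) = (p * 1, y, 0) := Algebra.eq_top_iff.1 hS p 1 0
  rw [hp, map_zero, LinearMap.zero_apply, mul_one] at hy
  exact (congrArg Prod.fst hy).symm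
end
end

section
/- Suppose given unital complex *-algebras D, A, B, A', B' with injective unital *-algebra homomorphisms D → A, D → B, A → A', B → B' and injective unital *-maps D → A', D → B' making the evident squares commute, where D is finite-dimensional and semisimple. If the amalgamated free product A' ∗_D B' is residually finite-dimensional, then so is A ∗_D B. -/
noncomputable section

/-- A complex *-algebra is residually finite-dimensional (RFD) if it admits an
injective unital *-algebra homomorphism into a product of matrix algebras. -/
def IsRFD (A : Type) [Ring A] [Algebra ℂ A] [StarRing A] : Prop :=
  ∃ (I : Type) (n : I → ℕ)
    (φ : A →⋆ₐ[ℂ] ∀ i, Matrix (Fin (n i)) (Fin (n i)) ℂ),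
    Function.Injective φ

/-- The amalgamated free product `A ∗_D B` of unital complex *-algebras: the pushout
of `A ← D → B` in the category of unital complex *-algebras (equivalently, the
quotient of the free product `A ∗ B` by the ideal generated by `ι_A(d) - ι_B(d)`,
`d ∈ D`, with the induced star), characterized by its universal property. -/
structure StarAlgPushout (D A B : Type)
    [Ring D] [Algebra ℂ D] [StarRing D] [StarModule ℂ D]
    [Ring A] [Algebra ℂ A] [StarRing A] [StarModule ℂ A]
    [Ring B] [Algebra ℂ B] [StarRing B] [StarModule ℂ B]
    (f : D →⋆ₐ[ℂ] A) (g : D →⋆ₐ[ℂ] B) where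
  carrier : Type
  [ringP : Ring carrier]
  [algP : Algebra ℂ carrier]
  [starP : StarRing carrier]
  [smodP : StarModule ℂ carrier]
  inl : A →⋆ₐ[ℂ] carrier
  inr : B →⋆ₐ[ℂ] carrier
  comm : inl.comp f = inr.comp g
  univ : ∀ (T : Type) [Ring T] [Algebra ℂ T] [StarRing T] [StarModule ℂ T]
      (jA : A →⋆ₐ[ℂ] T) (jB : B →⋆ₐ[ℂ] T),
      jA.comp f = jB.comp g →
      ∃! φ : carrier →⋆ₐ[ℂ] T, φ.comp inl = jA ∧ φ.comp inr = jB

attribute [instance] StarAlgPushout.ringP StarAlgPushout.algP StarAlgPushout.starP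
  StarAlgPushout.smodP

namespace IsSemisimpleRing

variable {R S Q Q' : Type} [Ring R] [IsSemisimpleRing R] [AddCommGroup Q] [Module R Q]
  [AddCommGroup Q'] [Module R Q']

/-- Over a semisimple ring every quotient of a module is a direct summand. -/
theorem nonempty_linearEquiv_prod_ker (q : Q →ₗ[R] Q') (hq : Function.Surjective q) :
    Nonempty (Q ≃ₗ[R] Q' × LinearMap.ker q) := by
  obtain ⟨r, hr⟩ := IsSemisimpleModule.extension_property (LinearMap.ker q).subtype
    (Submodule.subtype_injective _) LinearMap.id
  have hr' (x) : r (Submodule.subtype _ x) = x := LinearMap.congr_fun hr x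
  refine ⟨LinearEquiv.ofBijective (q.prod r) ⟨?_, ?_⟩⟩
  · rw [injective_iff_map_eq_zero]
    intro x hx
    obtain ⟨h1, h2⟩ := Prod.ext_iff.1 hx
    simpa using congr_arg Subtype.val ((hr' ⟨x, h1⟩).symm.trans h2)
  · rintro ⟨y, k⟩
    obtain ⟨x, rfl⟩ := hq y
    have hk (k : LinearMap.ker q) : q (k : Q) = 0 := k.2
    have hr'' (k : LinearMap.ker q) : r (k : Q) = k := hr' k
    exact ⟨x + (k - r x : LinearMap.ker q), by simp [hk, hr'', -AddSubgroupClass.coe_sub]⟩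

/-- Eilenberg swindle: a quotient of a free module of infinite rank is absorbed by it. -/
theorem nonempty_prod_finsupp_linearEquiv [Infinite S] (q : (S →₀ R) →ₗ[R] Q)
    (hq : Function.Surjective q) : Nonempty ((Q × (S →₀ R)) ≃ₗ[R] (S →₀ R)) := by
  obtain ⟨e⟩ := nonempty_linearEquiv_prod_ker q hq
  have ⟨eS⟩ : Nonempty (ℕ × S ≃ S) := by
    rw [← Cardinal.eq]
    simp
  let eN : (Unit ⊕ ℕ) ≃ ℕ := Classical.choice (by rw [← Cardinal.eq]; simp)
  let K := LinearMap.ker q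
  let split : (ℕ →₀ (Q × K)) ≃ₗ[R] (ℕ →₀ Q) × (ℕ →₀ K) := LinearEquiv.ofLinearMap
    ((Finsupp.mapRange.linearMap (LinearMap.fst R Q K)).prod
      (Finsupp.mapRange.linearMap (LinearMap.snd R Q K)))
    ((Finsupp.mapRange.linearMap (LinearMap.inl R Q K)).coprod
      (Finsupp.mapRange.linearMap (LinearMap.inr R Q K)))
    (by ext <;> simp) (by ext <;> simp)
  let absorb : (Q × (ℕ →₀ Q)) ≃ₗ[R] (ℕ →₀ Q) :=
    ((Finsupp.uniqueLinearEquiv R Q ()).symm.prodCongr (.refl R _)) ≪≫ₗ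
      (Finsupp.sumFinsuppLEquivProdFinsupp R).symm ≪≫ₗ Finsupp.domLCongr eN
  let t : (S →₀ R) ≃ₗ[R] (ℕ →₀ Q) × (ℕ →₀ K) :=
    Finsupp.domLCongr eS.symm ≪≫ₗ Finsupp.curryLinearEquiv R ≪≫ₗ
      Finsupp.mapRange.linearEquiv e ≪≫ₗ split
  exact ⟨(LinearEquiv.refl R Q).prodCongr t ≪≫ₗ (LinearEquiv.prodAssoc R _ _ _).symm ≪≫ₗ
    absorb.prodCongr (.refl R _) ≪≫ₗ t.symm⟩

/-- A small enough module containing a free module of infinite rank is isomorphic to it. -/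
theorem nonempty_linearEquiv_finsupp [Infinite S] (hQ : Cardinal.mk Q ≤ Cardinal.mk S)
    (j : (S →₀ R) →ₗ[R] Q) (hj : Function.Injective j) : Nonempty (Q ≃ₗ[R] (S →₀ R)) := by
  obtain ⟨r, hr⟩ := IsSemisimpleModule.extension_property j hj LinearMap.id
  obtain ⟨e⟩ := nonempty_linearEquiv_prod_ker r fun x => ⟨j x, LinearMap.congr_fun hr x⟩
  have ⟨i⟩ : Nonempty (LinearMap.ker r ↪ S) := (Cardinal.mk_subtype_le _).trans hQ
  obtain ⟨e'⟩ := nonempty_prod_finsupp_linearEquiv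
    (Finsupp.linearCombination R (Function.invFun i))
    (Finsupp.linearCombination_surjective R (Function.invFun_surjective i.injective))
  exact ⟨e ≪≫ₗ LinearEquiv.prodComm R _ _ ≪≫ₗ e'⟩

/-- A pair `L ⊆ N` of modules with a map `L → P` is determined up to isomorphism by `P`, provided
that both the kernel of `L → P` and the quotient `N / L` contain a large free module. -/
theorem exists_linearEquiv_prod_finsupp [Infinite S] {N L P : Type}
    [AddCommGroup N] [Module R N] [AddCommGroup L] [Module R L] [AddCommGroup P] [Module R P]
    (hN : Cardinal.mk N ≤ Cardinal.mk S)
    (i : L →ₗ[R] N) (hi : Function.Injective i) (π : L →ₗ[R] P) (hπ : Function.Surjective π)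
    (j : (S →₀ R) →ₗ[R] L) (hj : Function.Injective j) (hπj : π ∘ₗ j = 0)
    (j' : (S →₀ R) →ₗ[R] N) (c : N →ₗ[R] (S →₀ R)) (hci : c ∘ₗ i = 0)
    (hcj' : c ∘ₗ j' = LinearMap.id) :
    ∃ e : N ≃ₗ[R] P × (S →₀ R) × (S →₀ R),
      (∀ l, ∃ k, e (i l) = (π l, k, 0)) ∧ ∀ p k, ∃ l, i l = e.symm (p, k, 0) := by
  have ⟨e₁⟩ : Nonempty (LinearMap.ker π ≃ₗ[R] (S →₀ R)) := by
    refine nonempty_linearEquiv_finsupp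
      ((Cardinal.mk_le_of_injective (hi.comp Subtype.val_injective)).trans hN)
      (j.codRestrict _ fun x => LinearMap.congr_fun hπj x) ?_
    exact fun x y h => hj (congr_arg Subtype.val h)
  have ⟨e₂⟩ : Nonempty ((N ⧸ LinearMap.range i) ≃ₗ[R] (S →₀ R)) := by
    refine nonempty_linearEquiv_finsupp
      ((Cardinal.mk_le_of_surjective (Submodule.mkQ_surjective _)).trans hN)
      ((LinearMap.range i).mkQ ∘ₗ j') ?_
    have hc : LinearMap.range i ≤ LinearMap.ker c := by
      rintro _ ⟨l, rfl⟩
      exact LinearMap.congr_fun hci l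
    refine Function.LeftInverse.injective (g := (LinearMap.range i).liftQ c hc) fun x => ?_
    exact LinearMap.congr_fun hcj' x
  obtain ⟨ρ, hρ⟩ := IsSemisimpleModule.extension_property i hi LinearMap.id
  obtain ⟨σ, hσ⟩ := IsSemisimpleModule.extension_property (LinearMap.ker π).subtype
    (Submodule.subtype_injective _) LinearMap.id
  replace hρ (l) : ρ (i l) = l := LinearMap.congr_fun hρ l
  replace hσ (l : LinearMap.ker π) : σ l = l := LinearMap.congr_fun hσ l
  have hker (l : LinearMap.ker π) : π (l : L) = 0 := l.2
  let m := (LinearMap.range i).mkQ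
  have hm (l) : m (i l) = 0 := by simp [m]
  let T : N →ₗ[R] P × (S →₀ R) × (S →₀ R) :=
    (π ∘ₗ ρ).prod ((e₁.toLinearMap ∘ₗ σ ∘ₗ ρ).prod (e₂.toLinearMap ∘ₗ m))
  have hT (n) : T n = (π (ρ n), e₁ (σ (ρ n)), e₂ (m n)) := rfl
  have hrange (n) (h : (T n).2.2 = 0) : ∃ l, i l = n := by
    have : m n = 0 := by simpa [hT] using h
    simpa [m] using this
  have hbij : Function.Bijective T := by
    constructor
    · rw [injective_iff_map_eq_zero]
      intro n hn
      obtain ⟨l, rfl⟩ := hrange n (by simp [hn])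
      simp only [hT, hρ, Prod.mk_eq_zero, EmbeddingLike.map_eq_zero_iff] at hn
      have hl : 0 = l := congr_arg Subtype.val (hn.2.1.symm.trans (hσ ⟨l, hn.1⟩))
      simp [← hl]
    · rintro ⟨p, k, c⟩
      obtain ⟨n, hn⟩ := Submodule.mkQ_surjective (LinearMap.range i) (e₂.symm c)
      obtain ⟨l, rfl⟩ := hπ p
      let u : LinearMap.ker π := e₁.symm k - σ l
      refine ⟨n - i (ρ n) + i (l + u), ?_⟩
      have hn' : m n = e₂.symm c := hn
      simp only [hT, map_add, map_sub, hρ, hker, hσ, hm, hn', sub_self, sub_zero, add_zero,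
        zero_add, LinearEquiv.apply_symm_apply, u]
      simp
  refine ⟨LinearEquiv.ofBijective T hbij, fun l => ⟨e₁ (σ l), ?_⟩, fun p k => hrange _ ?_⟩
  · simp [hT, hρ, hm]
  · have := (LinearEquiv.ofBijective T hbij).apply_symm_apply (p, k, 0)
    rw [LinearEquiv.ofBijective_apply] at this
    rw [this]

/-- Let `D → A → A'` be injective ring maps with `D` semisimple. Every `A`-module `P` is a quotient
of an `A`-submodule of an `A'`-module, where the underlying `D`-modules do not depend on `A`. -/
theorem exists_algHom_end_prod_finsupp {D A A' P S : Type}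
    [Ring D] [Algebra ℂ D] [IsSemisimpleRing D] [Ring A] [Module D A] [IsScalarTower D A A]
    [Ring A'] [Algebra ℂ A'] [Nontrivial A'] [Module D A'] [IsScalarTower D A' A']
    [IsScalarTower ℂ D A'] [Module A A'] [IsScalarTower A A' A'] [IsScalarTower D A A']
    [AddCommGroup P] [Module ℂ P] [Module D P] [Module A P] [IsScalarTower D A P]
    [IsScalarTower ℂ D P] [Infinite S]
    (hA' : Cardinal.mk A' ≤ Cardinal.mk S) (hP : Cardinal.mk P ≤ Cardinal.mk S)
    (hf : Function.Injective (LinearMap.toSpanSingleton D A 1))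
    (hf' : Function.Injective (LinearMap.toSpanSingleton A A' 1)) :
    ∃ ρ : A' →ₐ[ℂ] Module.End ℂ (P × (S →₀ D) × (S →₀ D)),
      (∀ (d : D) x, ρ (d • 1) x = d • x) ∧
      ∀ (a : A) p k, ∃ k', ρ (a • 1) (p, k, 0) = (a • p, k', 0) := by
  have ⟨ι⟩ : Nonempty (P ↪ S) := hP
  let L := (S →₀ A) × (S →₀ A)
  let N := (S →₀ A') × (S →₀ A') × (S →₀ A')
  have hN : Cardinal.mk N ≤ Cardinal.mk S := by
    have h : Cardinal.mk (S →₀ A') ≤ Cardinal.mk S := by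
      rw [Cardinal.mk_finsupp_of_infinite]
      exact max_le le_rfl hA'
    have hS := Cardinal.aleph0_le_mk S
    simp only [N, Cardinal.mk_prod, Cardinal.lift_id]
    exact Cardinal.mul_le_of_le hS h (Cardinal.mul_le_of_le hS h h)
  let φ := Finsupp.mapRange.linearMap (α := S) (LinearMap.toSpanSingleton A A' 1)
  have hφ : Function.Injective φ := Finsupp.mapRange_injective _ (map_zero _) hf'
  let i : L →ₗ[A] N := φ.prodMap (LinearMap.inl A _ _ ∘ₗ φ)
  have hi : Function.Injective i := hφ.prodMap (LinearMap.inl_injective.comp hφ)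
  let π : L →ₗ[A] P := Finsupp.linearCombination A (Function.invFun ι) ∘ₗ LinearMap.fst A _ _
  have hπ : Function.Surjective π :=
    (Finsupp.linearCombination_surjective A (Function.invFun_surjective ι.injective)).comp
      LinearMap.fst_surjective
  let j : (S →₀ D) →ₗ[D] L := LinearMap.inr D _ _ ∘ₗ
    Finsupp.mapRange.linearMap (LinearMap.toSpanSingleton D A 1)
  have hj : Function.Injective j :=
    LinearMap.inr_injective.comp (Finsupp.mapRange_injective _ (map_zero _) hf)
  have hff' : Function.Injective (LinearMap.toSpanSingleton D A' 1) := by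
    convert hf'.comp hf using 1
    ext d
    simp
  obtain ⟨r, hr⟩ := IsSemisimpleModule.extension_property _ hff' LinearMap.id
  let j' : (S →₀ D) →ₗ[D] N := LinearMap.inr D _ _ ∘ₗ LinearMap.inr D _ _ ∘ₗ
    Finsupp.mapRange.linearMap (LinearMap.toSpanSingleton D A' 1)
  let c : N →ₗ[D] (S →₀ D) := Finsupp.mapRange.linearMap r ∘ₗ LinearMap.snd D _ _ ∘ₗ
    LinearMap.snd D _ _
  have hcj' : c ∘ₗ j' = LinearMap.id := by
    refine LinearMap.ext fun x => Finsupp.ext fun s => ?_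
    exact LinearMap.congr_fun hr (x s)
  have hci : c ∘ₗ i.restrictScalars D = 0 := by
    refine LinearMap.ext fun x => Finsupp.ext fun s => ?_
    exact map_zero r
  have hπj : π.restrictScalars D ∘ₗ j = 0 := by
    refine LinearMap.ext fun x => ?_
    exact map_zero (Finsupp.linearCombination A (Function.invFun ι))
  obtain ⟨e, he, he'⟩ := exists_linearEquiv_prod_finsupp hN (i.restrictScalars D) hi
    (π.restrictScalars D) hπ j hj hπj j' c hci hcj'
  let ρ : A' →ₐ[ℂ] Module.End ℂ (P × (S →₀ D) × (S →₀ D)) :=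
    ((e.restrictScalars ℂ).conjAlgEquiv ℂ).toAlgHom.comp (Algebra.lsmul ℂ ℂ N)
  have hρ (a x) : ρ a x = e (a • e.symm x) := rfl
  refine ⟨ρ, fun d x => ?_, fun a p k => ?_⟩
  · rw [hρ, smul_assoc, one_smul, map_smul, e.apply_symm_apply]
  · obtain ⟨l, hl⟩ := he' p k
    obtain ⟨k₁, hk₁⟩ := he l
    obtain ⟨k₂, hk₂⟩ := he (a • l)
    rw [hl, e.apply_symm_apply] at hk₁
    have hp : p = π l := congr_arg Prod.fst hk₁
    refine ⟨k₂, ?_⟩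
    rw [hρ, ← hl, smul_assoc, one_smul, hp, ← map_smul π]
    exact (congr_arg e (map_smul i a l).symm).trans hk₂

/-- Version of `exists_algHom_end_prod_finsupp` for homomorphisms of algebras. -/
theorem exists_algHom_end_of_injective {D A A' P S : Type}
    [Ring D] [Algebra ℂ D] [IsSemisimpleRing D] [Ring A] [Algebra ℂ A] [Ring A'] [Algebra ℂ A']
    [Nontrivial A'] [Ring P] [Algebra ℂ P] [Module D P] [IsScalarTower ℂ D P] [Infinite S]
    (hA' : Cardinal.mk A' ≤ Cardinal.mk S) (hP : Cardinal.mk P ≤ Cardinal.mk S)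
    (f : D →ₐ[ℂ] A) (hf : Function.Injective f) (f' : A →ₐ[ℂ] A') (hf' : Function.Injective f')
    (α : A →ₐ[ℂ] P) (hα : ∀ d p, d • p = α (f d) * p) :
    ∃ ρ : A' →ₐ[ℂ] Module.End ℂ (P × (S →₀ D) × (S →₀ D)),
      (∀ d x, ρ (f' (f d)) x = d • x) ∧
      ∀ a p k, ∃ k', ρ (f' a) (p, k, 0) = (α a * p, k', 0) := by
  let : Module D A := Module.compHom A (f : D →+* A)
  let : Module A A' := Module.compHom A' (f' : A →+* A')
  let : Module D A' := Module.compHom A' (f'.comp f : D →+* A')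
  let : Module A P := Module.compHom P (α : A →+* P)
  have hDA (d : D) (a : A) : d • a = f d * a := rfl
  have hAA' (a : A) (a' : A') : a • a' = f' a * a' := rfl
  have hDA' (d : D) (a' : A') : d • a' = f' (f d) * a' := rfl
  have hAP (a : A) (p : P) : a • p = α a * p := rfl
  have : IsScalarTower D A A := ⟨fun d a b => by simp [hDA, mul_assoc]⟩
  have : IsScalarTower D A' A' := ⟨fun d a b => by simp [hDA', mul_assoc]⟩
  have : IsScalarTower A A' A' := ⟨fun d a b => by simp [hAA', mul_assoc]⟩
  have : IsScalarTower D A A' := ⟨fun d a b => by simp [hDA, hAA', hDA', mul_assoc]⟩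
  have : IsScalarTower D A P := ⟨fun d a b => by simp [hDA, hAP, hα, mul_assoc]⟩
  have : IsScalarTower ℂ D A' := ⟨fun z d a => by simp [hDA']⟩
  obtain ⟨ρ, hρD, hρA⟩ := exists_algHom_end_prod_finsupp (D := D) (A := A) (P := P) hA' hP
    (by simpa [Function.Injective, hDA] using hf) (by simpa [Function.Injective, hAA'] using hf')
  refine ⟨ρ, fun d x => ?_, fun a p k => ?_⟩
  · simpa [hDA'] using hρD d x
  · simpa [hAA', hAP] using hρA a p k

end IsSemisimpleRing

/-- The double `E × Eᵒᵖ` of a complex algebra `E`, with `ℂ` acting conjugate-linearly on the second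
factor; it is a *-algebra for the involution swapping the factors. -/
def StarDouble (E : Type) : Type := E × Eᵐᵒᵖ

namespace StarDouble

variable {E : Type} [Ring E] [Algebra ℂ E]

instance : Ring (StarDouble E) := inferInstanceAs (Ring (E × Eᵐᵒᵖ))

instance : Algebra ℂ (StarDouble E) :=
  RingHom.toAlgebra' (S := StarDouble E)
    ((algebraMap ℂ E).prod ((algebraMap ℂ Eᵐᵒᵖ).comp (starRingEnd ℂ)))
    fun z x => Prod.ext (Algebra.commutes z x.1) (Algebra.commutes (starRingEnd ℂ z) x.2)

instance : StarRing (StarDouble E) where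
  star x := (x.2.unop, MulOpposite.op x.1)
  star_involutive _ := rfl
  star_mul _ _ := rfl
  star_add _ _ := rfl

theorem algebraMap_eq (z : ℂ) : algebraMap ℂ (StarDouble E) z =
    (algebraMap ℂ E z, algebraMap ℂ Eᵐᵒᵖ (starRingEnd ℂ z)) := rfl

instance : StarModule ℂ (StarDouble E) where
  star_smul z x := by
    rw [Algebra.smul_def, Algebra.smul_def, star_mul, Algebra.commutes]
    congr 1
    refine Prod.ext rfl (congr_arg MulOpposite.op ?_)
    change algebraMap ℂ E z = algebraMap ℂ E (star (star z))
    rw [star_star]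

/-- The first projection of the double. -/
def fst : StarDouble E →ₐ[ℂ] E where
  __ := RingHom.fst E Eᵐᵒᵖ
  commutes' _ := rfl

/-- A homomorphism of algebras into `E` induces a *-homomorphism into the double of `E`. -/
def lift {A : Type} [Ring A] [Algebra ℂ A] [StarRing A] [StarModule ℂ A] (φ : A →ₐ[ℂ] E) :
    A →⋆ₐ[ℂ] StarDouble E where
  toFun a := (φ a, MulOpposite.op (φ (star a)))
  map_one' := by simp; rfl
  map_zero' := by simp; rfl
  map_mul' a b := by simp; rfl
  map_add' a b := by simp; rfl
  commutes' z := by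
    rw [algebraMap_eq, ← algebraMap_star_comm]
    simp
    rfl
  map_star' a := by
    rw [star_star]
    rfl

end StarDouble

namespace StarAlgPushout

variable {D A B : Type}
  [Ring D] [Algebra ℂ D] [StarRing D] [StarModule ℂ D]
  [Ring A] [Algebra ℂ A] [StarRing A] [StarModule ℂ A]
  [Ring B] [Algebra ℂ B] [StarRing B] [StarModule ℂ B]
  {f : D →⋆ₐ[ℂ] A} {g : D →⋆ₐ[ℂ] B} (P : StarAlgPushout D A B f g)

/-- The pushout of *-algebras is also a pushout of algebras. -/
theorem exists_algHom {E : Type} [Ring E] [Algebra ℂ E] (jA : A →ₐ[ℂ] E) (jB : B →ₐ[ℂ] E)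
    (h : ∀ d, jA (f d) = jB (g d)) :
    ∃ φ : P.carrier →ₐ[ℂ] E, (∀ a, φ (P.inl a) = jA a) ∧ ∀ b, φ (P.inr b) = jB b := by
  obtain ⟨φ, ⟨hA, hB⟩, -⟩ := P.univ (StarDouble E) (StarDouble.lift jA) (StarDouble.lift jB) <|
    StarAlgHom.ext fun d => Prod.ext (h d) <| congr_arg MulOpposite.op <| by
      change jA (star (f d)) = jB (star (g d))
      rw [← map_star f, ← map_star g, h]
  exact ⟨StarDouble.fst.comp φ.toAlgHom, fun a => congr_arg Prod.fst (DFunLike.congr_fun hA a),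
    fun b => congr_arg Prod.fst (DFunLike.congr_fun hB b)⟩

/-- The pushout is generated by the images of the two factors. -/
theorem adjoin_range_union_range :
    StarAlgebra.adjoin ℂ (Set.range P.inl ∪ Set.range P.inr) = ⊤ := by
  set T := StarAlgebra.adjoin ℂ (Set.range P.inl ∪ Set.range P.inr)
  have hA (a) : P.inl a ∈ T := StarAlgebra.subset_adjoin ℂ _ (.inl ⟨a, rfl⟩)
  have hB (b) : P.inr b ∈ T := StarAlgebra.subset_adjoin ℂ _ (.inr ⟨b, rfl⟩)
  obtain ⟨φ, ⟨hφA, hφB⟩, -⟩ := P.univ T (P.inl.codRestrict T hA) (P.inr.codRestrict T hB) <|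
    StarAlgHom.ext fun d => Subtype.ext (DFunLike.congr_fun P.comm d)
  have h : T.subtype.comp φ = StarAlgHom.id ℂ P.carrier := by
    refine (P.univ P.carrier P.inl P.inr P.comm).unique ⟨?_, ?_⟩ ⟨rfl, rfl⟩
    · rw [StarAlgHom.comp_assoc, hφA]
      rfl
    · rw [StarAlgHom.comp_assoc, hφB]
      rfl
  refine eq_top_iff.2 fun x _ => ?_
  rw [show x = φ x from (DFunLike.congr_fun h x).symm]
  exact (φ x).2

variable {P} in
/-- Induction principle for the elements of a pushout. -/
@[elab_as_elim]
theorem induction {p : P.carrier → Prop} (inl : ∀ a, p (P.inl a)) (inr : ∀ b, p (P.inr b))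
    (add : ∀ x y, p x → p y → p (x + y)) (mul : ∀ x y, p x → p y → p (x * y))
    (x : P.carrier) : p x := by
  have hx : x ∈ StarAlgebra.adjoin ℂ (Set.range P.inl ∪ Set.range P.inr) := by
    simp [adjoin_range_union_range]
  suffices p x ∧ p (star x) from this.1
  induction hx using StarAlgebra.adjoin_induction with
  | mem x hx =>
    obtain ⟨a, rfl⟩ | ⟨b, rfl⟩ := hx
    · exact ⟨inl a, by rw [← map_star]; exact inl _⟩
    · exact ⟨inr b, by rw [← map_star]; exact inr _⟩
  | algebraMap z =>
    have h (z : ℂ) : p (algebraMap ℂ P.carrier z) := by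
      rw [← AlgHomClass.commutes P.inl]
      exact inl _
    exact ⟨h z, by rw [← algebraMap_star_comm]; exact h _⟩
  | add x y _ _ hx hy => exact ⟨add _ _ hx.1 hy.1, by rw [star_add]; exact add _ _ hx.2 hy.2⟩
  | mul x y _ _ hx hy => exact ⟨mul _ _ hx.1 hy.1, by rw [star_mul]; exact mul _ _ hy.2 hx.2⟩
  | star x _ hx => exact ⟨hx.2, by rw [star_star]; exact hx.1⟩

end StarAlgPushout

/-- Corollary 2.14 of the paper: given *-embeddings `D → A → A'`, `D → B → B'` with
`D` finite-dimensional and semisimple, if `A' ∗_D B'` is residually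
finite-dimensional then so is `A ∗_D B`. -/
theorem starAlgPushout_isRFD_of_isRFD (D A B A' B' : Type)
    [Ring D] [Algebra ℂ D] [StarRing D] [StarModule ℂ D]
    [Ring A] [Algebra ℂ A] [StarRing A] [StarModule ℂ A]
    [Ring B] [Algebra ℂ B] [StarRing B] [StarModule ℂ B]
    [Ring A'] [Algebra ℂ A'] [StarRing A'] [StarModule ℂ A']
    [Ring B'] [Algebra ℂ B'] [StarRing B'] [StarModule ℂ B']
    (f : D →⋆ₐ[ℂ] A) (g : D →⋆ₐ[ℂ] B) (f' : A →⋆ₐ[ℂ] A') (g' : B →⋆ₐ[ℂ] B')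
    (hf : Function.Injective f) (hg : Function.Injective g)
    (hf' : Function.Injective f') (hg' : Function.Injective g')
    [FiniteDimensional ℂ D] [IsSemisimpleRing D]
    (P : StarAlgPushout D A B f g) (P' : StarAlgPushout D A' B' (f'.comp f) (g'.comp g))
    (hRFD : IsRFD P'.carrier) : IsRFD P.carrier := by
  obtain ⟨Φ, ⟨hΦA, hΦB⟩, -⟩ := P.univ P'.carrier (P'.inl.comp f') (P'.inr.comp g') P'.comm
  suffices hΦ : Function.Injective Φ by
    obtain ⟨I, n, ψ, hψ⟩ := hRFD
    exact ⟨I, n, ψ.comp Φ, hψ.comp hΦ⟩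
  cases subsingleton_or_nontrivial P.carrier
  · exact Function.injective_of_subsingleton _
  have : Nontrivial A := RingHom.domain_nontrivial (P.inl : A →+* P.carrier)
  have : Nontrivial A' := hf'.nontrivial
  have : Nontrivial B := RingHom.domain_nontrivial (P.inr : B →+* P.carrier)
  have : Nontrivial B' := hg'.nontrivial
  let S := ℕ ⊕ P.carrier ⊕ A' ⊕ B'
  have hP : Cardinal.mk P.carrier ≤ Cardinal.mk S :=
    Cardinal.mk_le_of_injective (Sum.inr_injective.comp Sum.inl_injective)
  have hA' : Cardinal.mk A' ≤ Cardinal.mk S := Cardinal.mk_le_of_injective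
    (Sum.inr_injective.comp (Sum.inr_injective.comp Sum.inl_injective))
  have hB' : Cardinal.mk B' ≤ Cardinal.mk S := Cardinal.mk_le_of_injective
    (Sum.inr_injective.comp (Sum.inr_injective.comp Sum.inr_injective))
  let : Module D P.carrier := Module.compHom P.carrier (P.inl.comp f : D →+* P.carrier)
  have hDA (d : D) (p : P.carrier) : d • p = P.inl (f d) * p := rfl
  have hDB (d : D) (p : P.carrier) : d • p = P.inr (g d) * p :=
    congr_arg (· * p) (DFunLike.congr_fun P.comm d)
  have : IsScalarTower ℂ D P.carrier := ⟨fun z d p => by simp [hDA]⟩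
  obtain ⟨ρA, hρA, hρA'⟩ := IsSemisimpleRing.exists_algHom_end_of_injective hA' hP
    f.toAlgHom hf f'.toAlgHom hf' P.inl.toAlgHom hDA
  obtain ⟨ρB, hρB, hρB'⟩ := IsSemisimpleRing.exists_algHom_end_of_injective hB' hP
    g.toAlgHom hg g'.toAlgHom hg' P.inr.toAlgHom hDB
  have hAB (d : D) : ρA (f' (f d)) = ρB (g' (g d)) :=
    LinearMap.ext fun x => (hρA d x).trans (hρB d x).symm
  obtain ⟨ρ, hinl, hinr⟩ := P'.exists_algHom
    (E := Module.End ℂ (P.carrier × (S →₀ D) × (S →₀ D))) ρA ρB hAB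
  have key (y : P.carrier) : ∀ p k, ∃ k', ρ (Φ y) (p, k, 0) = (y * p, k', 0) := by
    induction y using StarAlgPushout.induction with
    | inl a =>
      rw [show Φ (P.inl a) = P'.inl (f' a) from DFunLike.congr_fun hΦA a, hinl]
      exact hρA' a
    | inr b =>
      rw [show Φ (P.inr b) = P'.inr (g' b) from DFunLike.congr_fun hΦB b, hinr]
      exact hρB' b
    | add x y hx hy =>
      intro p k
      obtain ⟨k₁, h₁⟩ := hx p k
      obtain ⟨k₂, h₂⟩ := hy p k
      exact ⟨k₁ + k₂, by simp [h₁, h₂, add_mul]⟩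
    | mul x y hx hy =>
      intro p k
      obtain ⟨k₁, h₁⟩ := hy p k
      obtain ⟨k₂, h₂⟩ := hx (y * p) k₁
      exact ⟨k₂, by simp [h₁, h₂, mul_assoc]⟩
  rw [injective_iff_map_eq_zero]
  intro x hx
  obtain ⟨k, hk⟩ := key x 1 0
  rw [hx, map_zero, LinearMap.zero_apply, mul_one] at hk
  exact (congr_arg Prod.fst hk).symm
end
end
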